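/- arXiv:math/0609047 — 2 statements merged into one kernel-verified Lean document; each statement's English description precedes it below -/
import Mathlib

section
/- If an arrangement 𝓐 of topoplanes in ℝⁿ is projectivizable, then 𝓐 is affine, and parallelism is transitive on 𝓐: for distinct H, H', H'' ∈ 𝓐, if H ∩ H' = ∅ and H' ∩ H'' = ∅, then H ∩ H'' = ∅. -/
open Set

/-- The `i`-th coordinate hyperplane in `ℝⁿ` (by convention the whole space if `i ≥ n`). -/
def coordHyp (n i : ℕ) : Set (Fin n → ℝ) := {x | ∀ h : i < n, x ⟨i, h⟩ = 0}

/-- `H` is a topological hyperplane (topoplane) in `ℝⁿ`: some self-homeomorphism of `ℝⁿ`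
carries `H` onto the coordinate hyperplane `{x | x₁ = 0}`. -/
def IsTopoplane {n : ℕ} (H : Set (Fin n → ℝ)) : Prop :=
  ∃ e : (Fin n → ℝ) ≃ₜ (Fin n → ℝ), e '' H = coordHyp n 0

/-- `Z` is a relative topoplane in `Y ⊆ ℝⁿ`: `Z ⊆ Y` and some homeomorphism of `Y`
(with the subspace topology) onto some `ℝᵈ`, `d ≥ 1`, carries `Z` onto `{x | x₁ = 0}`. -/
def IsRelTopoplane {n : ℕ} (Y Z : Set (Fin n → ℝ)) : Prop :=
  Z ⊆ Y ∧ ∃ d : ℕ, 1 ≤ d ∧ ∃ φ : Y ≃ₜ (Fin d → ℝ),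
    φ '' {y : Y | (y : Fin n → ℝ) ∈ Z} = coordHyp d 0

/-- `Y` is a flat of the family `𝓗`: a nonempty intersection of a subfamily of `𝓗`
(the empty intersection being all of `ℝⁿ`). -/
def IsFlat {n : ℕ} (𝓗 : Set (Set (Fin n → ℝ))) (Y : Set (Fin n → ℝ)) : Prop :=
  (∃ 𝓢 ⊆ 𝓗, Y = ⋂₀ 𝓢) ∧ Y.Nonempty

/-- `𝓗` is an arrangement of topoplanes in `ℝⁿ`: a finite set of topoplanes such that for
every `H ∈ 𝓗` and every flat `Y`, either `Y ⊆ H`, or `H ∩ Y = ∅`, or `H ∩ Y` is a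
relative topoplane in `Y`. -/
def IsArrangement {n : ℕ} (𝓗 : Set (Set (Fin n → ℝ))) : Prop :=
  𝓗.Finite ∧ (∀ H ∈ 𝓗, IsTopoplane H) ∧
    ∀ H ∈ 𝓗, ∀ Y : Set (Fin n → ℝ), IsFlat 𝓗 Y →
      Y ⊆ H ∨ H ∩ Y = ∅ ∨ IsRelTopoplane Y (H ∩ Y)

/-- `Y` has dimension `d`: it is homeomorphic, in the subspace topology, to `ℝᵈ`. -/
def HasDim {n : ℕ} (Y : Set (Fin n → ℝ)) (d : ℕ) : Prop :=
  Nonempty (Y ≃ₜ (Fin d → ℝ))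

/-- Topoplanes `H₁`, `H₂` cross: some self-homeomorphism of `ℝⁿ` carries them
simultaneously onto the coordinate hyperplanes `{x | x₁ = 0}` and `{x | x₂ = 0}`. -/
def Crosses {n : ℕ} (H₁ H₂ : Set (Fin n → ℝ)) : Prop :=
  ∃ e : (Fin n → ℝ) ≃ₜ (Fin n → ℝ), e '' H₁ = coordHyp n 0 ∧ e '' H₂ = coordHyp n 1

/-- The pairwise condition for an arrangement to be affine: any two distinct members
are disjoint or cross. -/
def PairwiseAffine {n : ℕ} (𝓗 : Set (Set (Fin n → ℝ))) : Prop :=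
  ∀ H₁ ∈ 𝓗, ∀ H₂ ∈ 𝓗, H₁ ≠ H₂ → H₁ ∩ H₂ = ∅ ∨ Crosses H₁ H₂

/-- The unit `n`-sphere `Sⁿ ⊆ ℝ^{n+1}`, as a topological space. -/
abbrev Sph (n : ℕ) : Type :=
  ↥(Metric.sphere (0 : EuclideanSpace ℝ (Fin (n + 1))) 1)

/-- The equator `Sⁿ ∩ {x : x₁ = 0}` of `Sⁿ` (homeomorphic to `S^{n-1}`). -/
def sphEquator (n : ℕ) : Set (Sph n) :=
  {x | (x : EuclideanSpace ℝ (Fin (n + 1))) 0 = 0}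

/-- `𝓢` is an arrangement of pseudospheres in `Sⁿ`: a finite set of centrally symmetric
pseudospheres such that every subfamily intersection is homeomorphic to a sphere of some
dimension (possibly the empty sphere), and for every subfamily `𝓢'` and `S ∈ 𝓢` with
`⋂𝓢' ⊄ S`, some homeomorphism from `⋂𝓢'` onto a standard sphere `S^d` carries `S ∩ ⋂𝓢'`
onto an equator `S^{d-1}`. -/
def IsPseudosphereArr {n : ℕ} (𝓢 : Set (Set (Sph n))) : Prop :=
  𝓢.Finite ∧
  (∀ S ∈ 𝓢,
    (∀ x ∈ S, ∀ y : Sph n,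
      (y : EuclideanSpace ℝ (Fin (n + 1))) = -(x : EuclideanSpace ℝ (Fin (n + 1))) →
        y ∈ S) ∧
    ∃ e : Sph n ≃ₜ Sph n, e '' S = sphEquator n) ∧
  (∀ 𝓢' ⊆ 𝓢, ⋂₀ 𝓢' = (∅ : Set (Sph n)) ∨
    ∃ d : ℕ, Nonempty (↥(⋂₀ 𝓢') ≃ₜ Sph d)) ∧
  (∀ 𝓢' ⊆ 𝓢, ∀ S ∈ 𝓢, ¬⋂₀ 𝓢' ⊆ S →
    ∃ d : ℕ, ∃ ψ : ↥(⋂₀ 𝓢') ≃ₜ Sph d,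
      ψ '' {y : ↥(⋂₀ 𝓢') | (y : Sph n) ∈ S} = sphEquator d)

/-- `𝓐` is projectivizable: there are an arrangement of pseudospheres `𝓢` in `Sⁿ`, a
member `S₀ ∈ 𝓢`, a connected component `D` of `Sⁿ ∖ S₀` and a homeomorphism `f` from `ℝⁿ`
onto `D` with `{f(A) : A ∈ 𝓐} = {S ∩ D : S ∈ 𝓢, S ≠ S₀}`. -/
def Projectivizable {n : ℕ} (𝓐 : Set (Set (Fin n → ℝ))) : Prop :=
  ∃ 𝓢 : Set (Set (Sph n)), IsPseudosphereArr 𝓢 ∧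
    ∃ S₀ ∈ 𝓢, ∃ D : Set (Sph n),
      (∃ x ∈ S₀ᶜ, D = connectedComponentIn S₀ᶜ x) ∧
      ∃ f : (Fin n → ℝ) ≃ₜ ↥D,
        {B : Set (Sph n) | ∃ A ∈ 𝓐, B = Subtype.val '' (⇑f '' A)} =
          {B : Set (Sph n) | ∃ S ∈ 𝓢, S ≠ S₀ ∧ B = S ∩ D}

section NoRetraction

open Metric MeasureTheory

open Polynomial in
/-- `det (1 + t A)` is a combination, with coefficients depending only on `t`, of its values at
finitely many points chosen in advance. -/
lemma exists_interpolation_det_one_add_smul {E : Type*} [NormedAddCommGroup E] [NormedSpace ℝ E]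
    [FiniteDimensional ℝ E] {ε : ℝ} (hε : 0 < ε) :
    ∃ (s : Finset ℕ) (v L : ℕ → ℝ), (∀ i ∈ s, 0 ≤ v i ∧ v i < ε) ∧ ∑ i ∈ s, L i = 1 ∧
      ∀ A : E →L[ℝ] E, (ContinuousLinearMap.id ℝ E + A).det =
        ∑ i ∈ s, L i * (ContinuousLinearMap.id ℝ E + v i • A).det := by
  classical
  set b := Module.finBasis ℝ E
  set N := Module.finrank ℝ E
  set s := Finset.range (N + 1)
  set v : ℕ → ℝ := fun i ↦ ε * (i / (N + 1)) with hv
  have hinj : Set.InjOn v s := by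
    intro i _ j _ h
    have hN : (N : ℝ) + 1 ≠ 0 := by positivity
    simp only [hv] at h
    field_simp at h
    exact_mod_cast h
  refine ⟨s, v, fun i ↦ (Lagrange.basis s v i).eval 1, ?_, ?_, ?_⟩
  · intro i hi
    refine ⟨by positivity, ?_⟩
    have hi' : (i : ℝ) < N + 1 := by exact_mod_cast Finset.mem_range.1 hi
    have : (i : ℝ) / (N + 1) < 1 := by rw [div_lt_one (by positivity)]; exact hi'
    simp only [hv]; nlinarith
  · rw [← eval_finsetSum, Lagrange.sum_basis hinj (by simp [s]), eval_one]
  · intro A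
    set M := LinearMap.toMatrix b b (A : E →ₗ[ℝ] E)
    set P : ℝ[X] := Matrix.det ((X : ℝ[X]) • M.map C + (1 : Matrix _ _ ℝ).map C)
    have hdeg : P.degree < (s.card : ℕ) := by
      have : P.natDegree ≤ _ := Polynomial.natDegree_det_X_add_C_le M 1
      refine (degree_le_natDegree).trans_lt ?_
      simp only [Fintype.card_fin] at this
      have h2 : P.natDegree < s.card := by simp only [s, Finset.card_range]; omega
      exact_mod_cast h2
    have hev : ∀ t : ℝ, P.eval t = (ContinuousLinearMap.id ℝ E + t • A).det := by
      intro t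
      have h1 : P.eval t = Matrix.det (t • M + 1) := by
        rw [← coe_evalRingHom, RingHom.map_det]
        congr 1
        ext i j
        simp [Matrix.one_apply]
        split_ifs <;> simp [mul_comm]
      rw [h1, ContinuousLinearMap.det, ← LinearMap.det_toMatrix b]
      congr 1
      simp [M, add_comm]
    have h := Lagrange.eq_interpolate hinj hdeg
    have h1 := congrArg (eval 1) h
    rw [hev 1, one_smul] at h1
    rw [h1, Lagrange.interpolate_apply, eval_finsetSum]
    refine Finset.sum_congr rfl fun i _ ↦ ?_
    rw [eval_mul, eval_C, hev, mul_comm]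

/-- A Lipschitz map on a closed ball vanishing on the sphere stays Lipschitz when extended
by zero. -/
lemma lipschitzWith_indicator_closedBall {E : Type*} [NormedAddCommGroup E] [NormedSpace ℝ E]
    {g : E → E} {ρ : ℝ} {K : NNReal} (hg : LipschitzOnWith K g (closedBall 0 ρ))
    (h0 : ∀ x, ‖x‖ = ρ → g x = 0) :
    LipschitzWith K ((closedBall 0 ρ).indicator g) := by
  have key : ∀ x ∈ closedBall (0 : E) ρ, ∀ y ∉ closedBall (0 : E) ρ,
      dist (g x) 0 ≤ K * dist x y := by
    intro x hx y hy
    rw [mem_closedBall_zero_iff] at hx hy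
    have hc : ContinuousOn (fun t : ℝ ↦ ‖AffineMap.lineMap x y t‖) (Icc 0 1) := by
      fun_prop
    obtain ⟨t, ht, htz⟩ := intermediate_value_Icc (zero_le_one) hc
      (show ρ ∈ Icc _ _ by simp; exact ⟨hx, (not_le.1 hy).le⟩)
    simp only at htz
    have h1 := hg.dist_le_mul x (by simpa using hx) (AffineMap.lineMap x y t)
      (by simp only [mem_closedBall_zero_iff]; exact htz.le)
    rw [h0 _ htz] at h1
    refine h1.trans ?_
    gcongr
    rw [dist_left_lineMap]
    have : ‖t‖ ≤ 1 := by rw [Real.norm_of_nonneg ht.1]; exact ht.2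
    nlinarith [dist_nonneg (x := x) (y := y)]
  refine LipschitzWith.of_dist_le_mul fun x y ↦ ?_
  by_cases hx : x ∈ closedBall (0 : E) ρ <;> by_cases hy : y ∈ closedBall (0 : E) ρ
  · rw [indicator_of_mem hx, indicator_of_mem hy]; exact hg.dist_le_mul x hx y hy
  · rw [indicator_of_mem hx, indicator_of_notMem hy]; exact key x hx y hy
  · rw [indicator_of_mem hy, indicator_of_notMem hx, dist_comm, dist_comm x]; exact key y hy x hx
  · rw [indicator_of_notMem hy, indicator_of_notMem hx, dist_self]; positivity

/-- There is no `C¹` retraction of a ball onto its boundary sphere. -/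
theorem no_contDiff_retraction {E : Type*} [NormedAddCommGroup E] [InnerProductSpace ℝ E]
    [FiniteDimensional ℝ E] {f : E → E} (hf : ContDiff ℝ 1 f) {ρ : ℝ} (hρ : 0 < ρ)
    (h1 : ∀ x, ‖f x‖ = ρ) (h2 : ∀ x, ‖x‖ = ρ → f x = x) : False := by
  borelize E
  set g : E → E := fun x ↦ f x - x with hg
  have hgd : ContDiff ℝ 1 g := hf.sub contDiff_id
  set B : Set E := closedBall 0 ρ with hB
  have hBc : IsCompact B := isCompact_closedBall 0 ρ
  obtain ⟨K, hK0, hK⟩ : ∃ K : NNReal, 0 < K ∧ ∀ x ∈ B, ‖fderiv ℝ g x‖ ≤ K := by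
    obtain ⟨K, hK⟩ := (hBc.image (hgd.continuous_fderiv (by norm_num)).norm).bddAbove
    refine ⟨Real.toNNReal K + 1, by positivity, fun x hx ↦ ?_⟩
    have := hK ⟨x, hx, rfl⟩
    push_cast
    have h := Real.le_coe_toNNReal K
    linarith
  have hlip : LipschitzOnWith K g B :=
    (convex_closedBall 0 ρ).lipschitzOnWith_of_nnnorm_fderiv_le
      (fun x _ ↦ hgd.differentiable (by norm_num) x) (fun x hx ↦ by exact_mod_cast hK x hx)
  set G : E → E := B.indicator g with hG
  have hGlip : LipschitzWith K G :=
    lipschitzWith_indicator_closedBall hlip fun x hx ↦ by simp [hg, h2 x hx]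
  obtain ⟨ε, hε, hdet⟩ : ∃ ε > 0, ∀ A : E →L[ℝ] E, ‖A‖ < ε →
      0 < (ContinuousLinearMap.id ℝ E + A).det := by
    have hc : ContinuousAt (fun A : E →L[ℝ] E ↦ (ContinuousLinearMap.id ℝ E + A).det) 0 := by
      exact ((ContinuousLinearMap.continuous_det (𝕜 := ℝ) (E := E)).comp
        (continuous_const.add continuous_id)).continuousAt
    have hpos : 0 < (ContinuousLinearMap.id ℝ E + (0 : E →L[ℝ] E)).det := by
      rw [add_zero]; simp [ContinuousLinearMap.det]
    obtain ⟨ε, hε, h⟩ := Metric.eventually_nhds_iff.1 (hc.eventually (lt_mem_nhds hpos))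
    exact ⟨ε, hε, fun A hA ↦ h (by simpa using hA)⟩
  have hvol : ∀ t : ℝ, 0 ≤ t → t < min 1 ε / K →
      ∫ x in B, (ContinuousLinearMap.id ℝ E + t • fderiv ℝ g x).det = volume.real B := by
    intro t ht0 ht
    have htK : t * K < min 1 ε := by rwa [lt_div_iff₀ (by exact_mod_cast hK0)] at ht
    set T : E → E := fun x ↦ x + t • G x with hT
    set c : NNReal := Real.toNNReal t * K with hcdef
    have hct : (c : ℝ) = t * K := by rw [hcdef, NNReal.coe_mul, Real.coe_toNNReal t ht0]
    have happ : ApproximatesLinearOn T ((ContinuousLinearEquiv.refl ℝ E : E ≃L[ℝ] E) : E →L[ℝ] E)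
        univ c := by
      rw [ApproximatesLinearOn.approximatesLinearOn_iff_lipschitzOnWith]
      have : T - ⇑((ContinuousLinearEquiv.refl ℝ E : E ≃L[ℝ] E) : E →L[ℝ] E) =
          fun x ↦ t • G x := by
        ext x; simp [hT]
      rw [this]
      refine LipschitzOnWith.of_dist_le_mul fun x _ y _ ↦ ?_
      rw [dist_smul₀, Real.norm_of_nonneg ht0, hct, mul_assoc]
      exact mul_le_mul_of_nonneg_left (hGlip.dist_le_mul x y) ht0
    have hcc : Subsingleton E ∨
        c < ‖((ContinuousLinearEquiv.refl ℝ E).symm : E →L[ℝ] E)‖₊⁻¹ := by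
      rcases subsingleton_or_nontrivial E with h | h
      · exact Or.inl h
      · right
        have h1 : ‖((ContinuousLinearEquiv.refl ℝ E).symm : E →L[ℝ] E)‖₊ = 1 := by
          ext
          exact ContinuousLinearMap.norm_id
        rw [h1, inv_one]
        rw [← NNReal.coe_lt_coe, hct]
        exact htK.trans_le (min_le_left _ _)
    have hTinj : Function.Injective T := by
      have := happ.injOn hcc
      exact injOn_univ.1 this
    have hTsurj : Function.Surjective T := happ.surjective hcc
    have hoff : ∀ x ∉ B, T x = x := fun x hx ↦ by simp [hT, hG, hx]
    have himg : T '' B = B := by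
      have h3 : T '' Bᶜ = Bᶜ := by
        ext y; constructor
        · rintro ⟨x, hx, rfl⟩; rw [hoff x hx]; exact hx
        · intro hy; exact ⟨y, hy, hoff y hy⟩
      rw [← compl_inj_iff, ← image_compl_eq ⟨hTinj, hTsurj⟩, h3]
    have hder : ∀ x ∈ B, HasFDerivWithinAt T
        (ContinuousLinearMap.id ℝ E + t • fderiv ℝ g x) B x := by
      intro x hx
      have h3 : HasFDerivWithinAt (fun x ↦ x + t • g x)
          (ContinuousLinearMap.id ℝ E + t • fderiv ℝ g x) B x :=
        ((hasFDerivAt_id x).add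
          ((hgd.differentiable (by norm_num) x).hasFDerivAt.const_smul t)).hasFDerivWithinAt
      refine h3.congr (fun y hy ↦ ?_) ?_
      · simp [hT, hG, hy]
      · simp [hT, hG, hx]
    have h3 := integral_image_eq_integral_abs_det_fderiv_smul volume
      measurableSet_closedBall hder hTinj.injOn (fun _ ↦ (1 : ℝ))
    rw [himg] at h3
    simp only [integral_const, MeasurableSet.univ, measureReal_restrict_apply, univ_inter,
      smul_eq_mul, mul_one] at h3
    rw [h3]
    refine setIntegral_congr_fun measurableSet_closedBall fun x hx ↦ ?_
    rw [abs_of_pos]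
    apply hdet
    rw [norm_smul, Real.norm_of_nonneg ht0]
    calc t * ‖fderiv ℝ g x‖ ≤ t * K := mul_le_mul_of_nonneg_left (hK x hx) ht0
      _ < ε := htK.trans_le (min_le_right _ _)
  have hδ : 0 < min 1 ε / K := by positivity
  obtain ⟨s, v, L, hv, hL, hdet⟩ := exists_interpolation_det_one_add_smul (E := E) hδ
  have hcont : ∀ t : ℝ, Continuous fun x ↦
      (ContinuousLinearMap.id ℝ E + t • fderiv ℝ g x).det := by
    intro t
    exact (ContinuousLinearMap.continuous_det (𝕜 := ℝ) (E := E)).comp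
      (continuous_const.add ((hgd.continuous_fderiv (by norm_num)).const_smul t))
  have hone : ∫ x in B, (ContinuousLinearMap.id ℝ E + fderiv ℝ g x).det = volume.real B := by
    calc _ = ∫ x in B, ∑ i ∈ s, L i * (ContinuousLinearMap.id ℝ E + v i • fderiv ℝ g x).det := by
          exact integral_congr_ae (Filter.Eventually.of_forall fun x ↦ hdet _)
      _ = ∑ i ∈ s, L i * volume.real B := by
          rw [integral_finsetSum]
          · refine Finset.sum_congr rfl fun i hi ↦ ?_
            rw [integral_const_mul, hvol _ (hv i hi).1 (hv i hi).2]
          · intro i _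
            exact ((hcont _).const_mul _).continuousOn.integrableOn_compact hBc
      _ = _ := by rw [← Finset.sum_mul, hL, one_mul]
  have hzero : ∀ x, (ContinuousLinearMap.id ℝ E + fderiv ℝ g x).det = 0 := by
    intro x
    have hd := (hf.differentiable (by norm_num) x).hasFDerivAt
    have h3 : ContinuousLinearMap.id ℝ E + fderiv ℝ g x = fderiv ℝ f x := by
      have : fderiv ℝ g x = fderiv ℝ f x - ContinuousLinearMap.id ℝ E :=
        (hd.sub (hasFDerivAt_id x)).fderiv
      rw [this]; abel
    rw [h3]
    by_contra hne
    have hort : ∀ w, inner ℝ (f x) (fderiv ℝ f x w) = 0 := by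
      intro w
      have h4 := (hd.norm_sq).fderiv
      have h5 : (fun y ↦ ‖f y‖ ^ 2) = fun _ ↦ ρ ^ 2 := by ext y; rw [h1]
      rw [h5] at h4
      have := congrArg (fun A : E →L[ℝ] ℝ ↦ A w) h4
      simpa using this.symm
    have hsurj : Function.Surjective (fderiv ℝ f x) := by
      have : IsUnit (LinearMap.det (fderiv ℝ f x : E →ₗ[ℝ] E)) := isUnit_iff_ne_zero.2 hne
      exact (LinearEquiv.ofIsUnitDet (v := Module.finBasis ℝ E) (v' := Module.finBasis ℝ E)
        (f := (fderiv ℝ f x : E →ₗ[ℝ] E)) (by rwa [LinearMap.det_toMatrix])).surjective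
    obtain ⟨w, hw⟩ := hsurj (f x)
    have h6 := hort w
    rw [hw, inner_self_eq_zero] at h6
    have := h1 x
    rw [h6, norm_zero] at this
    exact hρ.ne this
  simp_rw [hzero] at hone
  rw [integral_zero] at hone
  have : 0 < volume.real B :=
    ENNReal.toReal_pos (measure_closedBall_pos _ _ hρ).ne' measure_closedBall_lt_top.ne
  linarith

/-- A continuous self-map of `E` which is the identity far away has a zero. -/
theorem exists_zero_of_eqOn_compl_ball {E : Type*} [NormedAddCommGroup E] [InnerProductSpace ℝ E]
    [FiniteDimensional ℝ E] {F : E → E} (hF : Continuous F) {R : ℝ}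
    (hR : ∀ x, R ≤ ‖x‖ → F x = x) : ∃ x, F x = 0 := by
  by_contra! hne
  wlog hR1 : 1 ≤ R generalizing R
  · exact this (R := 1) (fun x hx ↦ hR x (by linarith [not_le.1 hR1])) le_rfl
  obtain ⟨c, hc, hc1, hFc⟩ : ∃ c : ℝ, 0 < c ∧ c ≤ 1 ∧ ∀ x, c ≤ ‖F x‖ := by
    obtain ⟨c, hc, h⟩ : ∃ c : ℝ, 0 < c ∧ ∀ x ∈ closedBall (0 : E) R, c ≤ ‖F x‖ := by
      obtain ⟨x, _, hx⟩ := (isCompact_closedBall (0 : E) R).exists_isMinOn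
        ⟨0, by simp; linarith⟩ hF.norm.continuousOn
      exact ⟨‖F x‖, norm_pos_iff.2 (hne x), hx⟩
    refine ⟨min c 1, by positivity, min_le_right _ _, fun x ↦ ?_⟩
    by_cases hx : ‖x‖ ≤ R
    · exact (min_le_left _ _).trans (h x (by simpa using hx))
    · rw [hR x (not_le.1 hx).le]
      exact (min_le_right _ _).trans (hR1.trans (not_le.1 hx).le)
  have huc : UniformContinuous fun x ↦ F x - x := by
    refine Continuous.uniformContinuous_of_tendsto_cocompact (x := 0) (hF.sub continuous_id) ?_
    refine tendsto_const_nhds.congr' ?_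
    filter_upwards [(isCompact_closedBall (0 : E) R).compl_mem_cocompact] with x hx
    rw [hR x (by simp at hx; exact hx.le), sub_self]
  obtain ⟨g, hg, hgd⟩ := huc.exists_contDiff_dist_le (half_pos hc)
  let χ : ContDiffBump (0 : E) := ⟨R, R + 1, by linarith, by linarith⟩
  set f : E → E := fun x ↦ x + χ x • g x with hf
  have hfd : ContDiff ℝ 1 f :=
    contDiff_id.add ((χ.contDiff).smul (hg.of_le (by simp)))
  have hfx : ∀ x, f x ≠ 0 := by
    intro x h
    have h1 : dist (f x) (F x) < c := by
      have e1 : f x - F x = χ x • (g x - (F x - x)) + (1 - χ x) • (x - F x) := by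
        simp only [hf]; module
      have e2 : (1 - χ x) • (x - F x) = 0 := by
        by_cases hx : ‖x‖ ≤ R
        · rw [χ.one_of_mem_closedBall (by simpa using hx)]; simp
        · rw [hR x (not_le.1 hx).le]; simp
      rw [dist_eq_norm, e1, e2, add_zero, norm_smul, Real.norm_of_nonneg χ.nonneg]
      have := hgd x
      rw [dist_eq_norm] at this
      have h3 := χ.le_one (x := x)
      have h4 := χ.nonneg (x := x)
      nlinarith [norm_nonneg (g x - (F x - x))]
    rw [h, dist_zero_left] at h1
    exact (hFc x).not_gt h1
  have hfar : ∀ x, ‖x‖ = R + 1 → f x = x := by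
    intro x hx
    simp only [hf]
    rw [χ.zero_of_le_dist (by simp [hx]; exact le_rfl), zero_smul, add_zero]
  refine no_contDiff_retraction (f := fun x ↦ ((R + 1) / ‖f x‖) • f x) (ρ := R + 1)
    ?_ (by linarith) ?_ ?_
  · exact (contDiff_const.div (hfd.norm ℝ hfx) fun x ↦ norm_ne_zero_iff.2 (hfx x)).smul hfd
  · intro x
    have := norm_pos_iff.2 (hfx x)
    rw [norm_smul, norm_div, norm_norm, Real.norm_of_nonneg (by linarith)]
    field_simp
  · intro x hx
    rw [hfar x hx, hx, div_self (by linarith), one_smul]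

end NoRetraction

section InvarianceOfDimension

open Metric

/-- A space of larger dimension is not a continuous retract of one of smaller dimension. -/
theorem finrank_le_of_leftInverse {E E' : Type*} [NormedAddCommGroup E] [InnerProductSpace ℝ E]
    [FiniteDimensional ℝ E] [NormedAddCommGroup E'] [InnerProductSpace ℝ E']
    [FiniteDimensional ℝ E'] {c : E' → E} {h : E → E'} (hc : Continuous c) (hh : Continuous h)
    (hhc : Function.LeftInverse h c) : Module.finrank ℝ E' ≤ Module.finrank ℝ E := by
  by_contra! hlt
  have hK : IsCompact (c '' closedBall 0 2) := (isCompact_closedBall 0 2).image hc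
  obtain ⟨R, hR0, hR⟩ : ∃ R : ℝ, 0 < R ∧ ∀ x ∈ c '' closedBall 0 2, ‖x‖ ≤ R := by
    obtain ⟨R, hR⟩ := hK.isBounded.exists_norm_le
    exact ⟨max R 1, by positivity, fun x hx ↦ (hR x hx).trans (le_max_left _ _)⟩
  let χ : ContDiffBump (0 : E) := ⟨R, R + 1, hR0, by linarith⟩
  have huc : UniformContinuous fun x ↦ χ x • h x := by
    refine Continuous.uniformContinuous_of_tendsto_cocompact (x := 0)
      (χ.continuous.smul hh) ?_
    refine tendsto_const_nhds.congr' ?_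
    filter_upwards [(isCompact_closedBall (0 : E) (R + 1)).compl_mem_cocompact] with x hx
    rw [χ.zero_of_le_dist (by simp at hx; simpa using hx.le), zero_smul]
  obtain ⟨g, hg, hgd⟩ := huc.exists_contDiff_dist_le (show (0 : ℝ) < 1 / 2 by norm_num)
  have hgh : ∀ x : E', ‖x‖ ≤ 2 → dist (g (c x)) x < 1 / 2 := by
    intro x hx
    have := hgd (c x)
    rwa [χ.one_of_mem_closedBall
      (by simpa using hR _ ⟨x, by simpa using hx, rfl⟩), one_smul, hhc] at this
  obtain ⟨w, hw, hwb⟩ : ∃ w, w ∉ range g ∧ ‖w‖ < 1 / 4 := by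
    have := (hg.of_le (m := 1) (by simp)).dense_compl_range_of_finrank_lt_finrank hlt
    obtain ⟨w, hw1, hw2⟩ := this.exists_mem_open (isOpen_ball (x := (0 : E')) (ε := 1 / 4))
      ⟨0, by simp⟩
    exact ⟨w, hw1, by simpa using hw2⟩
  set F : E' → E' := fun x ↦ x + max 0 (min 1 (2 - ‖x‖)) • (g (c x) - w - x) with hF
  have hgc := hg.continuous
  obtain ⟨x, hx⟩ := exists_zero_of_eqOn_compl_ball (F := F) (R := 2) (by fun_prop) (by
    intro x hx
    have : max 0 (min 1 (2 - ‖x‖)) = 0 := by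
      rw [max_eq_left]; exact (min_le_right _ _).trans (by linarith)
    simp [hF, this])
  simp only [hF] at hx
  rcases le_total ‖x‖ 1 with h1 | h1
  · have : max 0 (min 1 (2 - ‖x‖)) = 1 := by
      rw [min_eq_left (by linarith), max_eq_right (by norm_num)]
    rw [this, one_smul, add_sub_cancel, sub_eq_zero] at hx
    exact hw ⟨_, hx⟩
  rcases le_total 2 ‖x‖ with h2 | h2
  · have : max 0 (min 1 (2 - ‖x‖)) = 0 := by
      rw [max_eq_left]; exact (min_le_right _ _).trans (by linarith)
    rw [this, zero_smul, add_zero] at hx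
    rw [hx, norm_zero] at h2
    linarith
  · have h3 := hgh x h2
    rw [dist_eq_norm] at h3
    have h4 : ‖x‖ = ‖max 0 (min 1 (2 - ‖x‖)) • (g (c x) - w - x)‖ := by
      conv_lhs => rw [← norm_neg x, neg_eq_of_add_eq_zero_right hx]
    rw [norm_smul, Real.norm_of_nonneg (le_max_left _ _)] at h4
    have h5 : max 0 (min 1 (2 - ‖x‖)) ≤ 1 := max_le (by norm_num) (min_le_left _ _)
    have h6 : ‖g (c x) - w - x‖ ≤ ‖g (c x) - x‖ + ‖w‖ := by
      rw [show g (c x) - w - x = (g (c x) - x) - w by abel]; exact norm_sub_le _ _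
    nlinarith [norm_nonneg (g (c x) - w - x)]

/-- Invariance of dimension. -/
theorem eq_of_homeomorph_pi {d d' : ℕ} (h : (Fin d → ℝ) ≃ₜ (Fin d' → ℝ)) : d = d' := by
  have key : ∀ {d d' : ℕ}, ((Fin d → ℝ) ≃ₜ (Fin d' → ℝ)) → d ≤ d' := by
    intro d d' h
    let k : EuclideanSpace ℝ (Fin d) ≃ₜ EuclideanSpace ℝ (Fin d') :=
      ((EuclideanSpace.equiv (Fin d) ℝ).toHomeomorph.trans h).trans
        (EuclideanSpace.equiv (Fin d') ℝ).toHomeomorph.symm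
    simpa using finrank_le_of_leftInverse k.continuous k.symm.continuous k.left_inv
  exact le_antisymm (key h) (key h.symm)

open Classical in
/-- The radial extension of a map between unit spheres. -/
noncomputable def sphereCone {E E' : Type*} [NormedAddCommGroup E] [NormedSpace ℝ E]
    [NormedAddCommGroup E'] [NormedSpace ℝ E'] (h : sphere (0 : E) 1 → sphere (0 : E') 1)
    (x : E) : E' :=
  if hx : x = 0 then 0 else ‖x‖ • (h ⟨‖x‖⁻¹ • x, by simp [norm_smul, hx]⟩ : E')

section Cone

variable {E E' : Type*} [NormedAddCommGroup E] [NormedSpace ℝ E]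
  [NormedAddCommGroup E'] [NormedSpace ℝ E']

lemma norm_sphereCone (h : sphere (0 : E) 1 → sphere (0 : E') 1) (x : E) :
    ‖sphereCone h x‖ = ‖x‖ := by
  unfold sphereCone
  split_ifs with hx
  · simp [hx]
  · rw [norm_smul, norm_norm, norm_eq_of_mem_sphere, mul_one]

lemma continuous_sphereCone {h : sphere (0 : E) 1 → sphere (0 : E') 1} (hh : Continuous h) :
    Continuous (sphereCone h) := by
  rw [continuous_iff_continuousAt]
  intro x
  by_cases hx : x = 0
  · rw [hx, ContinuousAt, show sphereCone h 0 = 0 by simp [sphereCone],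
      tendsto_zero_iff_norm_tendsto_zero]
    simp_rw [norm_sphereCone]
    simpa using (continuous_norm (E := E)).tendsto 0
  · have ho : IsOpen {y : E | y ≠ 0} := isOpen_ne
    refine ContinuousOn.continuousAt (s := {y | y ≠ 0}) ?_ (ho.mem_nhds hx)
    rw [continuousOn_iff_continuous_domRestrict]
    have : ({y | y ≠ 0} : Set E).domRestrict (sphereCone h) = fun y : {y : E | y ≠ 0} ↦
        ‖(y : E)‖ • (h ⟨‖(y : E)‖⁻¹ • (y : E), by simp [norm_smul, show (y : E) ≠ 0 from y.2]⟩ :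
          E') := by
      ext y; simp [sphereCone, show (y : E) ≠ 0 from y.2]
    rw [this]
    refine Continuous.smul (by fun_prop) (continuous_subtype_val.comp (hh.comp ?_))
    refine Continuous.subtype_mk (Continuous.smul (Continuous.inv₀ (by fun_prop) ?_)
      (by fun_prop)) _
    intro y; exact norm_ne_zero_iff.2 y.2

lemma sphereCone_leftInverse {h : sphere (0 : E) 1 → sphere (0 : E') 1}
    {k : sphere (0 : E') 1 → sphere (0 : E) 1} (hk : Function.LeftInverse k h) :
    Function.LeftInverse (sphereCone k) (sphereCone h) := by
  intro x
  by_cases hx : x = 0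
  · simp [sphereCone, hx]
  have hx' : ‖x‖ ≠ 0 := norm_ne_zero_iff.2 hx
  have h1 : sphereCone h x ≠ 0 := by rw [← norm_ne_zero_iff, norm_sphereCone]; exact hx'
  have h2 : (⟨‖sphereCone h x‖⁻¹ • sphereCone h x, by simp [norm_smul, h1]⟩ :
      sphere (0 : E') 1) = h ⟨‖x‖⁻¹ • x, by simp [norm_smul, hx]⟩ := by
    ext1
    simp only [norm_sphereCone]
    rw [sphereCone, dif_neg hx]
    exact inv_smul_smul₀ hx' _
  rw [sphereCone, dif_neg h1, h2, hk, norm_sphereCone, smul_smul, mul_inv_cancel₀ hx', one_smul]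

end Cone

theorem eq_of_homeomorph_sph {d d' : ℕ} (h : Sph d ≃ₜ Sph d') : d = d' := by
  have key : ∀ {d d' : ℕ}, (Sph d ≃ₜ Sph d') → d ≤ d' := by
    intro d d' h
    simpa using finrank_le_of_leftInverse (continuous_sphereCone h.continuous)
      (continuous_sphereCone h.symm.continuous) (sphereCone_leftInverse h.left_inv)
  exact le_antisymm (key h) (key h.symm)

/-- The equator of `S^{d+1}` is a sphere of dimension `d`. -/
noncomputable def sphEquatorHomeomorph (d : ℕ) : sphEquator (d + 1) ≃ₜ Sph d where
  toFun x := ⟨WithLp.toLp 2 fun i ↦ (x : EuclideanSpace ℝ (Fin (d + 2))) i.succ, by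
    have h1 := x.1.2
    have h2 : (x.1 : EuclideanSpace ℝ (Fin (d + 2))) 0 = 0 := x.2
    rw [mem_sphere_zero_iff_norm, ← sq_eq_sq₀ (norm_nonneg _) (by norm_num),
      EuclideanSpace.norm_sq_eq] at h1 ⊢
    rw [Fin.sum_univ_succ, h2] at h1
    simpa using h1⟩
  invFun y := ⟨⟨WithLp.toLp 2 (Fin.cons 0 fun i ↦ (y : EuclideanSpace ℝ (Fin (d + 1))) i), by
    have h1 := y.2
    rw [mem_sphere_zero_iff_norm, ← sq_eq_sq₀ (norm_nonneg _) (by norm_num),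
      EuclideanSpace.norm_sq_eq] at h1 ⊢
    rw [Fin.sum_univ_succ]
    simpa using h1⟩, by simp [sphEquator]⟩
  left_inv x := by
    have h2 : (x.1 : EuclideanSpace ℝ (Fin (d + 2))) 0 = 0 := x.2
    ext i
    refine Fin.cases ?_ (fun i ↦ ?_) i
    · simp [h2]
    · simp
  right_inv y := by ext i; simp
  continuous_toFun := by
    refine Continuous.subtype_mk ?_ _
    fun_prop
  continuous_invFun := by
    refine Continuous.subtype_mk (Continuous.subtype_mk ?_ _) _
    refine (PiLp.continuous_toLp 2 _).comp (continuous_pi fun i ↦ ?_)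
    refine Fin.cases ?_ (fun i ↦ ?_) i
    · simpa using continuous_const
    · simp only [Fin.cons_succ]; fun_prop

lemma sphEquator_zero : sphEquator 0 = ∅ := by
  ext x
  simp only [sphEquator, mem_ofPred_eq, mem_empty_iff_false, iff_false]
  intro h
  have h1 := x.2
  rw [mem_sphere_zero_iff_norm, ← sq_eq_sq₀ (norm_nonneg _) (by norm_num),
    EuclideanSpace.norm_sq_eq] at h1
  simp [h] at h1

instance sph_nonempty (d : ℕ) : Nonempty (Sph d) :=
  ⟨⟨EuclideanSpace.single 0 1, by simp⟩⟩

lemma isEmpty_homeomorph_sph_sphEquator (k : ℕ) : IsEmpty (Sph k ≃ₜ sphEquator k) := by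
  refine ⟨fun h ↦ ?_⟩
  cases k with
  | zero =>
    have key : ∀ z, z ∉ sphEquator 0 := by simp [sphEquator_zero]
    exact key _ (h (sph_nonempty 0).some).2
  | succ d =>
    have := eq_of_homeomorph_sph (h.trans (sphEquatorHomeomorph d))
    omega

/-- The coordinate hyperplane in `ℝ^{d+1}` is homeomorphic to `ℝᵈ`. -/
def coordHypHomeomorph (d : ℕ) : coordHyp (d + 1) 0 ≃ₜ (Fin d → ℝ) where
  toFun x i := (x : Fin (d + 1) → ℝ) i.succ
  invFun y := ⟨Fin.cons 0 y, fun _ ↦ rfl⟩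
  left_inv x := by
    have h2 : (x : Fin (d + 1) → ℝ) 0 = 0 := x.2 (Nat.succ_pos d)
    ext i
    refine Fin.cases ?_ (fun i ↦ ?_) i
    · simp [h2]
    · simp
  right_inv y := by ext i; simp
  continuous_toFun :=
    continuous_pi fun i ↦ (continuous_apply i.succ).comp continuous_subtype_val
  continuous_invFun := by
    refine Continuous.subtype_mk (continuous_pi fun i ↦ ?_) _
    refine Fin.cases ?_ (fun i ↦ ?_) i
    · simpa using continuous_const
    · simp only [Fin.cons_succ]; fun_prop

end InvarianceOfDimension

section Antipode

open Metric

/-- Brouwer's fixed point theorem for the unit ball. -/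
theorem exists_fixedPoint_of_mapsTo_closedBall {E : Type*} [NormedAddCommGroup E]
    [InnerProductSpace ℝ E] [FiniteDimensional ℝ E] {G : E → E} (hG : Continuous G)
    (hB : MapsTo G (closedBall 0 1) (closedBall 0 1)) : ∃ x, ‖x‖ ≤ 1 ∧ G x = x := by
  have hp1 : ∀ x : E, ‖(max 1 ‖x‖)⁻¹ • x‖ ≤ 1 := by
    intro x
    have : 0 < max 1 ‖x‖ := by positivity
    rw [norm_smul, norm_inv, Real.norm_of_nonneg this.le, inv_mul_le_iff₀ this, mul_one]
    exact le_max_right _ _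
  have hpc : Continuous fun x : E ↦ (max 1 ‖x‖)⁻¹ • x :=
    Continuous.smul (Continuous.inv₀ (by fun_prop) fun x ↦ by positivity) continuous_id
  obtain ⟨x, hx⟩ := exists_zero_of_eqOn_compl_ball
    (F := fun x ↦ x - max 0 (min 1 (2 - ‖x‖)) • G ((max 1 ‖x‖)⁻¹ • x)) (R := 2)
    (by fun_prop) (by
      intro x hx
      have : max 0 (min 1 (2 - ‖x‖)) = 0 := by
        rw [max_eq_left]; exact (min_le_right _ _).trans (by linarith)
      simp [this])
  simp only [sub_eq_zero] at hx
  have hG1 : ‖G ((max 1 ‖x‖)⁻¹ • x)‖ ≤ 1 := by simpa using hB (by simpa using hp1 x)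
  have h5 : max 0 (min 1 (2 - ‖x‖)) ≤ 1 := max_le (by norm_num) (min_le_left _ _)
  have h6 : 0 ≤ max 0 (min 1 (2 - ‖x‖)) := le_max_left _ _
  have hx1 : ‖x‖ ≤ 1 := by
    rw [hx, norm_smul, Real.norm_of_nonneg h6]
    nlinarith [norm_nonneg (G ((max 1 ‖x‖)⁻¹ • x))]
  refine ⟨x, hx1, ?_⟩
  rw [max_eq_left hx1, min_eq_left (by linarith), max_eq_right zero_le_one, inv_one, one_smul,
    one_smul] at hx
  exact hx.symm

/-- The point of the closed upper hemisphere above the radial projection of `y` to the unit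
ball. -/
noncomputable def hemisphereLift (d : ℕ) (y : EuclideanSpace ℝ (Fin d)) : Sph d :=
  ⟨WithLp.toLp 2 (Fin.cons (√(1 - ‖(max 1 ‖y‖)⁻¹ • y‖ ^ 2))
    fun i ↦ ((max 1 ‖y‖)⁻¹ • y) i), by
    have h0 : 0 < max 1 ‖y‖ := by positivity
    have h1 : ‖(max 1 ‖y‖)⁻¹ • y‖ ≤ 1 := by
      rw [norm_smul, norm_inv, Real.norm_of_nonneg h0.le, inv_mul_le_iff₀ h0, mul_one]
      exact le_max_right _ _
    have h2 : 0 ≤ 1 - ‖(max 1 ‖y‖)⁻¹ • y‖ ^ 2 := by nlinarith [norm_nonneg ((max 1 ‖y‖)⁻¹ • y)]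
    rw [mem_sphere_zero_iff_norm, ← sq_eq_sq₀ (norm_nonneg _) (by norm_num),
      EuclideanSpace.norm_sq_eq, Fin.sum_univ_succ]
    simp only [Fin.cons_zero, Fin.cons_succ, Real.norm_eq_abs, sq_abs, Real.sq_sqrt h2]
    rw [EuclideanSpace.norm_sq_eq]
    simp [mul_pow]⟩

lemma continuous_hemisphereLift (d : ℕ) : Continuous (hemisphereLift d) := by
  have hpc : Continuous fun x : EuclideanSpace ℝ (Fin d) ↦ (max 1 ‖x‖)⁻¹ • x :=
    Continuous.smul (Continuous.inv₀ (continuous_const.max continuous_norm)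
      fun x ↦ (lt_max_of_lt_left one_pos).ne') continuous_id
  refine Continuous.subtype_mk ((PiLp.continuous_toLp 2 _).comp (continuous_pi fun i ↦ ?_)) _
  refine Fin.cases ?_ (fun i ↦ ?_) i
  · simp only [Fin.cons_zero]; fun_prop
  · simp only [Fin.cons_succ]; exact (PiLp.continuous_apply 2 _ i).comp hpc

lemma hemisphereLift_zero_nonneg (d : ℕ) (y : EuclideanSpace ℝ (Fin d)) :
    0 ≤ (hemisphereLift d y : EuclideanSpace ℝ (Fin (d + 1))) 0 :=
  Real.sqrt_nonneg _

lemma hemisphereLift_succ {d : ℕ} {y : EuclideanSpace ℝ (Fin d)} (hy : ‖y‖ ≤ 1) (i : Fin d) :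
    (hemisphereLift d y : EuclideanSpace ℝ (Fin (d + 1))) i.succ = y i := by
  simp [hemisphereLift, max_eq_left hy]

/-- Forget the first coordinate. -/
noncomputable def sphTail {d : ℕ} (x : Sph d) : EuclideanSpace ℝ (Fin d) :=
  WithLp.toLp 2 fun i ↦ (x : EuclideanSpace ℝ (Fin (d + 1))) i.succ

lemma norm_sphTail_sq {d : ℕ} (x : Sph d) :
    ((x : EuclideanSpace ℝ (Fin (d + 1))) 0) ^ 2 + ‖sphTail x‖ ^ 2 = 1 := by
  have h1 := x.2
  rw [mem_sphere_zero_iff_norm, ← sq_eq_sq₀ (norm_nonneg _) (by norm_num),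
    EuclideanSpace.norm_sq_eq, Fin.sum_univ_succ] at h1
  rw [EuclideanSpace.norm_sq_eq]
  simpa [sphTail] using h1

lemma norm_sphTail_le {d : ℕ} (x : Sph d) : ‖sphTail x‖ ≤ 1 := by
  nlinarith [norm_sphTail_sq x, norm_nonneg (sphTail x),
    sq_nonneg ((x : EuclideanSpace ℝ (Fin (d + 1))) 0)]

lemma eq_of_sphTail_eq {d : ℕ} {x y : Sph d} (hx : 0 ≤ (x : EuclideanSpace ℝ (Fin (d + 1))) 0)
    (hy : 0 ≤ (y : EuclideanSpace ℝ (Fin (d + 1))) 0) (h : sphTail x = sphTail y) : x = y := by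
  have h1 := norm_sphTail_sq x
  have h2 := norm_sphTail_sq y
  have h0 : (x : EuclideanSpace ℝ (Fin (d + 1))) 0 = (y : EuclideanSpace ℝ (Fin (d + 1))) 0 := by
    rw [← sq_eq_sq₀ hx hy]; rw [h] at h1; linarith
  ext i
  refine Fin.cases h0 (fun i ↦ ?_) i
  exact congrArg (fun z : EuclideanSpace ℝ (Fin d) ↦ z i) h

lemma sphTail_hemisphereLift {d : ℕ} {y : EuclideanSpace ℝ (Fin d)} (hy : ‖y‖ ≤ 1) :
    sphTail (hemisphereLift d y) = y := by
  ext i; exact hemisphereLift_succ hy i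

lemma hemisphere_pos_eq_image (d : ℕ) :
    {x : Sph d | 0 < (x : EuclideanSpace ℝ (Fin (d + 1))) 0} = hemisphereLift d '' ball 0 1 := by
  ext x
  constructor
  · intro hx
    have hx' : 0 < (x : EuclideanSpace ℝ (Fin (d + 1))) 0 := hx
    refine ⟨sphTail x, ?_, ?_⟩
    · rw [mem_ball_zero_iff]
      nlinarith [norm_sphTail_sq x, norm_nonneg (sphTail x)]
    · exact eq_of_sphTail_eq (hemisphereLift_zero_nonneg _ _) hx'.le
        (sphTail_hemisphereLift (norm_sphTail_le x))
  · rintro ⟨y, hy, rfl⟩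
    rw [mem_ball_zero_iff] at hy
    refine (hemisphereLift_zero_nonneg _ _).lt_of_ne' fun h ↦ ?_
    have := norm_sphTail_sq (hemisphereLift d y)
    rw [h, sphTail_hemisphereLift hy.le] at this
    nlinarith [norm_nonneg y]

lemma isPreconnected_hemisphere_pos (d : ℕ) :
    IsPreconnected {x : Sph d | 0 < (x : EuclideanSpace ℝ (Fin (d + 1))) 0} := by
  rw [hemisphere_pos_eq_image]
  exact (convex_ball 0 1).isPreconnected.image _ (continuous_hemisphereLift d).continuousOn

/-- The antipodal map. -/
noncomputable def antipode (d : ℕ) : Sph d ≃ₜ Sph d where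
  toFun x := -x
  invFun x := -x
  left_inv := neg_neg
  right_inv := neg_neg
  continuous_toFun := continuous_neg
  continuous_invFun := continuous_neg

lemma antipode_antipode {d : ℕ} (x : Sph d) : antipode d (antipode d x) = x := neg_neg x

lemma antipode_apply {d : ℕ} (x : Sph d) (i : Fin (d + 1)) :
    (antipode d x : EuclideanSpace ℝ (Fin (d + 1))) i =
      -(x : EuclideanSpace ℝ (Fin (d + 1))) i := rfl

lemma antipode_ne {d : ℕ} (x : Sph d) : antipode d x ≠ x := by
  intro h
  have h1 : -(x : EuclideanSpace ℝ (Fin (d + 1))) = x := congrArg Subtype.val h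
  have h2 : (x : EuclideanSpace ℝ (Fin (d + 1))) = 0 := by
    have h3 : (2 : ℝ) • (x : EuclideanSpace ℝ (Fin (d + 1))) = 0 := by
      rw [two_smul]; nth_rewrite 1 [← h1]; exact neg_add_cancel _
    exact (smul_eq_zero.1 h3).resolve_left two_ne_zero
  have := x.2
  rw [mem_sphere_zero_iff_norm, h2, norm_zero] at this
  norm_num at this

lemma hemisphere_neg_eq_image (d : ℕ) :
    {x : Sph d | (x : EuclideanSpace ℝ (Fin (d + 1))) 0 < 0} =
      antipode d '' {x : Sph d | 0 < (x : EuclideanSpace ℝ (Fin (d + 1))) 0} := by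
  ext x
  constructor
  · intro hx
    exact ⟨antipode d x, by simpa [antipode_apply] using hx, antipode_antipode x⟩
  · rintro ⟨y, hy, rfl⟩
    simpa [antipode_apply] using hy

lemma isPreconnected_hemisphere_neg (d : ℕ) :
    IsPreconnected {x : Sph d | (x : EuclideanSpace ℝ (Fin (d + 1))) 0 < 0} := by
  rw [hemisphere_neg_eq_image]
  exact (isPreconnected_hemisphere_pos d).image _ (antipode d).continuous.continuousOn

lemma mem_closure_hemisphere_pos {d : ℕ} {x : Sph d} (hx : x ∈ sphEquator d) :
    x ∈ closure {x : Sph d | 0 < (x : EuclideanSpace ℝ (Fin (d + 1))) 0} := by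
  have hx0 : (x : EuclideanSpace ℝ (Fin (d + 1))) 0 = 0 := hx
  have h1 : hemisphereLift d (sphTail x) = x :=
    eq_of_sphTail_eq (hemisphereLift_zero_nonneg _ _) hx0.ge
      (sphTail_hemisphereLift (norm_sphTail_le x))
  rw [hemisphere_pos_eq_image, ← h1]
  refine map_mem_closure (continuous_hemisphereLift d) (s := ball 0 1) ?_ (mapsTo_image _ _)
  rw [closure_ball _ one_ne_zero, mem_closedBall_zero_iff]
  exact norm_sphTail_le x

lemma mem_closure_hemisphere_neg {d : ℕ} {x : Sph d} (hx : x ∈ sphEquator d) :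
    x ∈ closure {x : Sph d | (x : EuclideanSpace ℝ (Fin (d + 1))) 0 < 0} := by
  have h1 : antipode d x ∈ sphEquator d := by
    have hx0 : (x : EuclideanSpace ℝ (Fin (d + 1))) 0 = 0 := hx
    change -(x : EuclideanSpace ℝ (Fin (d + 1))) 0 = 0
    rw [hx0, neg_zero]
  rw [hemisphere_neg_eq_image, ← antipode_antipode x]
  exact map_mem_closure (antipode d).continuous (mem_closure_hemisphere_pos h1) (mapsTo_image _ _)

/-- A preconnected set on which a continuous real function does not vanish, and which contains a
point where it is positive, lies in the positive region. -/
lemma pos_of_isPreconnected {X : Type*} [TopologicalSpace X] {U : Set X} (hU : IsPreconnected U)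
    {φ : X → ℝ} (hφ : ContinuousOn φ U) (h0 : ∀ x ∈ U, φ x ≠ 0) {a : X} (ha : a ∈ U)
    (hpos : 0 < φ a) : ∀ x ∈ U, 0 < φ x := by
  intro x hx
  by_contra! h
  obtain ⟨z, hz, hz0⟩ := hU.intermediate_value hx ha hφ ⟨h, hpos.le⟩
  exact h0 z hz hz0

lemma continuous_sph_apply {d : ℕ} (i : Fin (d + 1)) :
    Continuous fun x : Sph d ↦ (x : EuclideanSpace ℝ (Fin (d + 1))) i := by
  fun_prop

/-- The antipodal map exchanges the two sides of a symmetric pseudosphere. -/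
theorem antipode_neg_of_pos {n : ℕ} {S : Set (Sph n)} (hS : ∀ x ∈ S, antipode n x ∈ S)
    {e : Sph n ≃ₜ Sph n} (he : e '' S = sphEquator n) {x : Sph n}
    (hx : 0 < (e x : EuclideanSpace ℝ (Fin (n + 1))) 0) :
    (e (antipode n x) : EuclideanSpace ℝ (Fin (n + 1))) 0 < 0 := by
  have hmem : ∀ y, y ∈ S ↔ (e y : EuclideanSpace ℝ (Fin (n + 1))) 0 = 0 := by
    intro y
    rw [← e.injective.mem_set_image (s := S), he]; rfl
  have hS' : ∀ y, antipode n y ∈ S ↔ y ∈ S :=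
    fun y ↦ ⟨fun h ↦ by simpa [antipode_antipode] using hS _ h, hS y⟩
  by_contra! hge
  have hpos : 0 < (e (antipode n x) : EuclideanSpace ℝ (Fin (n + 1))) 0 := by
    refine hge.lt_of_ne' fun h ↦ ?_
    rw [← hmem, hS', hmem] at h
    exact hx.ne' h
  set T : Sph n → Sph n := fun y ↦ e (antipode n (e.symm y)) with hT
  have hTc : Continuous T := e.continuous.comp ((antipode n).continuous.comp e.symm.continuous)
  have hT0 : ∀ y, (T y : EuclideanSpace ℝ (Fin (n + 1))) 0 = 0 ↔
      (y : EuclideanSpace ℝ (Fin (n + 1))) 0 = 0 := by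
    intro y
    rw [hT, ← hmem, hS', hmem, e.apply_symm_apply]
  have hTpos : ∀ y : Sph n, 0 < (y : EuclideanSpace ℝ (Fin (n + 1))) 0 →
      0 < (T y : EuclideanSpace ℝ (Fin (n + 1))) 0 := by
    refine pos_of_isPreconnected (isPreconnected_hemisphere_pos n)
      ((continuous_sph_apply 0).comp hTc).continuousOn ?_ (a := e x) hx ?_
    · intro y hy h
      exact (show 0 < (y : EuclideanSpace ℝ (Fin (n + 1))) 0 from hy).ne' ((hT0 y).1 h)
    · simpa [hT] using hpos
  have hTnn : ∀ y : Sph n, 0 ≤ (y : EuclideanSpace ℝ (Fin (n + 1))) 0 →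
      0 ≤ (T y : EuclideanSpace ℝ (Fin (n + 1))) 0 := by
    intro y hy
    rcases hy.eq_or_lt with h | h
    · exact ((hT0 y).2 h.symm).ge
    · exact (hTpos y h).le
  have hTfix : ∀ y, T y ≠ y := by
    intro y h
    apply antipode_ne (e.symm y)
    apply e.injective
    rw [e.apply_symm_apply]; exact h
  have htail : Continuous (sphTail (d := n)) := by unfold sphTail; fun_prop
  obtain ⟨z, hz1, hz⟩ := exists_fixedPoint_of_mapsTo_closedBall
    (G := fun z ↦ sphTail (T (hemisphereLift n z)))
    (htail.comp (hTc.comp (continuous_hemisphereLift n)))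
    (fun z _ ↦ by simpa using norm_sphTail_le _)
  refine hTfix (hemisphereLift n z) (eq_of_sphTail_eq
    (hTnn _ (hemisphereLift_zero_nonneg _ _)) (hemisphereLift_zero_nonneg _ _) ?_)
  rw [sphTail_hemisphereLift hz1]; exact hz

theorem antipode_pos_of_neg {n : ℕ} {S : Set (Sph n)} (hS : ∀ x ∈ S, antipode n x ∈ S)
    {e : Sph n ≃ₜ Sph n} (he : e '' S = sphEquator n) {x : Sph n}
    (hx : (e x : EuclideanSpace ℝ (Fin (n + 1))) 0 < 0) :
    0 < (e (antipode n x) : EuclideanSpace ℝ (Fin (n + 1))) 0 := by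
  have he' : (e.trans (antipode n)) '' S = sphEquator n := by
    rw [show ⇑(e.trans (antipode n)) = antipode n ∘ e from rfl, image_comp, he]
    ext y
    constructor
    · rintro ⟨z, hz, rfl⟩
      simpa [sphEquator, antipode_apply] using hz
    · intro hy
      exact ⟨antipode n y, by simpa [sphEquator, antipode_apply] using hy, antipode_antipode y⟩
  have := antipode_neg_of_pos hS he' (x := x) (by simpa [antipode_apply] using hx)
  simpa [antipode_apply] using this

end Antipode

section SlowFunction

open Filter Topology NNReal

lemma hasSum_inv_mul_succ (j : ℕ) :
    HasSum (fun k : ℕ ↦ 1 / (((k + j : ℕ) : ℝ) + 1) / (((k + j : ℕ) : ℝ) + 2)) (1 / ((j : ℝ) + 1)) := by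
  rw [hasSum_iff_tendsto_nat_of_nonneg (fun k ↦ by positivity)]
  have h : ∀ n : ℕ, ∑ k ∈ Finset.range n, 1 / (((k + j : ℕ) : ℝ) + 1) / (((k + j : ℕ) : ℝ) + 2) =
      1 / ((j : ℝ) + 1) - 1 / ((n : ℝ) + ((j : ℝ) + 1)) := by
    intro n
    induction n with
    | zero => simp
    | succ n ih =>
      rw [Finset.sum_range_succ, ih]
      push_cast
      field_simp
      ring
  simp_rw [h]
  have h2 : Tendsto (fun n : ℕ ↦ 1 / ((n : ℝ) + ((j : ℝ) + 1))) atTop (𝓝 0) :=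
    tendsto_const_nhds.div_atTop
      (tendsto_atTop_add_const_right _ _ tendsto_natCast_atTop_atTop)
  simpa using tendsto_const_nhds.sub h2

/-- A continuous function growing very slowly at `0`, at the scales prescribed by `s`. -/
lemma exists_slow_function (s : ℕ → ℝ) (hs : ∀ k, 0 < s k)
    (hdec : ∀ k, s (k + 1) ≤ s k / ((k : ℝ) + 2) ^ 2) :
    ∃ ℓ : ℝ≥0 → ℝ, Continuous ℓ ∧ ℓ 0 = 0 ∧ (∀ r, 0 < r → 0 < ℓ r) ∧
      (∀ (j : ℕ) (r : ℝ≥0), s j ≤ r → 1 / ((j : ℝ) + 1) ≤ ℓ r) ∧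
      ∀ (j : ℕ) (r : ℝ≥0), r ≤ s j → ℓ r ≤ 1 / ((j : ℝ) + 1) + 1 / ((j : ℝ) + 1) ^ 2 := by
  set a : ℕ → ℝ := fun k ↦ 1 / ((k : ℝ) + 1) / ((k : ℝ) + 2) with ha
  have ha0 : ∀ k, 0 < a k := fun k ↦ by simp only [ha]; positivity
  have hasum : HasSum a 1 := by simpa [ha] using hasSum_inv_mul_succ 0
  set f : ℕ → ℝ≥0 → ℝ := fun k r ↦ a k * min 1 (r / s k) with hf
  have hf0 : ∀ k r, 0 ≤ f k r := fun k r ↦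
    mul_nonneg (ha0 k).le (le_min zero_le_one (div_nonneg r.2 (hs k).le))
  have hfa : ∀ k r, f k r ≤ a k := fun k r ↦ by
    have := min_le_left 1 ((r : ℝ) / s k)
    simp only [hf]; nlinarith [ha0 k]
  have hfs : ∀ r, Summable fun k ↦ f k r := fun r ↦
    hasum.summable.of_nonneg_of_le (fun k ↦ hf0 k r) fun k ↦ hfa k r
  have hlow : ∀ (j : ℕ) (r : ℝ≥0), (∀ k, s (k + j) ≤ r) → 1 / ((j : ℝ) + 1) ≤ ∑' k, f k r := by
    intro j r hr
    rw [← (hfs r).sum_add_tsum_nat_add j, ← (hasSum_inv_mul_succ j).tsum_eq]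
    have : ∀ k, f (k + j) r = 1 / (((k + j : ℕ) : ℝ) + 1) / (((k + j : ℕ) : ℝ) + 2) := by
      intro k
      have h1 : 1 ≤ (r : ℝ) / s (k + j) := (one_le_div (hs _)).2 (hr k)
      simp only [hf, ha, min_eq_left h1, mul_one]
    simp_rw [this]
    exact le_add_of_nonneg_left (Finset.sum_nonneg fun k _ ↦ hf0 k r)
  have hs1 : ∀ k, s (k + 1) ≤ s k := fun k ↦ (hdec k).trans
    (div_le_self (hs k).le (by have : (0 : ℝ) ≤ k := k.cast_nonneg; nlinarith))
  have hanti : Antitone s := antitone_nat_of_succ_le hs1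
  refine ⟨fun r ↦ ∑' k, f k r, ?_, ?_, ?_, ?_, ?_⟩
  · refine continuous_tsum (u := a) (fun k ↦ ?_) hasum.summable fun k r ↦ ?_
    · simp only [hf]; fun_prop
    · rw [Real.norm_of_nonneg (hf0 k r)]; exact hfa k r
  · simp [hf]
  · intro r hr
    refine (hfs r).tsum_pos (fun k ↦ hf0 k r) 0 ?_
    have : (0 : ℝ) < r := hr
    exact mul_pos (ha0 0) (lt_min one_pos (div_pos this (hs 0)))
  · intro j r hr
    exact hlow j r fun k ↦ (hanti (Nat.le_add_left j k)).trans hr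
  · intro j r hr
    simp only
    rw [← (hfs r).sum_add_tsum_nat_add j, add_comm]
    gcongr
    · rw [← (hasSum_inv_mul_succ j).tsum_eq]
      exact ((_root_.summable_nat_add_iff j).2 (hfs r)).tsum_le_tsum (fun k ↦ hfa _ _)
        (hasSum_inv_mul_succ j).summable
    · have h1 : ∀ k ∈ Finset.range j, f k r ≤ a k * (1 / ((j : ℝ) + 1) ^ 2) := by
        intro k hk
        rw [Finset.mem_range] at hk
        simp only [hf]
        refine mul_le_mul_of_nonneg_left ((min_le_right _ _).trans ?_) (ha0 k).le
        obtain ⟨i, rfl⟩ : ∃ i, j = i + 1 := ⟨j - 1, by omega⟩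
        have h2 : s i ≤ s k := hanti (by omega)
        have h3 := hdec i
        rw [div_le_div_iff₀ (hs k) (by positivity), one_mul]
        rw [le_div_iff₀ (by positivity)] at h3
        push_cast
        have h4 : (i : ℝ) + 1 + 1 = i + 2 := by ring
        rw [h4]
        calc (r : ℝ) * ((i : ℝ) + 2) ^ 2 ≤ s (i + 1) * ((i : ℝ) + 2) ^ 2 := by gcongr
          _ ≤ s k := h3.trans h2
      refine (Finset.sum_le_sum h1).trans ?_
      rw [← Finset.sum_mul]
      have h5 : ∑ k ∈ Finset.range j, a k ≤ 1 := sum_le_hasSum _ (fun k _ ↦ (ha0 k).le) hasum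
      have h6 : (0 : ℝ) ≤ 1 / ((j : ℝ) + 1) ^ 2 := by positivity
      nlinarith

variable {V : Type*} [NormedAddCommGroup V] [ProperSpace V]

lemma exists_tube {h : ℂ × V → ℂ × V} (hc : Continuous h) (h0 : ∀ v, (h (0, v)).1 = 0) (R : ℝ)
    {ε : ℝ} (hε : 0 < ε) :
    ∃ η > 0, ∀ p : ℂ × V, ‖p.1‖ ≤ η → ‖p.2‖ ≤ R → ‖(h p).1‖ < ε := by
  have hU : IsOpen {p : ℂ × V | ‖(h p).1‖ < ε} :=
    isOpen_lt (continuous_fst.comp hc).norm continuous_const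
  obtain ⟨u, w, hu, -, h0u, hw, huw⟩ := generalized_tube_lemma (isCompact_singleton (x := (0 : ℂ)))
    (isCompact_closedBall (0 : V) R) hU (by
      rintro ⟨z, v⟩ ⟨hz, -⟩
      rw [mem_singleton_iff] at hz
      simp only at hz
      subst hz
      simpa [h0] using hε)
  obtain ⟨η, hη, hηu⟩ := Metric.isOpen_iff.1 hu 0 (h0u rfl)
  refine ⟨η / 2, half_pos hη, fun p hp1 hp2 ↦ huw ⟨hηu ?_, hw ?_⟩⟩
  · rw [mem_ball_zero_iff]; linarith
  · simpa using hp2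

/-- For a homeomorphism `g` fixing `{0} × V` there is a gauge function `ℓ` on radii which is
asymptotically preserved by `g` near `{0} × V`. -/
theorem exists_gauge (g : (ℂ × V) ≃ₜ (ℂ × V)) (hg : ∀ v, g (0, v) = (0, v)) :
    ∃ ℓ : ℝ≥0 → ℝ, Continuous ℓ ∧ ℓ 0 = 0 ∧ (∀ r, 0 < r → 0 < ℓ r) ∧
      ∀ v₀ : V, Tendsto (fun p : ℂ × V ↦ ℓ ‖(g p).1‖₊ / ℓ ‖p.1‖₊)
        (𝓝[{p | p.1 ≠ 0}] (0, v₀)) (𝓝 1) := by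
  have hg' : ∀ v, g.symm (0, v) = (0, v) := fun v ↦ by rw [g.symm_apply_eq, hg]
  have step : ∀ (k : ℕ) (x : {x : ℝ // 0 < x}), ∃ y : {x : ℝ // 0 < x},
      (y : ℝ) ≤ x / ((k : ℝ) + 2) ^ 2 ∧ ∀ p : ℂ × V, ‖p.1‖ ≤ y → ‖p.2‖ ≤ k + 1 →
        ‖(g p).1‖ < x ∧ ‖(g.symm p).1‖ < x := by
    rintro k ⟨x, hx⟩
    obtain ⟨η₁, h₁, H₁⟩ := exists_tube g.continuous (fun v ↦ by rw [hg]) (k + 1) hx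
    obtain ⟨η₂, h₂, H₂⟩ := exists_tube g.symm.continuous (fun v ↦ by rw [hg']) (k + 1) hx
    exact ⟨⟨min (x / ((k : ℝ) + 2) ^ 2) (min η₁ η₂), by positivity⟩, min_le_left _ _,
      fun p hp1 hp2 ↦ ⟨H₁ p (hp1.trans ((min_le_right _ _).trans (min_le_left _ _))) hp2,
        H₂ p (hp1.trans ((min_le_right _ _).trans (min_le_right _ _))) hp2⟩⟩
  choose F hF1 hF2 using step
  set t : ℕ → {x : ℝ // 0 < x} := fun k ↦ Nat.rec ⟨1, one_pos⟩ F k with ht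
  set s : ℕ → ℝ := fun k ↦ t k with hsdef
  have hs : ∀ k, 0 < s k := fun k ↦ (t k).2
  have hdec : ∀ k, s (k + 1) ≤ s k / ((k : ℝ) + 2) ^ 2 := fun k ↦ hF1 k (t k)
  have hbd : ∀ (k : ℕ) (p : ℂ × V), ‖p.1‖ ≤ s (k + 1) → ‖p.2‖ ≤ k + 1 →
      ‖(g p).1‖ < s k ∧ ‖(g.symm p).1‖ < s k := fun k p ↦ hF2 k (t k) p
  have hs1 : ∀ k, s (k + 1) ≤ s k := fun k ↦ (hdec k).trans
    (div_le_self (hs k).le (by have : (0 : ℝ) ≤ k := k.cast_nonneg; nlinarith))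
  have hanti : Antitone s := antitone_nat_of_succ_le hs1
  have hslim : Tendsto s atTop (𝓝 0) := by
    have h1 : ∀ k : ℕ, s k ≤ 1 / ((k : ℝ) + 1) := by
      intro k
      cases k with
      | zero => simp [hsdef, ht]
      | succ k =>
        have h0 : s k ≤ 1 := (hanti (Nat.zero_le k)).trans (by simp [hsdef, ht])
        refine (hdec k).trans ?_
        push_cast
        rw [div_le_div_iff₀ (by positivity) (by positivity)]
        nlinarith [hs k, (k.cast_nonneg : (0 : ℝ) ≤ k)]
    exact squeeze_zero (fun k ↦ (hs k).le) h1 tendsto_one_div_add_atTop_nhds_zero_nat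
  obtain ⟨ℓ, hℓc, hℓ0, hℓpos, hlow, hup⟩ := exists_slow_function s hs hdec
  refine ⟨ℓ, hℓc, hℓ0, hℓpos, fun v₀ ↦ ?_⟩
  rw [Metric.tendsto_nhds]
  intro ε hε
  obtain ⟨n, hn⟩ := exists_nat_gt (max (7 / ε) (‖v₀‖ + 1))
  have hnε : 7 / ε < n := (le_max_left _ _).trans_lt hn
  have hnv : ‖v₀‖ + 1 < n := (le_max_right _ _).trans_lt hn
  have hn1 : (1 : ℝ) < n := by linarith [norm_nonneg v₀]
  have hn1' : 1 < n := by exact_mod_cast hn1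
  have E1 : ∀ᶠ p : ℂ × V in 𝓝 (0, v₀), ‖p.1‖ < s n :=
    (continuous_fst.norm).continuousAt.eventually (gt_mem_nhds (by simpa using hs n))
  have E2 : ∀ᶠ p : ℂ × V in 𝓝 (0, v₀), ‖p.2‖ < n :=
    (continuous_snd.norm).continuousAt.eventually (gt_mem_nhds (by simp only; linarith))
  have E3 : ∀ᶠ p : ℂ × V in 𝓝 (0, v₀), ‖(g p).2‖ < n :=
    ((continuous_snd.comp g.continuous).norm).continuousAt.eventually
      (gt_mem_nhds (by simp only [Function.comp, hg]; linarith))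
  filter_upwards [nhdsWithin_le_nhds E1, nhdsWithin_le_nhds E2, nhdsWithin_le_nhds E3,
    self_mem_nhdsWithin] with p h1 h2 h3 h0
  have hp0 : 0 < ‖p.1‖ := norm_pos_iff.2 h0
  obtain ⟨i, hi1, hi2⟩ : ∃ i, s (i + 1) < ‖p.1‖ ∧ ‖p.1‖ ≤ s i := by
    classical
    have hex : ∃ k, s k < ‖p.1‖ := (hslim.eventually (gt_mem_nhds hp0)).exists
    have hne : Nat.find hex ≠ 0 := by
      intro h
      have := Nat.find_spec hex
      rw [h] at this
      exact absurd (h1.trans_le (hanti (Nat.zero_le n))) this.not_gt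
    obtain ⟨i, hi⟩ := Nat.exists_eq_succ_of_ne_zero hne
    refine ⟨i, by rw [← Nat.succ_eq_add_one, ← hi]; exact Nat.find_spec hex, ?_⟩
    exact not_lt.1 (Nat.find_min hex (by omega))
  have hni : n ≤ i := by
    by_contra! h
    exact absurd (hi1.trans h1) (hanti (show i + 1 ≤ n by omega)).not_gt
  have hni' : (n : ℝ) ≤ i := by exact_mod_cast hni
  have hg1 : ‖(g p).1‖ < s (i - 1) := by
    refine (hbd (i - 1) p ?_ ?_).1
    · rwa [Nat.sub_add_cancel (by omega)]
    · rw [← Nat.cast_add_one, Nat.sub_add_cancel (by omega)]; linarith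
  have hg2 : s (i + 2) ≤ ‖(g p).1‖ := by
    by_contra! h
    have := (hbd (i + 1) (g p) h.le (by push_cast; linarith)).2
    rw [g.symm_apply_apply] at this
    linarith
  have hi0 : (0 : ℝ) < i := by linarith
  have L1 : 1 / ((i : ℝ) + 3) ≤ ℓ ‖p.1‖₊ :=
    le_trans (one_div_le_one_div_of_le (by positivity) (by push_cast; linarith)) (hlow (i + 1) ‖p.1‖₊ hi1.le)
  have L2 : 1 / ((i : ℝ) + 3) ≤ ℓ ‖(g p).1‖₊ :=
    le_trans (by push_cast; rw [show (i : ℝ) + 2 + 1 = i + 3 by ring]) (hlow (i + 2) ‖(g p).1‖₊ hg2)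
  have U1 : ℓ ‖p.1‖₊ ≤ 1 / (i : ℝ) + 1 / (i : ℝ) ^ 2 :=
    (hup i ‖p.1‖₊ hi2).trans (by gcongr <;> linarith)
  have U2 : ℓ ‖(g p).1‖₊ ≤ 1 / (i : ℝ) + 1 / (i : ℝ) ^ 2 := by
    refine (hup (i - 1) ‖(g p).1‖₊ hg1.le).trans ?_
    rw [← Nat.cast_add_one, Nat.sub_add_cancel (by omega)]
  have hM : 1 / (i : ℝ) + 1 / (i : ℝ) ^ 2 ≤ (1 + 7 / i) * (1 / ((i : ℝ) + 3)) := by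
    rw [← sub_nonneg]
    have : (1 + 7 / i) * (1 / ((i : ℝ) + 3)) - (1 / (i : ℝ) + 1 / (i : ℝ) ^ 2) =
        (3 * i - 3) / (i ^ 2 * (i + 3)) := by field_simp; ring
    rw [this]
    exact div_nonneg (by linarith) (by positivity)
  have h7 : 7 / (i : ℝ) < ε := by
    rw [div_lt_iff₀ hε] at hnε
    rw [div_lt_iff₀ hi0]
    nlinarith
  have h7' : 0 ≤ 7 / (i : ℝ) := by positivity
  have hx : 0 < ℓ ‖p.1‖₊ := lt_of_lt_of_le (by positivity) L1
  rw [Real.dist_eq, div_sub_one hx.ne', abs_div, abs_of_pos hx, div_lt_iff₀ hx, abs_lt]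
  constructor <;> nlinarith
end SlowFunction

section AngleLift

open Filter Topology NNReal

variable {V : Type*}

/-- Polar coordinates in which the angle is rescaled by the gauge `ℓ` of the radius. -/
noncomputable def gaugePolar (ℓ : ℝ≥0 → ℝ) (q : V × ℝ≥0 × ℝ) : ℂ × V :=
  ((q.2.1 : ℂ) * Complex.exp ((q.2.2 / ℓ q.2.1 : ℝ) * Complex.I), q.1)

lemma norm_gaugePolar_fst (ℓ : ℝ≥0 → ℝ) (q : V × ℝ≥0 × ℝ) :
    ‖(gaugePolar ℓ q).1‖ = q.2.1 := by
  rw [gaugePolar, norm_mul, Complex.norm_exp_ofReal_mul_I, mul_one]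
  simp

lemma nnnorm_gaugePolar_fst (ℓ : ℝ≥0 → ℝ) (q : V × ℝ≥0 × ℝ) :
    ‖(gaugePolar ℓ q).1‖₊ = q.2.1 := by
  ext; exact norm_gaugePolar_fst ℓ q

lemma gaugePolar_fst_eq_zero {ℓ : ℝ≥0 → ℝ} {q : V × ℝ≥0 × ℝ} :
    (gaugePolar ℓ q).1 = 0 ↔ q.2.1 = 0 := by
  rw [← norm_eq_zero, norm_gaugePolar_fst]; simp

lemma continuous_gaugePolar [TopologicalSpace V] {ℓ : ℝ≥0 → ℝ} (hℓ : Continuous ℓ)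
    (hpos : ∀ r, 0 < r → 0 < ℓ r) :
    Continuous (gaugePolar ℓ : V × ℝ≥0 × ℝ → ℂ × V) := by
  refine Continuous.prodMk ?_ continuous_fst
  rw [continuous_iff_continuousAt]
  intro q
  by_cases hq : q.2.1 = 0
  · have h0 : (gaugePolar ℓ q).1 = 0 := gaugePolar_fst_eq_zero.2 hq
    change Tendsto (fun q : V × ℝ≥0 × ℝ ↦ (gaugePolar ℓ q).1) (𝓝 q) (𝓝 (gaugePolar ℓ q).1)
    rw [h0, tendsto_zero_iff_norm_tendsto_zero]
    simp_rw [norm_gaugePolar_fst]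
    have : Tendsto (fun q : V × ℝ≥0 × ℝ ↦ (q.2.1 : ℝ)) (𝓝 q) (𝓝 (q.2.1 : ℝ)) :=
      Continuous.tendsto (by fun_prop) q
    simpa [hq] using this
  · have hne : ℓ q.2.1 ≠ 0 := (hpos _ (pos_iff_ne_zero.2 hq)).ne'
    have hdiv : ContinuousAt (fun q : V × ℝ≥0 × ℝ ↦ q.2.2 / ℓ q.2.1) q :=
      ContinuousAt.div (by fun_prop) (by fun_prop) hne
    have h1 : ContinuousAt (fun q : V × ℝ≥0 × ℝ ↦ ((q.2.2 / ℓ q.2.1 : ℝ) : ℂ)) q :=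
      Complex.continuous_ofReal.continuousAt.comp hdiv
    have h2 : ContinuousAt (fun q : V × ℝ≥0 × ℝ ↦ ((q.2.1 : ℝ) : ℂ)) q := by fun_prop
    exact h2.mul (Complex.continuous_exp.continuousAt.comp (h1.mul continuousAt_const))

/-- The lift of `g` to gauged polar coordinates, where `δ` is the angle by which `g` rotates. -/
noncomputable def angleLift (g : ℂ × V → ℂ × V) (δ : ℂ × V → ℝ) (ℓ : ℝ≥0 → ℝ)
    (q : V × ℝ≥0 × ℝ) : V × ℝ≥0 × ℝ :=
  ((g (gaugePolar ℓ q)).2, ‖(g (gaugePolar ℓ q)).1‖₊,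
    if q.2.1 = 0 then q.2.2
    else (q.2.2 / ℓ q.2.1 + δ (gaugePolar ℓ q)) * ℓ ‖(g (gaugePolar ℓ q)).1‖₊)

variable {g : ℂ × V → ℂ × V} {δ : ℂ × V → ℝ} {ℓ : ℝ≥0 → ℝ}

lemma continuous_angleLift [TopologicalSpace V] (hg : Continuous g) (hg0 : ∀ v, g (0, v) = (0, v))
    (hδ : ContinuousOn δ {p | p.1 ≠ 0}) {C : ℝ} (hC : ∀ p, |δ p| ≤ C)
    (hℓ : Continuous ℓ) (hℓ0 : ℓ 0 = 0) (hpos : ∀ r, 0 < r → 0 < ℓ r)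
    (hlim : ∀ v₀ : V, Tendsto (fun p : ℂ × V ↦ ℓ ‖(g p).1‖₊ / ℓ ‖p.1‖₊)
        (𝓝[{p | p.1 ≠ 0}] (0, v₀)) (𝓝 1)) :
    Continuous (angleLift g δ ℓ) := by
  have hP : Continuous (gaugePolar ℓ : V × ℝ≥0 × ℝ → ℂ × V) := continuous_gaugePolar hℓ hpos
  have hℓg : Continuous fun q : V × ℝ≥0 × ℝ ↦ ℓ ‖(g (gaugePolar ℓ q)).1‖₊ :=
    hℓ.comp ((continuous_fst.comp (hg.comp hP)).nnnorm)
  refine (continuous_snd.comp (hg.comp hP)).prodMk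
    (((continuous_fst.comp (hg.comp hP)).nnnorm).prodMk ?_)
  rw [continuous_iff_continuousAt]
  rintro ⟨v, r, u⟩
  by_cases hr : r = 0
  · subst hr
    have hp0 : gaugePolar ℓ (v, (0 : ℝ≥0), u) = (0, v) := by simp [gaugePolar]
    have hz : Tendsto (fun q : V × ℝ≥0 × ℝ ↦ ℓ ‖(g (gaugePolar ℓ q)).1‖₊) (𝓝 (v, 0, u)) (𝓝 0) := by
      have := hℓg.tendsto (v, 0, u)
      rwa [hp0, hg0, nnnorm_zero, hℓ0] at this
    have hu : Tendsto (fun q : V × ℝ≥0 × ℝ ↦ q.2.2) (𝓝 (v, 0, u)) (𝓝 u) :=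
      (continuous_snd.comp continuous_snd).tendsto (v, (0 : ℝ≥0), u)
    rw [ContinuousAt, if_pos rfl]
    have hsplit : (univ : Set (V × ℝ≥0 × ℝ)) = {q | q.2.1 = 0} ∪ {q | q.2.1 ≠ 0} := by
      ext q; simp [em]
    rw [← nhdsWithin_univ, hsplit, nhdsWithin_union, tendsto_sup]
    constructor
    · refine (hu.mono_left nhdsWithin_le_nhds).congr' ?_
      filter_upwards [self_mem_nhdsWithin] with q hq
      rw [if_pos hq]
    · have h1 : Tendsto (gaugePolar ℓ) (𝓝[{q : V × ℝ≥0 × ℝ | q.2.1 ≠ 0}] (v, 0, u))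
          (𝓝[{p | p.1 ≠ 0}] (0, v)) := by
        refine tendsto_nhdsWithin_iff.2 ⟨?_, ?_⟩
        · have := hP.tendsto (v, 0, u)
          rw [hp0] at this
          exact this.mono_left nhdsWithin_le_nhds
        · filter_upwards [self_mem_nhdsWithin] with q hq
          exact fun h ↦ hq (gaugePolar_fst_eq_zero.1 h)
      have h2 := (hlim v).comp h1
      have h3 : Tendsto (fun q : V × ℝ≥0 × ℝ ↦
          δ (gaugePolar ℓ q) * ℓ ‖(g (gaugePolar ℓ q)).1‖₊) (𝓝 (v, 0, u)) (𝓝 0) := by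
        refine squeeze_zero_norm (a := fun q ↦ C * |ℓ ‖(g (gaugePolar ℓ q)).1‖₊|) (fun q ↦ ?_) ?_
        · rw [norm_mul, Real.norm_eq_abs, Real.norm_eq_abs]
          exact mul_le_mul_of_nonneg_right (hC _) (abs_nonneg _)
        · simpa using hz.abs.const_mul C
      have h4 := ((hu.mono_left (nhdsWithin_le_nhds (s := {q | q.2.1 ≠ 0}))).mul h2).add
        (h3.mono_left nhdsWithin_le_nhds)
      rw [mul_one, add_zero] at h4
      refine h4.congr' ?_
      filter_upwards [self_mem_nhdsWithin] with q hq
      rw [if_neg hq]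
      simp only [Function.comp, nnnorm_gaugePolar_fst]
      ring
  · have hev : ∀ᶠ q : V × ℝ≥0 × ℝ in 𝓝 (v, r, u), q.2.1 ≠ 0 :=
      (isOpen_ne.preimage (continuous_fst.comp continuous_snd)).mem_nhds hr
    have hne : ℓ r ≠ 0 := (hpos _ (pos_iff_ne_zero.2 hr)).ne'
    have hdiv : ContinuousAt (fun q : V × ℝ≥0 × ℝ ↦ q.2.2 / ℓ q.2.1) (v, r, u) :=
      ContinuousAt.div (by fun_prop) (by fun_prop) hne
    have hδ' : ContinuousAt (fun q : V × ℝ≥0 × ℝ ↦ δ (gaugePolar ℓ q)) (v, r, u) := by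
      refine ContinuousAt.comp (g := δ) ?_ hP.continuousAt
      refine hδ.continuousAt ((isOpen_ne.preimage continuous_fst).mem_nhds ?_)
      exact fun h ↦ hr (gaugePolar_fst_eq_zero.1 h)
    refine ((hdiv.add hδ').mul hℓg.continuousAt).congr ?_
    filter_upwards [hev] with q hq
    simp [hq]

lemma angleLift_of_eq_zero (hg0 : ∀ v, g (0, v) = (0, v)) (v : V) (u : ℝ) :
    angleLift g δ ℓ (v, 0, u) = (v, 0, u) := by
  simp [angleLift, gaugePolar, hg0]

lemma gaugePolar_angleLift (hpos : ∀ r, 0 < r → 0 < ℓ r) (hg0 : ∀ v, g (0, v) = (0, v))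
    (hg1 : ∀ p, p.1 ≠ 0 → (g p).1 ≠ 0)
    (hrot : ∀ p, (‖p.1‖ : ℂ) * (g p).1 = ‖(g p).1‖ * (p.1 * Complex.exp (δ p * Complex.I)))
    (q : V × ℝ≥0 × ℝ) : gaugePolar ℓ (angleLift g δ ℓ q) = g (gaugePolar ℓ q) := by
  obtain ⟨v, r, u⟩ := q
  by_cases hr : r = 0
  · subst hr
    rw [angleLift_of_eq_zero hg0]
    simp [gaugePolar, hg0]
  set p := gaugePolar ℓ (v, r, u) with hp
  have hp0 : p.1 ≠ 0 := fun h ↦ hr (gaugePolar_fst_eq_zero.1 h)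
  have hℓ' : ℓ ‖(g p).1‖₊ ≠ 0 := (hpos _ (nnnorm_pos.2 (hg1 p hp0))).ne'
  refine Prod.ext ?_ rfl
  simp only [gaugePolar, angleLift, if_neg hr]
  change ((‖(g p).1‖₊ : ℝ) : ℂ) * Complex.exp
    (((u / ℓ r + δ p) * ℓ ‖(g p).1‖₊ / ℓ ‖(g p).1‖₊ : ℝ) * Complex.I) = (g p).1
  rw [mul_div_cancel_right₀ _ hℓ', coe_nnnorm]
  have h1 := hrot p
  have hn : ‖p.1‖ = r := norm_gaugePolar_fst ℓ _
  have hr' : ((r : ℝ) : ℂ) ≠ 0 := by exact_mod_cast hr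
  have h2 : p.1 = ((r : ℝ) : ℂ) * Complex.exp ((u / ℓ r : ℝ) * Complex.I) := rfl
  rw [hn] at h1
  apply mul_left_cancel₀ hr'
  rw [h1, h2]
  push_cast
  rw [add_mul, Complex.exp_add]
  ring

lemma angleLift_leftInverse (hpos : ∀ r, 0 < r → 0 < ℓ r) (hg0 : ∀ v, g (0, v) = (0, v))
    (hg1 : ∀ p, p.1 ≠ 0 → (g p).1 ≠ 0)
    (hrot : ∀ p, (‖p.1‖ : ℂ) * (g p).1 = ‖(g p).1‖ * (p.1 * Complex.exp (δ p * Complex.I)))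
    {g' : ℂ × V → ℂ × V} {δ' : ℂ × V → ℝ} (hg' : Function.LeftInverse g' g)
    (hδ' : ∀ p, δ' (g p) = -δ p) (q : V × ℝ≥0 × ℝ) :
    angleLift g' δ' ℓ (angleLift g δ ℓ q) = q := by
  have hg0' : ∀ v, g' (0, v) = (0, v) := fun v ↦ by conv_lhs => rw [← hg0 v, hg']
  obtain ⟨v, r, u⟩ := q
  by_cases hr : r = 0
  · subst hr
    rw [angleLift_of_eq_zero hg0, angleLift_of_eq_zero hg0']
  have hpol := gaugePolar_angleLift hpos hg0 hg1 hrot (v, r, u)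
  have hp0 : (gaugePolar ℓ (v, r, u)).1 ≠ 0 := fun h ↦ hr (gaugePolar_fst_eq_zero.1 h)
  have hr' : (angleLift g δ ℓ (v, r, u)).2.1 ≠ 0 := nnnorm_ne_zero_iff.2 (hg1 _ hp0)
  have hℓ' : ℓ (angleLift g δ ℓ (v, r, u)).2.1 ≠ 0 := (hpos _ (pos_iff_ne_zero.2 hr')).ne'
  have hℓr : ℓ r ≠ 0 := (hpos _ (pos_iff_ne_zero.2 hr)).ne'
  have h3 : (angleLift g δ ℓ (v, r, u)).2.2 =
      (u / ℓ r + δ (gaugePolar ℓ (v, r, u))) * ℓ (angleLift g δ ℓ (v, r, u)).2.1 := by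
    simp [angleLift, hr]
  rw [angleLift, if_neg hr', hpol, hg', hδ', nnnorm_gaugePolar_fst, h3,
    mul_div_cancel_right₀ _ hℓ']
  simp only [add_neg_cancel_right, div_mul_cancel₀ _ hℓr]
  rfl

/-- The lift of a homeomorphism to gauged polar coordinates. -/
theorem exists_homeomorph_angleLift [NormedAddCommGroup V] (g : (ℂ × V) ≃ₜ (ℂ × V)) (hg0 : ∀ v, g (0, v) = (0, v))
    (hδ : ContinuousOn δ {p | p.1 ≠ 0}) {C : ℝ} (hC : ∀ p, |δ p| ≤ C)
    (hrot : ∀ p, (‖p.1‖ : ℂ) * (g p).1 = ‖(g p).1‖ * (p.1 * Complex.exp (δ p * Complex.I)))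
    (hℓ : Continuous ℓ) (hℓ0 : ℓ 0 = 0) (hpos : ∀ r, 0 < r → 0 < ℓ r)
    (hlim : ∀ v₀ : V, Tendsto (fun p : ℂ × V ↦ ℓ ‖(g p).1‖₊ / ℓ ‖p.1‖₊)
        (𝓝[{p | p.1 ≠ 0}] (0, v₀)) (𝓝 1)) :
    ∃ σ : (V × ℝ≥0 × ℝ) ≃ₜ (V × ℝ≥0 × ℝ), ∀ q, σ q = angleLift g δ ℓ q := by
  have hg0' : ∀ v, g.symm (0, v) = (0, v) := fun v ↦ by rw [g.symm_apply_eq, hg0]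
  have hne : ∀ p, p.1 ≠ 0 → (g p).1 ≠ 0 := by
    intro p hp h
    have : g p = g (0, (g p).2) := by rw [hg0]; exact Prod.ext h rfl
    exact hp (congrArg Prod.fst (g.injective this))
  have hne' : ∀ p, p.1 ≠ 0 → (g.symm p).1 ≠ 0 := by
    intro p hp h
    have : g.symm p = g.symm (0, (g.symm p).2) := by rw [hg0']; exact Prod.ext h rfl
    exact hp (congrArg Prod.fst (g.symm.injective this))
  set δ' : ℂ × V → ℝ := fun p ↦ -δ (g.symm p) with hδ'
  have hrot' : ∀ p, (‖p.1‖ : ℂ) * (g.symm p).1 =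
      ‖(g.symm p).1‖ * (p.1 * Complex.exp (δ' p * Complex.I)) := by
    intro p
    have h1 := hrot (g.symm p)
    rw [g.apply_symm_apply] at h1
    rw [← mul_assoc, h1, hδ', mul_assoc, mul_assoc, ← Complex.exp_add]
    push_cast
    rw [neg_mul, add_neg_cancel, Complex.exp_zero, mul_one]
  have hlim' : ∀ v₀ : V, Tendsto (fun p : ℂ × V ↦ ℓ ‖(g.symm p).1‖₊ / ℓ ‖p.1‖₊)
      (𝓝[{p | p.1 ≠ 0}] (0, v₀)) (𝓝 1) := by
    intro v₀
    have h1 : Tendsto g.symm (𝓝[{p | p.1 ≠ 0}] (0, v₀)) (𝓝[{p | p.1 ≠ 0}] (0, v₀)) := by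
      refine tendsto_nhdsWithin_iff.2 ⟨?_, ?_⟩
      · have := g.symm.continuous.tendsto (0, v₀)
        rw [hg0'] at this
        exact this.mono_left nhdsWithin_le_nhds
      · filter_upwards [self_mem_nhdsWithin] with q hq
        exact hne' q hq
    have h2 := ((hlim v₀).comp h1).inv₀ one_ne_zero
    simpa [Function.comp_def] using h2
  refine ⟨⟨⟨angleLift g δ ℓ, angleLift g.symm δ' ℓ, ?_, ?_⟩, ?_, ?_⟩, fun q ↦ rfl⟩
  · exact angleLift_leftInverse hpos hg0 hne hrot g.left_inv fun p ↦ by simp [hδ']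
  · exact angleLift_leftInverse hpos hg0' hne' hrot' g.right_inv fun p ↦ by simp [hδ']
  · exact continuous_angleLift g.continuous hg0 hδ hC hℓ hℓ0 hpos hlim
  · refine continuous_angleLift g.symm.continuous hg0' ?_ (C := C) ?_ hℓ hℓ0 hpos hlim'
    · exact (hδ.comp g.symm.continuous.continuousOn hne').neg
    · intro p; simpa [hδ'] using hC (g.symm p)

end AngleLift

section Corner

open Filter Topology NNReal

variable {V : Type*}

lemma continuous_mul_of_abs_le_one {X : Type*} [TopologicalSpace X] {a m : X → ℝ}
    (ha : Continuous a) (hm : ∀ x, |m x| ≤ 1) (h : ∀ x, a x ≠ 0 → ContinuousAt m x) :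
    Continuous fun x ↦ a x * m x := by
  rw [continuous_iff_continuousAt]
  intro x
  by_cases hx : a x = 0
  · rw [ContinuousAt, hx, zero_mul]
    refine squeeze_zero_norm (a := fun y ↦ |a y|) (fun y ↦ ?_) ?_
    · rw [norm_mul, Real.norm_eq_abs, Real.norm_eq_abs]
      exact mul_le_of_le_one_right (abs_nonneg _) (hm y)
    · simpa [hx] using ha.abs.tendsto x
  · exact ha.continuousAt.mul (h x hx)

/-- The parameter in `[0, 1]` measuring the position of `u` below the threshold `c / 2`. -/
noncomputable def openRatio (c : V × ℝ≥0 → ℝ) (p : V × ℝ≥0 × ℝ) : ℝ :=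
  max 0 (min 1 (2 * p.2.2 / c (p.1, p.2.1)))

/-- A map opening the quarter plane `{r ≥ 0, u ≥ 0}` to the half plane `{r ≥ 0}`,
equal to the identity where `u ≥ c`. -/
noncomputable def openCorner (c : V × ℝ≥0 → ℝ) (p : V × ℝ≥0 × ℝ) : V × ℝ≥0 × ℝ :=
  (p.1, (p.2.1 * openRatio c p).toNNReal,
    max 0 (min p.2.2 (2 * p.2.2 - c (p.1, p.2.1))) - (p.2.1 - p.2.1 * openRatio c p))

/-- The radius at which `closeCorner` lives. -/
noncomputable def closeRadius (p : V × ℝ≥0 × ℝ) : ℝ≥0 := p.2.1 + (-p.2.2).toNNReal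

/-- The inverse of `openCorner`. -/
noncomputable def closeCorner (c : V × ℝ≥0 → ℝ) (p : V × ℝ≥0 × ℝ) : V × ℝ≥0 × ℝ :=
  (p.1, closeRadius p, max (max 0 p.2.2)
    ((max 0 p.2.2 + c (p.1, closeRadius p) * (p.2.1 / closeRadius p : ℝ)) / 2))

variable {c : V × ℝ≥0 → ℝ}

lemma openRatio_nonneg (p : V × ℝ≥0 × ℝ) : 0 ≤ openRatio c p := le_max_left _ _

lemma openRatio_le_one (p : V × ℝ≥0 × ℝ) : openRatio c p ≤ 1 :=
  max_le zero_le_one (min_le_left _ _)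

lemma continuous_openCorner [TopologicalSpace V] (hc : Continuous c) (hpos : ∀ v r, 0 < r → 0 < c (v, r)) :
    Continuous (openCorner c) := by
  have h : Continuous fun p : V × ℝ≥0 × ℝ ↦ (p.2.1 : ℝ) * openRatio c p := by
    refine continuous_mul_of_abs_le_one (by fun_prop) (fun p ↦ ?_) (fun p hp ↦ ?_)
    · rw [abs_of_nonneg (openRatio_nonneg p)]; exact openRatio_le_one p
    · have hne : c (p.1, p.2.1) ≠ 0 := (hpos _ _ (pos_iff_ne_zero.2 (by exact_mod_cast hp))).ne'
      have : ContinuousAt (fun p : V × ℝ≥0 × ℝ ↦ 2 * p.2.2 / c (p.1, p.2.1)) p :=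
        ContinuousAt.div (by fun_prop) (by fun_prop) hne
      exact continuousAt_const.max (continuousAt_const.min this)
  unfold openCorner
  fun_prop

lemma continuous_closeCorner [TopologicalSpace V] (hc : Continuous c) (hc0 : ∀ v, c (v, 0) = 0) :
    Continuous (closeCorner c) := by
  have hρ : Continuous (closeRadius : V × ℝ≥0 × ℝ → ℝ≥0) := by unfold closeRadius; fun_prop
  have h : Continuous fun p : V × ℝ≥0 × ℝ ↦
      c (p.1, closeRadius p) * (p.2.1 / closeRadius p : ℝ) := by
    refine continuous_mul_of_abs_le_one (by fun_prop) (fun p ↦ ?_) (fun p hp ↦ ?_)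
    · rw [abs_of_nonneg (by positivity)]
      refine div_le_one_of_le₀ ?_ (by positivity)
      rw [closeRadius]; push_cast; linarith [(-p.2.2).toNNReal.2]
    · have hne : (closeRadius p : ℝ) ≠ 0 := by
        intro h
        have : closeRadius p = 0 := by exact_mod_cast h
        rw [this, hc0] at hp
        exact hp rfl
      exact ContinuousAt.div (by fun_prop) (by fun_prop) hne
  unfold closeCorner
  fun_prop

lemma openCorner_of_ge (hc0 : ∀ v, c (v, 0) = 0) (hpos : ∀ v r, 0 < r → 0 < c (v, r))
    {p : V × ℝ≥0 × ℝ} (hp : c (p.1, p.2.1) ≤ p.2.2) : openCorner c p = p := by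
  obtain ⟨v, r, u⟩ := p
  simp only at hp
  rcases eq_or_ne r 0 with rfl | hr
  · rw [hc0] at hp
    have : u ≤ 2 * u := by linarith
    simp [openCorner, hc0, hp, this]
  · have h1 := hpos v r (pos_iff_ne_zero.2 hr)
    have h2 : openRatio c (v, r, u) = 1 := by
      rw [openRatio, min_eq_left, max_eq_right zero_le_one]
      rw [le_div_iff₀ h1]; simp only; linarith
    simp only [openCorner, h2, mul_one, sub_self, sub_zero, Real.toNNReal_coe]
    rw [min_eq_left (by linarith), max_eq_right (by linarith)]

lemma openCorner_of_mid (hpos : ∀ v r, 0 < r → 0 < c (v, r))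
    {v : V} {r : ℝ≥0} {u : ℝ} (hr : 0 < r) (h1 : c (v, r) ≤ 2 * u) (h2 : u ≤ c (v, r)) :
    openCorner c (v, r, u) = (v, r, 2 * u - c (v, r)) := by
  have h0 := hpos v r hr
  have h3 : openRatio c (v, r, u) = 1 := by
    rw [openRatio, min_eq_left, max_eq_right zero_le_one]
    rw [le_div_iff₀ h0]; simp only; linarith
  simp only [openCorner, h3, mul_one, sub_self, sub_zero, Real.toNNReal_coe]
  rw [min_eq_right (by linarith), max_eq_right (by linarith)]

lemma openCorner_of_small (hpos : ∀ v r, 0 < r → 0 < c (v, r))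
    {v : V} {r : ℝ≥0} {u : ℝ} (hr : 0 < r) (hu : 0 ≤ u) (h1 : 2 * u ≤ c (v, r)) :
    openCorner c (v, r, u) = (v, (r * (2 * u / c (v, r))).toNNReal, -(r - r * (2 * u / c (v, r)))) := by
  have h0 := hpos v r hr
  have h3 : openRatio c (v, r, u) = 2 * u / c (v, r) := by
    rw [openRatio, min_eq_right, max_eq_right (by positivity)]
    rw [div_le_one h0]; simp only; linarith
  simp only [openCorner, h3]
  rw [max_eq_left ((min_le_right _ _).trans (by linarith)), zero_sub]

lemma closeCorner_of_nonneg (hc0 : ∀ v, c (v, 0) = 0) {v : V} {r : ℝ≥0} {u : ℝ} (hu : 0 ≤ u) :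
    closeCorner c (v, r, u) = (v, r, max u ((u + c (v, r)) / 2)) := by
  have h1 : closeRadius (v, r, u) = r := by simp [closeRadius, hu]
  simp only [closeCorner, h1, max_eq_right hu]
  rcases eq_or_ne r 0 with rfl | hr
  · simp [hc0]
  · rw [div_self (by exact_mod_cast hr), mul_one]

lemma closeCorner_of_nonpos (hpos : ∀ v r, 0 ≤ c (v, r)) {v : V} {r : ℝ≥0} {u : ℝ} (hu : u ≤ 0) :
    closeCorner c (v, r, u) = (v, r + (-u).toNNReal,
      c (v, r + (-u).toNNReal) * (r / (r - u)) / 2) := by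
  simp only [closeCorner, closeRadius, max_eq_left hu]
  have h2 : ((r + (-u).toNNReal : ℝ≥0) : ℝ) = r - u := by
    push_cast; rw [Real.coe_toNNReal _ (by linarith)]; ring
  rw [h2, zero_add, max_eq_right]
  have := hpos v (r + (-u).toNNReal)
  have h3 : 0 ≤ (r : ℝ) - u := by linarith [r.2]
  positivity

lemma closeCorner_of_ge (hc0 : ∀ v, c (v, 0) = 0) (hpos : ∀ v r, 0 ≤ c (v, r))
    {p : V × ℝ≥0 × ℝ} (hp : c (p.1, p.2.1) ≤ p.2.2) : closeCorner c p = p := by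
  obtain ⟨v, r, u⟩ := p
  simp only at hp
  rw [closeCorner_of_nonneg hc0 ((hpos _ _).trans hp), max_eq_left (by linarith)]

lemma closeCorner_snd_nonneg (p : V × ℝ≥0 × ℝ) : 0 ≤ (closeCorner c p).2.2 :=
  (le_max_left _ _).trans (le_max_left _ _)

lemma closeCorner_openCorner (hc0 : ∀ v, c (v, 0) = 0) (hpos : ∀ v r, 0 < r → 0 < c (v, r))
    {p : V × ℝ≥0 × ℝ} (hp : 0 ≤ p.2.2) : closeCorner c (openCorner c p) = p := by
  have hnn : ∀ v r, 0 ≤ c (v, r) := fun v r ↦ by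
    rcases eq_or_ne r 0 with rfl | hr
    · exact (hc0 v).ge
    · exact (hpos v r (pos_iff_ne_zero.2 hr)).le
  obtain ⟨v, r, u⟩ := p
  simp only at hp
  rcases le_or_gt (c (v, r)) u with h | h
  · rw [openCorner_of_ge hc0 hpos h, closeCorner_of_ge hc0 hnn h]
  have hr : 0 < r := by
    rw [pos_iff_ne_zero]; rintro rfl; rw [hc0] at h; linarith
  have h0 := hpos v r hr
  rcases le_total (c (v, r)) (2 * u) with h1 | h1
  · rw [openCorner_of_mid hpos hr h1 h.le, closeCorner_of_nonneg hc0 (by linarith),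
      max_eq_right (by linarith)]
    congr 2; ring
  · rw [openCorner_of_small hpos hr hp h1]
    have hr' : (0 : ℝ) < r := by exact_mod_cast hr
    have h2 : 2 * u / c (v, r) ≤ 1 := (div_le_one h0).2 h1
    have h3 : 0 ≤ r * (2 * u / c (v, r)) := by positivity
    have h4 : (r : ℝ) * (2 * u / c (v, r)) ≤ r := mul_le_of_le_one_right hr'.le h2
    rw [closeCorner_of_nonpos hnn (by linarith)]
    have h5 : (r * (2 * u / c (v, r))).toNNReal + (-(-(r - r * (2 * u / c (v, r))))).toNNReal = r := by
      ext
      push_cast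
      rw [Real.coe_toNNReal _ h3, Real.coe_toNNReal _ (by linarith)]
      ring
    rw [h5, Real.coe_toNNReal _ h3]
    have h6 : r * (2 * u / c (v, r)) - -(r - r * (2 * u / c (v, r))) = (r : ℝ) := by ring
    rw [h6]
    congr 2
    field_simp

lemma openCorner_closeCorner (hc0 : ∀ v, c (v, 0) = 0) (hpos : ∀ v r, 0 < r → 0 < c (v, r))
    (p : V × ℝ≥0 × ℝ) : openCorner c (closeCorner c p) = p := by
  have hnn : ∀ v r, 0 ≤ c (v, r) := fun v r ↦ by
    rcases eq_or_ne r 0 with rfl | hr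
    · exact (hc0 v).ge
    · exact (hpos v r (pos_iff_ne_zero.2 hr)).le
  obtain ⟨v, r, u⟩ := p
  rcases le_or_gt (c (v, r)) u with h | h
  · rw [closeCorner_of_ge hc0 hnn h, openCorner_of_ge hc0 hpos h]
  rcases le_or_gt 0 u with hu | hu
  · have hr : 0 < r := by
      rw [pos_iff_ne_zero]; rintro rfl; rw [hc0] at h; linarith
    rw [closeCorner_of_nonneg hc0 hu, max_eq_right (by linarith),
      openCorner_of_mid hpos hr (by linarith) (by linarith)]
    congr 2; ring
  · rw [closeCorner_of_nonpos hnn hu.le]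
    have hρ : 0 < r + (-u).toNNReal := by
      have : 0 < (-u).toNNReal := Real.toNNReal_pos.2 (by linarith)
      positivity
    have h0 := hpos v _ hρ
    have hru : (0 : ℝ) < r - u := by linarith [r.2]
    have h1 : (r : ℝ) / (r - u) ≤ 1 := (div_le_one hru).2 (by linarith)
    have h2 : ((r + (-u).toNNReal : ℝ≥0) : ℝ) = r - u := by
      push_cast; rw [Real.coe_toNNReal _ (by linarith)]; ring
    rw [openCorner_of_small hpos hρ (by positivity) (by nlinarith), h2]
    set C := c (v, r + (-u).toNNReal)
    have h3 : (r - u) * (2 * (C * (r / (r - u)) / 2) / C) = (r : ℝ) := by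
      field_simp
    rw [h3, Real.toNNReal_coe]
    congr 2; ring

lemma openCorner_snd_le (hc0 : ∀ v, c (v, 0) = 0) (hpos : ∀ v r, 0 < r → 0 < c (v, r))
    {p : V × ℝ≥0 × ℝ} (hp : 0 ≤ p.2.2) (h : p.2.2 ≤ c (p.1, p.2.1)) :
    (openCorner c p).2.2 ≤ c ((openCorner c p).1, (openCorner c p).2.1) := by
  have hnn : ∀ v r, 0 ≤ c (v, r) := fun v r ↦ by
    rcases eq_or_ne r 0 with rfl | hr
    · exact (hc0 v).ge
    · exact (hpos v r (pos_iff_ne_zero.2 hr)).le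
  obtain ⟨v, r, u⟩ := p
  simp only at hp h
  rcases eq_or_ne r 0 with rfl | hr
  · rw [openCorner_of_ge hc0 hpos (by rw [hc0]; exact hp)]; exact h
  rw [← pos_iff_ne_zero] at hr
  have h0 := hpos v r hr
  rcases le_total (c (v, r)) (2 * u) with h1 | h1
  · rw [openCorner_of_mid hpos hr h1 h]; simp only; linarith
  · rw [openCorner_of_small hpos hr hp h1]
    refine le_trans ?_ (hnn _ _)
    have h2 : 2 * u / c (v, r) ≤ 1 := (div_le_one h0).2 h1
    have h4 : (r : ℝ) * (2 * u / c (v, r)) ≤ r := mul_le_of_le_one_right r.2 h2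
    simp only; linarith

lemma closeCorner_snd_le (hc0 : ∀ v, c (v, 0) = 0) (hnn : ∀ v r, 0 ≤ c (v, r))
    {p : V × ℝ≥0 × ℝ} (h : p.2.2 ≤ c (p.1, p.2.1)) :
    (closeCorner c p).2.2 ≤ c ((closeCorner c p).1, (closeCorner c p).2.1) := by
  obtain ⟨v, r, u⟩ := p
  simp only at h
  rcases le_total 0 u with hu | hu
  · rw [closeCorner_of_nonneg hc0 hu, max_eq_right (by linarith)]; simp only; linarith
  · rw [closeCorner_of_nonpos hnn hu]
    have hru : (0 : ℝ) ≤ r - u := by linarith [r.2]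
    have h1 : (r : ℝ) / (r - u) ≤ 1 := div_le_one_of_le₀ (by linarith) hru
    have h2 : 0 ≤ (r : ℝ) / (r - u) := by positivity
    have := hnn v (r + (-u).toNNReal)
    simp only; nlinarith

lemma openCorner_of_eq_zero (hc0 : ∀ v, c (v, 0) = 0) (hpos : ∀ v r, 0 < r → 0 < c (v, r))
    (v : V) (r : ℝ≥0) : openCorner c (v, r, 0) = (v, 0, -(r : ℝ)) := by
  rcases eq_or_ne r 0 with rfl | hr
  · rw [openCorner_of_ge hc0 hpos (hc0 v).le]; simp
  · rw [openCorner_of_small hpos (pos_iff_ne_zero.2 hr) le_rfl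
      (by simpa using (hpos v r (pos_iff_ne_zero.2 hr)).le)]
    simp

end Corner

section Angle

open Filter Topology NNReal

/-- The line `{re = 0}` in the source and the line `{im = 0}` in the target are crossed by `z ↦ w`
with the standard orientation. -/
structure CrossCompatible (z w : ℂ) : Prop where
  eq_zero_iff : z = 0 ↔ w = 0
  re_pos : w.im = 0 → 0 < w.re → 0 < z.re
  re_neg : w.im = 0 → w.re < 0 → z.re < 0
  im_pos : z.re = 0 → 0 < z.im → 0 < w.im
  im_neg : z.re = 0 → z.im < 0 → w.im < 0

/-- A determination of the argument of `z`, depending on the sign of `w.im`. -/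
noncomputable def sourceAngle (z w : ℂ) : ℝ :=
  if 0 ≤ z.re then z.arg else if 0 ≤ w.im then Real.pi + (-z).arg else -Real.pi + (-z).arg

/-- A determination of the argument of `w`. -/
noncomputable def targetAngle (w : ℂ) : ℝ :=
  if 0 ≤ w.im then Real.pi / 2 + (-(Complex.I * w)).arg
  else -(Real.pi / 2) + (Complex.I * w).arg

lemma norm_mul_exp_sourceAngle (z w : ℂ) :
    ‖z‖ * Complex.exp (sourceAngle z w * Complex.I) = z := by
  have h := Complex.norm_mul_exp_arg_mul_I (-z)
  rw [norm_neg] at h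
  unfold sourceAngle
  split_ifs
  · exact Complex.norm_mul_exp_arg_mul_I z
  · push_cast
    rw [add_mul, Complex.exp_add, Complex.exp_pi_mul_I]
    linear_combination -h
  · push_cast
    rw [add_mul, Complex.exp_add, neg_mul, Complex.exp_neg, Complex.exp_pi_mul_I]
    have : (-1 : ℂ)⁻¹ = -1 := by norm_num
    rw [this]
    linear_combination -h

lemma norm_mul_exp_targetAngle (w : ℂ) :
    ‖w‖ * Complex.exp (targetAngle w * Complex.I) = w := by
  have h := Complex.norm_mul_exp_arg_mul_I (-(Complex.I * w))
  have h' := Complex.norm_mul_exp_arg_mul_I (Complex.I * w)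
  rw [norm_neg] at h
  rw [norm_mul, Complex.norm_I, one_mul] at h h'
  have h2 : Complex.exp (Real.pi / 2 * Complex.I) = Complex.I := Complex.exp_pi_div_two_mul_I
  unfold targetAngle
  split_ifs
  · push_cast
    rw [add_mul, Complex.exp_add, h2]
    linear_combination Complex.I * h - w * Complex.I_sq
  · push_cast
    rw [add_mul, Complex.exp_add, neg_mul, Complex.exp_neg, h2, Complex.inv_I]
    linear_combination -Complex.I * h' - w * Complex.I_sq

lemma arg_eq_pi_div_two {z : ℂ} (h : z.re = 0) (h' : 0 < z.im) : z.arg = Real.pi / 2 :=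
  Complex.arg_eq_pi_div_two_iff.2 ⟨h, h'⟩

lemma arg_eq_neg_pi_div_two {z : ℂ} (h : z.re = 0) (h' : z.im < 0) : z.arg = -(Real.pi / 2) := by
  exact Complex.arg_eq_neg_pi_div_two_iff.2 ⟨h, h'⟩

lemma abs_arg_le {z : ℂ} (h : 0 ≤ z.re) : -(Real.pi / 2) ≤ z.arg ∧ z.arg ≤ Real.pi / 2 :=
  abs_le.1 (Complex.abs_arg_le_pi_div_two_iff.2 h)

lemma abs_arg_lt {z : ℂ} (h : 0 < z.re) : -(Real.pi / 2) < z.arg ∧ z.arg < Real.pi / 2 :=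
  abs_lt.1 (Complex.abs_arg_lt_pi_div_two_iff.2 (Or.inl h))

lemma abs_targetAngle_sub_sourceAngle_le (z w : ℂ) :
    |targetAngle w - sourceAngle z w| ≤ 4 * Real.pi := by
  have hp := Real.pi_pos
  have h1 := Complex.arg_le_pi z
  have h2 := Complex.neg_pi_lt_arg z
  have h3 := Complex.arg_le_pi (-z)
  have h4 := Complex.neg_pi_lt_arg (-z)
  have h5 := Complex.arg_le_pi (-(Complex.I * w))
  have h6 := Complex.neg_pi_lt_arg (-(Complex.I * w))
  have h7 := Complex.arg_le_pi (Complex.I * w)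
  have h8 := Complex.neg_pi_lt_arg (Complex.I * w)
  unfold targetAngle sourceAngle
  rw [abs_le]
  split_ifs <;> constructor <;> linarith

lemma continuousAt_of_isClosed_cover {ι X Y : Type*} [Finite ι] [TopologicalSpace X]
    [TopologicalSpace Y] {f : X → Y} {P : ι → Set X} (hP : ∀ i, IsClosed (P i)) {x : X}
    (hcov : ∀ y, ∃ i, y ∈ P i) (h : ∀ i, x ∈ P i → ContinuousWithinAt f (P i) x) :
    ContinuousAt f x := by
  have hU : (⋃ i, P i) = univ := eq_univ_of_forall fun y ↦ mem_iUnion.2 (hcov y)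
  rw [← continuousWithinAt_univ, ← hU, ContinuousWithinAt, nhdsWithin_iUnion, tendsto_iSup]
  intro i
  by_cases hx : x ∈ P i
  · exact h i hx
  · have : 𝓝[P i] x = ⊥ := by
      rw [← notMem_closure_iff_nhdsWithin_eq_bot, (hP i).closure_eq]; exact hx
    rw [this]; exact tendsto_bot

lemma continuousAt_arg_of_re_nonneg {z : ℂ} (h0 : z ≠ 0) (h : 0 ≤ z.re) :
    ContinuousAt Complex.arg z := by
  refine Complex.continuousAt_arg ?_
  rw [Complex.mem_slitPlane_iff]
  rcases h.lt_or_eq with h | h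
  · exact Or.inl h
  · right; intro h'; exact h0 (Complex.ext h.symm h')

lemma continuousOn_targetAngle_sub_sourceAngle {X : Type*} [TopologicalSpace X] {z w : X → ℂ}
    (hz : Continuous z) (hw : Continuous w) (h : ∀ x, CrossCompatible (z x) (w x)) :
    ContinuousOn (fun x ↦ targetAngle (w x) - sourceAngle (z x) (w x)) {x | z x ≠ 0} := by
  intro x hx
  refine ContinuousAt.continuousWithinAt ?_
  have hx' : w x ≠ 0 := fun h' ↦ hx ((h x).eq_zero_iff.2 h')
  have hA : 0 ≤ (z x).re → ContinuousAt (fun y ↦ (z y).arg) x := fun h1 ↦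
    (continuousAt_arg_of_re_nonneg hx h1).comp hz.continuousAt
  have hB : (z x).re ≤ 0 → ContinuousAt (fun y ↦ (-z y).arg) x := fun h1 ↦
    ContinuousAt.comp (g := Complex.arg)
      (continuousAt_arg_of_re_nonneg (neg_ne_zero.2 hx) (by simpa using h1)) hz.neg.continuousAt
  have hC : 0 ≤ (w x).im → ContinuousAt (fun y ↦ (-(Complex.I * w y)).arg) x := fun h1 ↦
    ContinuousAt.comp (g := Complex.arg)
      (continuousAt_arg_of_re_nonneg (neg_ne_zero.2 (mul_ne_zero Complex.I_ne_zero hx'))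
        (by simpa using h1)) (continuous_const.mul hw).neg.continuousAt
  have hD : (w x).im ≤ 0 → ContinuousAt (fun y ↦ (Complex.I * w y).arg) x := fun h1 ↦
    ContinuousAt.comp (g := Complex.arg)
      (continuousAt_arg_of_re_nonneg (mul_ne_zero Complex.I_ne_zero hx')
        (by simpa using h1)) (continuous_const.mul hw).continuousAt
  have hre : Continuous fun y ↦ (z y).re := Complex.continuous_re.comp hz
  have him : Continuous fun y ↦ (w y).im := Complex.continuous_im.comp hw
  have key : ∀ᶠ y in 𝓝 x, z y ≠ 0 := hz.continuousAt.eventually_ne hx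
  -- on the two lines the competing determinations agree
  have e1 : ∀ y, z y ≠ 0 → (z y).re ≤ 0 → 0 ≤ (w y).im →
      sourceAngle (z y) (w y) = Real.pi + (-z y).arg := by
    intro y hy h1 h2
    unfold sourceAngle
    rcases h1.lt_or_eq with h1 | h1
    · rw [if_neg h1.not_ge, if_pos h2]
    · rw [if_pos h1.ge]
      have h3 : 0 < (z y).im := by
        rcases lt_trichotomy (z y).im 0 with h3 | h3 | h3
        · exact absurd ((h y).im_neg h1 h3) h2.not_gt
        · exact absurd (Complex.ext h1 h3) hy
        · exact h3
      rw [arg_eq_pi_div_two h1 h3, arg_eq_neg_pi_div_two (by simp [h1]) (by simpa using h3)]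
      ring
  have e2 : ∀ y, z y ≠ 0 → (z y).re ≤ 0 → (w y).im < 0 →
      sourceAngle (z y) (w y) = -Real.pi + (-z y).arg := by
    intro y hy h1 h2
    unfold sourceAngle
    rcases h1.lt_or_eq with h1 | h1
    · rw [if_neg h1.not_ge, if_neg h2.not_ge]
    · rw [if_pos h1.ge]
      have h3 : (z y).im < 0 := by
        rcases lt_trichotomy (z y).im 0 with h3 | h3 | h3
        · exact h3
        · exact absurd (Complex.ext h1 h3) hy
        · exact absurd ((h y).im_pos h1 h3) h2.not_gt
      rw [arg_eq_neg_pi_div_two h1 h3, arg_eq_pi_div_two (by simp [h1]) (by simpa using h3)]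
      ring
  have hwy : ∀ y, z y ≠ 0 → (w y).im = 0 → (w y).re ≠ 0 := fun y hy h1 h2 ↦
    hy ((h y).eq_zero_iff.2 (Complex.ext h2 h1))
  have e3 : ∀ y, z y ≠ 0 → (w y).im = 0 → 0 ≤ (z y).re →
      (-(Complex.I * w y)).arg = -(Real.pi / 2) ∧ (Complex.I * w y).arg = Real.pi / 2 := by
    intro y hy h1 h2
    have h3 : 0 < (w y).re := by
      rcases (hwy y hy h1).lt_or_gt with h3 | h3
      · exact absurd ((h y).re_neg h1 h3) h2.not_gt
      · exact h3
    exact ⟨arg_eq_neg_pi_div_two (by simp [h1]) (by simpa using h3),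
      arg_eq_pi_div_two (by simp [h1]) (by simpa using h3)⟩
  have e4 : ∀ y, z y ≠ 0 → (w y).im = 0 → (z y).re ≤ 0 →
      (-(Complex.I * w y)).arg = Real.pi / 2 ∧ (Complex.I * w y).arg = -(Real.pi / 2) := by
    intro y hy h1 h2
    have h3 : (w y).re < 0 := by
      rcases (hwy y hy h1).lt_or_gt with h3 | h3
      · exact h3
      · exact absurd ((h y).re_pos h1 h3) h2.not_gt
    exact ⟨arg_eq_pi_div_two (by simp [h1]) (by simpa using h3),
      arg_eq_neg_pi_div_two (by simp [h1]) (by simpa using h3)⟩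
  let P : Bool × Bool → Set X := fun b ↦
    {y | if b.1 then 0 ≤ (z y).re else (z y).re ≤ 0} ∩
    {y | if b.2 then 0 ≤ (w y).im else (w y).im ≤ 0}
  refine continuousAt_of_isClosed_cover (P := P) ?_ ?_ ?_
  · rintro ⟨_ | _, _ | _⟩ <;> simp only [P, if_true, Bool.false_eq_true, if_false]
    · exact (isClosed_le hre continuous_const).inter (isClosed_le him continuous_const)
    · exact (isClosed_le hre continuous_const).inter (isClosed_le continuous_const him)
    · exact (isClosed_le continuous_const hre).inter (isClosed_le him continuous_const)
    · exact (isClosed_le continuous_const hre).inter (isClosed_le continuous_const him)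
  · intro y
    rcases le_total 0 (z y).re with h1 | h1 <;> rcases le_total 0 (w y).im with h2 | h2
    · exact ⟨(true, true), by simp [P, h1, h2]⟩
    · exact ⟨(true, false), by simp [P, h1, h2]⟩
    · exact ⟨(false, true), by simp [P, h1, h2]⟩
    · exact ⟨(false, false), by simp [P, h1, h2]⟩
  have aux : ∀ (s : Set X) (f : X → ℝ), x ∈ s → ContinuousAt f x →
      (∀ y ∈ s, z y ≠ 0 → targetAngle (w y) - sourceAngle (z y) (w y) = f y) →
      ContinuousWithinAt (fun x ↦ targetAngle (w x) - sourceAngle (z x) (w x)) s x := by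
    intro s f hxs hf hs
    refine hf.continuousWithinAt.congr_of_eventuallyEq ?_ (hs x hxs hx)
    filter_upwards [self_mem_nhdsWithin, nhdsWithin_le_nhds key] with y hy hy'
    exact hs y hy hy'
  rintro ⟨_ | _, _ | _⟩ <;> simp only [P, if_true, Bool.false_eq_true, if_false] <;> intro hxP
  · refine aux _ (fun y ↦ (-(Real.pi / 2) + (Complex.I * w y).arg) - (-Real.pi + (-z y).arg)) hxP
      ((continuousAt_const.add (hD hxP.2)).sub (continuousAt_const.add (hB hxP.1))) ?_
    rintro y ⟨h1, h2⟩ hy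
    simp only [mem_ofPred_eq] at h1 h2
    rcases h2.lt_or_eq with h2 | h2
    · rw [e2 y hy h1 h2, targetAngle, if_neg h2.not_ge]
    · rw [e1 y hy h1 h2.ge, targetAngle, if_pos h2.ge, (e4 y hy h2 h1).1, (e4 y hy h2 h1).2]
      ring
  · refine aux _ (fun y ↦ (Real.pi / 2 + (-(Complex.I * w y)).arg) - (Real.pi + (-z y).arg)) hxP
      ((continuousAt_const.add (hC hxP.2)).sub (continuousAt_const.add (hB hxP.1))) ?_
    rintro y ⟨h1, h2⟩ hy
    simp only [mem_ofPred_eq] at h1 h2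
    rw [e1 y hy h1 h2, targetAngle, if_pos h2]
  · refine aux _ (fun y ↦ (-(Real.pi / 2) + (Complex.I * w y).arg) - (z y).arg) hxP
      ((continuousAt_const.add (hD hxP.2)).sub (hA hxP.1)) ?_
    rintro y ⟨h1, h2⟩ hy
    simp only [mem_ofPred_eq] at h1 h2
    rw [sourceAngle, if_pos h1]
    rcases h2.lt_or_eq with h2 | h2
    · rw [targetAngle, if_neg h2.not_ge]
    · rw [targetAngle, if_pos h2.ge, (e3 y hy h2 h1).1, (e3 y hy h2 h1).2]
      ring
  · refine aux _ (fun y ↦ (Real.pi / 2 + (-(Complex.I * w y)).arg) - (z y).arg) hxP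
      ((continuousAt_const.add (hC hxP.2)).sub (hA hxP.1)) ?_
    rintro y ⟨h1, h2⟩ hy
    simp only [mem_ofPred_eq] at h1 h2
    rw [targetAngle, if_pos h2, sourceAngle, if_pos h1]

lemma exists_int_of_norm_mul_exp {z : ℂ} (hz : z ≠ 0) {θ φ : ℝ}
    (h1 : ‖z‖ * Complex.exp (θ * Complex.I) = z) (h2 : ‖z‖ * Complex.exp (φ * Complex.I) = z) :
    ∃ k : ℤ, θ = φ + 2 * Real.pi * k := by
  have h3 : (‖z‖ : ℂ) ≠ 0 := by simpa using hz
  have h4 := mul_left_cancel₀ h3 (h1.trans h2.symm)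
  obtain ⟨k, hk⟩ := Complex.exp_eq_exp_iff_exists_int.1 h4
  refine ⟨k, ?_⟩
  have h5 : (θ : ℂ) * Complex.I = ((φ + 2 * Real.pi * k : ℝ) : ℂ) * Complex.I := by
    rw [hk]; push_cast; ring
  exact_mod_cast mul_right_cancel₀ Complex.I_ne_zero h5

lemma targetAngle_mem (w : ℂ) : -Real.pi ≤ targetAngle w ∧ targetAngle w ≤ Real.pi := by
  have hp := Real.pi_pos
  unfold targetAngle
  split_ifs with h
  · have := abs_arg_le (z := -(Complex.I * w)) (by simpa using h)
    constructor <;> linarith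
  · have := abs_arg_le (z := Complex.I * w) (by simpa using (not_le.1 h).le)
    constructor <;> linarith

lemma targetAngle_nonneg_iff (w : ℂ) : 0 ≤ targetAngle w ↔ 0 ≤ w.im := by
  unfold targetAngle
  split_ifs with h
  · have := abs_arg_le (z := -(Complex.I * w)) (by simpa using h)
    exact ⟨fun _ ↦ h, fun _ ↦ by linarith⟩
  · have := abs_arg_lt (z := Complex.I * w) (by simpa using (not_le.1 h))
    exact ⟨fun _ ↦ by linarith, fun h' ↦ absurd h' h⟩

lemma sourceAngle_mem (z w : ℂ) :
    -(3 * Real.pi / 2) < sourceAngle z w ∧ sourceAngle z w < 3 * Real.pi / 2 := by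
  have hp := Real.pi_pos
  unfold sourceAngle
  split_ifs with h
  · have := abs_arg_le h; constructor <;> linarith
  · have := abs_arg_lt (z := -z) (by simpa using h); constructor <;> linarith
  · have := abs_arg_lt (z := -z) (by simpa using h); constructor <;> linarith

lemma CrossCompatible.eq_arg {z w : ℂ} (hz : z ≠ 0) {θ : ℝ}
    (hθ : ‖z‖ * Complex.exp (θ * Complex.I) = z) (h1 : θ ≤ Real.pi / 2)
    (h2 : 0 ≤ θ + (targetAngle w - sourceAngle z w)) : 0 ≤ z.re ∧ 0 ≤ w.im ∧ θ = z.arg := by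
  have hp := Real.pi_pos
  obtain ⟨k, hk⟩ := exists_int_of_norm_mul_exp hz hθ (norm_mul_exp_sourceAngle z w)
  have h3 := targetAngle_mem w
  have h4 := sourceAngle_mem z w
  have hk0 : k = 0 := by
    have a1 : (-1 : ℝ) < k := by by_contra! h; nlinarith
    have a2 : (k : ℝ) < 1 := by by_contra! h; nlinarith
    have a3 : (-1 : ℤ) < k := by exact_mod_cast a1
    have a4 : k < (1 : ℤ) := by exact_mod_cast a2
    omega
  subst hk0
  rw [Int.cast_zero, mul_zero, add_zero] at hk
  have h5 : 0 ≤ w.im := (targetAngle_nonneg_iff w).1 (by linarith)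
  rw [hk] at h1 ⊢
  unfold sourceAngle at h1 ⊢
  split_ifs at h1 ⊢ with h
  · exact ⟨h, h5, rfl⟩
  · have := abs_arg_lt (z := -z) (by simpa using h); linarith

lemma CrossCompatible.lt_pi_div_two {z w : ℂ} (h : CrossCompatible z w) (hz : z ≠ 0) {θ : ℝ}
    (hθ : ‖z‖ * Complex.exp (θ * Complex.I) = z)
    (h2 : θ + (targetAngle w - sourceAngle z w) ≤ 0) : θ < Real.pi / 2 := by
  have hp := Real.pi_pos
  obtain ⟨k, hk⟩ := exists_int_of_norm_mul_exp hz hθ (norm_mul_exp_sourceAngle z w)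
  have h3 := targetAngle_mem w
  have h4 := sourceAngle_mem z w
  have hk0 : k ≤ 0 := by
    have a2 : (k : ℝ) < 1 := by by_contra! h; nlinarith
    have a4 : k < (1 : ℤ) := by exact_mod_cast a2
    omega
  rcases hk0.lt_or_eq with hk0 | rfl
  · have a1 : (k : ℝ) ≤ -1 := by exact_mod_cast (by omega : k ≤ -1)
    nlinarith
  rw [Int.cast_zero, mul_zero, add_zero] at hk
  rw [hk] at h2 ⊢
  have h5 : targetAngle w ≤ 0 := by linarith
  have hw0 : w ≠ 0 := fun h' ↦ hz (h.eq_zero_iff.2 h')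
  by_cases hw : 0 ≤ w.im
  · rw [targetAngle, if_pos hw] at h5
    have h6 := abs_arg_le (z := -(Complex.I * w)) (by simpa using hw)
    have h7 : (-(Complex.I * w)).arg = -(Real.pi / 2) := by linarith
    obtain ⟨h8, h9⟩ := Complex.arg_eq_neg_pi_div_two_iff.1 h7
    have h10 := h.re_pos (by simpa using h8) (by simpa using h9)
    rw [sourceAngle, if_pos h10.le]
    exact (abs_arg_lt h10).2
  · unfold sourceAngle
    rw [if_neg hw]
    split_ifs with h6
    · refine (abs_arg_le h6).2.lt_of_ne fun h7 ↦ ?_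
      obtain ⟨h8, h9⟩ := Complex.arg_eq_pi_div_two_iff.1 h7
      exact hw (h.im_pos h8 h9).le
    · have := abs_arg_le (z := -z) (by simpa using (not_le.1 h6).le); linarith

lemma CrossCompatible.arg_add_nonneg {z w : ℂ} (h1 : 0 ≤ z.re) (h2 : 0 ≤ w.im) :
    0 ≤ z.arg + (targetAngle w - sourceAngle z w) := by
  rw [sourceAngle, if_pos h1]
  have := (targetAngle_nonneg_iff w).2 h2
  linarith

lemma CrossCompatible.arg_add_eq_zero {z w : ℂ} (h : CrossCompatible z w) (hz : z ≠ 0)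
    (h1 : 0 ≤ z.re) (h2 : w.im = 0) :
    z.arg + (targetAngle w - sourceAngle z w) = 0 := by
  have hw0 : w ≠ 0 := fun h' ↦ hz (h.eq_zero_iff.2 h')
  have h3 : 0 < w.re := by
    rcases lt_trichotomy w.re 0 with h3 | h3 | h3
    · exact absurd (h.re_neg h2 h3) h1.not_gt
    · exact absurd (Complex.ext h3 h2) hw0
    · exact h3
  rw [sourceAngle, if_pos h1, targetAngle, if_pos h2.ge,
    arg_eq_neg_pi_div_two (z := -(Complex.I * w)) (by simp [h2]) (by simpa using h3)]
  ring

end Angle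

section Quadrant

open Filter Topology NNReal

variable {V : Type*}

/-- Gauged polar coordinates of a point, using the principal argument. -/
noncomputable def gaugeArg (ℓ : ℝ≥0 → ℝ) (p : ℂ × V) : V × ℝ≥0 × ℝ :=
  (p.2, ‖p.1‖₊, ℓ ‖p.1‖₊ * p.1.arg)

lemma gaugePolar_gaugeArg {ℓ : ℝ≥0 → ℝ} (hpos : ∀ r, 0 < r → 0 < ℓ r) (p : ℂ × V) :
    gaugePolar ℓ (gaugeArg ℓ p) = p := by
  obtain ⟨z, v⟩ := p
  rcases eq_or_ne z 0 with rfl | hz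
  · simp [gaugePolar, gaugeArg]
  · have h : ℓ ‖z‖₊ ≠ 0 := (hpos _ (nnnorm_pos.2 hz)).ne'
    simp only [gaugePolar, gaugeArg, mul_div_cancel_left₀ _ h, coe_nnnorm]
    rw [Complex.norm_mul_exp_arg_mul_I]

lemma continuousOn_gaugeArg [NormedAddCommGroup V] {ℓ : ℝ≥0 → ℝ} (hℓ : Continuous ℓ) (hℓ0 : ℓ 0 = 0) :
    ContinuousOn (gaugeArg ℓ : ℂ × V → V × ℝ≥0 × ℝ) {p | 0 ≤ p.1.re} := by
  have h : ContinuousOn (fun p : ℂ × V ↦ ℓ ‖p.1‖₊ * p.1.arg) {p | 0 ≤ p.1.re} := by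
    rw [continuousOn_iff_continuous_domRestrict]
    have := continuous_mul_of_abs_le_one (X := {p : ℂ × V | 0 ≤ p.1.re})
      (a := fun p ↦ Real.pi * ℓ ‖p.1.1‖₊) (m := fun p ↦ p.1.1.arg / Real.pi) (by fun_prop)
      (fun p ↦ by
        rw [abs_div, abs_of_pos Real.pi_pos, div_le_one Real.pi_pos]
        exact Complex.abs_arg_le_pi _)
      (fun p hp ↦ by
        have h0 : p.1.1 ≠ 0 := by rintro h; simp [h, hℓ0] at hp
        have h1 : ContinuousAt (fun p : {p : ℂ × V | 0 ≤ p.1.re} ↦ p.1.1.arg) p :=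
          ContinuousAt.comp (g := Complex.arg) (continuousAt_arg_of_re_nonneg h0 p.2) (by fun_prop)
        exact h1.div_const _)
    refine this.congr fun p ↦ ?_
    have := Real.pi_pos.ne'
    simp only [Set.domRestrict]
    field_simp
  exact continuousOn_snd.prodMk (continuous_fst.nnnorm.continuousOn.prodMk h)

/-- The coordinates of the quarter plane. -/
noncomputable def quarterMap (ℓ : ℝ≥0 → ℝ) (q : V × ℝ≥0 × ℝ) : ℂ × V :=
  (⟨Real.pi / 2 * ℓ q.2.1 - q.2.2, q.2.1⟩, q.1)

/-- The inverse of `quarterMap`. -/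
noncomputable def quarterInv (ℓ : ℝ≥0 → ℝ) (p : ℂ × V) : V × ℝ≥0 × ℝ :=
  (p.2, p.1.im.toNNReal, Real.pi / 2 * ℓ p.1.im.toNNReal - p.1.re)

lemma quarterInv_quarterMap (ℓ : ℝ≥0 → ℝ) (q : V × ℝ≥0 × ℝ) :
    quarterInv ℓ (quarterMap ℓ q) = q := by
  simp [quarterInv, quarterMap]

lemma quarterMap_quarterInv (ℓ : ℝ≥0 → ℝ) {p : ℂ × V} (hp : 0 ≤ p.1.im) :
    quarterMap ℓ (quarterInv ℓ p) = p := by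
  refine Prod.ext (Complex.ext ?_ ?_) rfl
  · simp [quarterInv, quarterMap]
  · simp [quarterInv, quarterMap, hp]

lemma continuous_quarterMap [NormedAddCommGroup V] {ℓ : ℝ≥0 → ℝ} (hℓ : Continuous ℓ) :
    Continuous (quarterMap ℓ : V × ℝ≥0 × ℝ → ℂ × V) := by
  have : (quarterMap ℓ : V × ℝ≥0 × ℝ → ℂ × V) = fun q ↦
      (((Real.pi / 2 * ℓ q.2.1 - q.2.2 : ℝ) : ℂ) + ((q.2.1 : ℝ) : ℂ) * Complex.I, q.1) := by
    ext q
    · simp [quarterMap, Complex.ext_iff]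
    · rfl
  rw [this]
  fun_prop

lemma continuous_quarterInv [NormedAddCommGroup V] {ℓ : ℝ≥0 → ℝ} (hℓ : Continuous ℓ) :
    Continuous (quarterInv ℓ : ℂ × V → V × ℝ≥0 × ℝ) := by
  have h1 : Continuous fun p : ℂ × V ↦ p.1.re := Complex.continuous_re.comp continuous_fst
  have h2 : Continuous fun p : ℂ × V ↦ p.1.im := Complex.continuous_im.comp continuous_fst
  unfold quarterInv
  fun_prop

/-- The quadrant `{re z ≥ 0, im (g z) ≥ 0}` is homeomorphic to the standard one, by a map
prescribed on the boundary. -/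
theorem exists_quadrant_maps [NormedAddCommGroup V] [ProperSpace V] (g : (ℂ × V) ≃ₜ (ℂ × V))
    (hg0 : ∀ v, g (0, v) = (0, v)) (hc : ∀ p, CrossCompatible p.1 (g p).1) :
    ∃ q q' : ℂ × V → ℂ × V,
      ContinuousOn q {p | 0 ≤ p.1.re ∧ 0 ≤ (g p).1.im} ∧
      ContinuousOn q' {p | 0 ≤ p.1.re ∧ 0 ≤ p.1.im} ∧
      (∀ p : ℂ × V, 0 ≤ p.1.re → 0 ≤ (g p).1.im →
        0 ≤ (q p).1.re ∧ 0 ≤ (q p).1.im ∧ q' (q p) = p) ∧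
      (∀ p : ℂ × V, 0 ≤ p.1.re → 0 ≤ p.1.im →
        0 ≤ (q' p).1.re ∧ 0 ≤ (g (q' p)).1.im ∧ q (q' p) = p) ∧
      (∀ p : ℂ × V, p.1.re = 0 → 0 ≤ (g p).1.im → q p = p) ∧
      ∀ p : ℂ × V, 0 ≤ p.1.re → (g p).1.im = 0 → q p = g p := by
  have hpi := Real.pi_pos
  obtain ⟨ℓ, hℓ, hℓ0, hpos, hlim⟩ := exists_gauge g hg0
  set δ : ℂ × V → ℝ := fun p ↦ targetAngle (g p).1 - sourceAngle p.1 (g p).1 with hδdef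
  have hrot : ∀ p, (‖p.1‖ : ℂ) * (g p).1 = ‖(g p).1‖ * (p.1 * Complex.exp (δ p * Complex.I)) := by
    intro p
    have h1 := norm_mul_exp_sourceAngle p.1 (g p).1
    have h2 := norm_mul_exp_targetAngle (g p).1
    have h3 : Complex.exp (targetAngle (g p).1 * Complex.I) =
        Complex.exp (sourceAngle p.1 (g p).1 * Complex.I) * Complex.exp (δ p * Complex.I) := by
      rw [← Complex.exp_add, hδdef]; push_cast; ring_nf
    calc (‖p.1‖ : ℂ) * (g p).1
        = ‖p.1‖ * (‖(g p).1‖ * Complex.exp (targetAngle (g p).1 * Complex.I)) := by rw [h2]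
      _ = ‖(g p).1‖ * (‖p.1‖ * Complex.exp (sourceAngle p.1 (g p).1 * Complex.I) *
          Complex.exp (δ p * Complex.I)) := by rw [h3]; ring
      _ = _ := by rw [h1]
  obtain ⟨σ, hσ⟩ : ∃ σ : (V × ℝ≥0 × ℝ) ≃ₜ (V × ℝ≥0 × ℝ), ∀ q, σ q = angleLift g δ ℓ q :=
    exists_homeomorph_angleLift g hg0
    (continuousOn_targetAngle_sub_sourceAngle continuous_fst (continuous_fst.comp g.continuous) hc)
    (fun p ↦ abs_targetAngle_sub_sourceAngle_le _ _) hrot hℓ hℓ0 hpos hlim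
  have hne : ∀ p : ℂ × V, p.1 ≠ 0 → (g p).1 ≠ 0 := fun p hp h ↦ hp ((hc p).eq_zero_iff.2 h)
  have hσ0 : ∀ v u, σ (v, 0, u) = (v, 0, u) := fun v u ↦ by
    rw [hσ, angleLift_of_eq_zero hg0]
  have hσ0' : ∀ v u, σ.symm (v, 0, u) = (v, 0, u) := fun v u ↦ by
    rw [σ.symm_apply_eq, hσ0]
  have hPσ : ∀ q, gaugePolar ℓ (σ q) = g (gaugePolar ℓ q) := fun q ↦ by
    rw [hσ, gaugePolar_angleLift hpos hg0 hne hrot]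
  have hσr : ∀ q : V × ℝ≥0 × ℝ, 0 < q.2.1 → 0 < (σ q).2.1 := by
    intro q hq
    rw [hσ, angleLift, nnnorm_pos]
    exact hne _ fun h ↦ hq.ne' (gaugePolar_fst_eq_zero.1 h)
  have hσr' : ∀ q : V × ℝ≥0 × ℝ, 0 < q.2.1 → 0 < (σ.symm q).2.1 := by
    intro q hq
    rw [pos_iff_ne_zero]
    intro h
    have h1 : σ.symm q = ((σ.symm q).1, 0, (σ.symm q).2.2) := by rw [← h]
    have h2 : q = ((σ.symm q).1, 0, (σ.symm q).2.2) := by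
      rw [← hσ0, ← h1, σ.apply_symm_apply]
    rw [h2] at hq
    exact lt_irrefl _ hq
  have hσu : ∀ q : V × ℝ≥0 × ℝ, 0 < q.2.1 →
      (σ q).2.2 = (q.2.2 / ℓ q.2.1 + δ (gaugePolar ℓ q)) * ℓ (σ q).2.1 := by
    intro q hq
    rw [hσ]
    simp only [angleLift, if_neg hq.ne']
  have hexp : ∀ q : V × ℝ≥0 × ℝ, ‖(gaugePolar ℓ q).1‖ *
      Complex.exp ((q.2.2 / ℓ q.2.1 : ℝ) * Complex.I) = (gaugePolar ℓ q).1 := by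
    intro q; rw [norm_gaugePolar_fst]; rfl
  have hP0 : ∀ q : V × ℝ≥0 × ℝ, 0 < q.2.1 → (gaugePolar ℓ q).1 ≠ 0 := fun q hq h ↦
    hq.ne' (gaugePolar_fst_eq_zero.1 h)
  set s : V × ℝ≥0 × ℝ → ℝ := fun q ↦ Real.pi / 2 * ℓ (σ.symm q).2.1 - (σ.symm q).2.2 with hs
  have hscont : Continuous s := by
    have := σ.symm.continuous
    fun_prop
  have hs0 : ∀ v u, s (v, 0, u) = -u := fun v u ↦ by simp [hs, hσ0', hℓ0]
  have hsneg : ∀ q : V × ℝ≥0 × ℝ, 0 < q.2.1 → q.2.2 ≤ 0 → 0 < s q := by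
    intro q hq hu
    have hr := hσr' q hq
    have hℓr := hpos _ hr
    have h1 := hσu _ hr
    rw [σ.apply_symm_apply] at h1
    have h2 : (σ.symm q).2.2 / ℓ (σ.symm q).2.1 + δ (gaugePolar ℓ (σ.symm q)) ≤ 0 := by
      by_contra! h
      have := mul_pos h (hpos _ hq)
      linarith
    have h3 := (hc _).lt_pi_div_two (hP0 _ hr) (hexp _) h2
    rw [div_lt_iff₀ hℓr] at h3
    simp only [hs]; linarith
  set N : Set (V × ℝ≥0 × ℝ) := {q | s q ≤ 0} with hN
  have hNc : IsClosed N := isClosed_le hscont continuous_const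
  have hNn : N.Nonempty := ⟨(0, 0, 1), by simp [hN, hs0]⟩
  set c : V × ℝ≥0 → ℝ := fun a ↦ Metric.infDist (a.1, a.2, (0 : ℝ)) N / 2 with hcdef
  have hcc : Continuous c :=
    ((Metric.continuous_infDist_pt N).comp (by fun_prop)).div_const 2
  have hc0 : ∀ v, c (v, 0) = 0 := fun v ↦ by
    have : ((v, 0, 0) : V × ℝ≥0 × ℝ) ∈ N := by simp [hN, hs0]
    simp [hcdef, Metric.infDist_zero_of_mem this]
  have hcpos : ∀ v r, 0 < r → 0 < c (v, r) := fun v r hr ↦ by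
    refine half_pos ((hNc.notMem_iff_infDist_pos hNn).1 ?_)
    exact (hsneg (v, r, 0) hr le_rfl).not_ge
  have hcnn : ∀ v r, 0 ≤ c (v, r) := fun v r ↦ div_nonneg Metric.infDist_nonneg zero_le_two
  have hC1 : ∀ q : V × ℝ≥0 × ℝ, 0 < q.2.1 → q.2.2 ≤ c (q.1, q.2.1) → 0 < s q := by
    rintro ⟨v, r, u⟩ hr hu
    rcases le_or_gt u 0 with h | h
    · exact hsneg _ hr h
    · by_contra! h'
      have h1 : Metric.infDist ((v, r, 0) : V × ℝ≥0 × ℝ) N ≤ dist (v, r, (0 : ℝ)) (v, r, u) :=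
        Metric.infDist_le_dist_of_mem h'
      have h2 : dist ((v, r, 0) : V × ℝ≥0 × ℝ) (v, r, u) = u := by
        simp [Prod.dist_eq, h.le, abs_of_pos h]
      have h3 := hcpos v r hr
      simp only [hcdef] at hu h3
      linarith
  have hC2 : ∀ q : V × ℝ≥0 × ℝ, q.2.2 ≤ c (q.1, q.2.1) → 0 ≤ s q := by
    intro q hu
    rcases eq_or_ne q.2.1 0 with hr | hr
    · obtain ⟨v, r, u⟩ := q
      simp only at hr
      subst hr
      simp only [hc0] at hu
      rw [hs0]; linarith
    · exact (hC1 q (pos_iff_ne_zero.2 hr) hu).le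
  have hopen : ∀ q : V × ℝ≥0 × ℝ, 0 ≤ q.2.2 → 0 ≤ s q → 0 ≤ s (openCorner c q) := by
    intro q hu hsq
    rcases le_total (c (q.1, q.2.1)) q.2.2 with h | h
    · rwa [openCorner_of_ge hc0 hcpos h]
    · exact hC2 _ (openCorner_snd_le hc0 hcpos hu h)
  have hclose : ∀ q : V × ℝ≥0 × ℝ, 0 ≤ s q → 0 ≤ s (closeCorner c q) := by
    intro q hsq
    rcases le_total (c (q.1, q.2.1)) q.2.2 with h | h
    · rwa [closeCorner_of_ge hc0 hcnn h]
    · exact hC2 _ (closeCorner_snd_le hc0 hcnn h)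
  have hsσ : ∀ q, s (σ q) = Real.pi / 2 * ℓ q.2.1 - q.2.2 := fun q ↦ by
    simp only [hs, σ.symm_apply_apply]
  have hℓnn : ∀ r, 0 ≤ ℓ r := fun r ↦ by
    rcases eq_or_ne r 0 with rfl | hr
    · exact hℓ0.ge
    · exact (hpos _ (pos_iff_ne_zero.2 hr)).le
  -- the image of the quadrant in gauged polar coordinates
  have hA : ∀ p : ℂ × V, 0 ≤ p.1.re → 0 ≤ (g p).1.im →
      0 ≤ (σ (gaugeArg ℓ p)).2.2 ∧ 0 ≤ s (σ (gaugeArg ℓ p)) := by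
    intro p h1 h2
    constructor
    · rcases eq_or_ne p.1 0 with h0 | h0
      · simp [gaugeArg, h0, hσ0]
      · have hr : 0 < (gaugeArg ℓ p).2.1 := nnnorm_pos.2 h0
        rw [hσu _ hr, gaugePolar_gaugeArg hpos]
        refine mul_nonneg ?_ (hℓnn _)
        have h3 : (gaugeArg ℓ p).2.2 / ℓ (gaugeArg ℓ p).2.1 = p.1.arg :=
          mul_div_cancel_left₀ _ (hpos _ hr).ne'
        rw [h3]
        exact CrossCompatible.arg_add_nonneg h1 h2
    · rw [hsσ]
      have h3 := (abs_arg_le h1).2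
      have h4 := hℓnn ‖p.1‖₊
      simp only [gaugeArg]; nlinarith
  have hB : ∀ q : V × ℝ≥0 × ℝ, 0 ≤ q.2.2 → 0 ≤ s q →
      0 ≤ (gaugePolar ℓ (σ.symm q)).1.re ∧ 0 ≤ (g (gaugePolar ℓ (σ.symm q))).1.im ∧
        gaugeArg ℓ (gaugePolar ℓ (σ.symm q)) = σ.symm q := by
    intro q hu hsq
    rcases eq_or_ne q.2.1 0 with hr | hr
    · obtain ⟨v, r, u⟩ := q
      simp only at hr hu
      subst hr
      rw [hs0] at hsq
      obtain rfl : u = 0 := by linarith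
      rw [hσ0']
      simp [gaugePolar, gaugeArg, hg0]
    · have hr' := hσr' q (pos_iff_ne_zero.2 hr)
      have h1 := hσu _ hr'
      rw [σ.apply_symm_apply] at h1
      have hℓr := hpos _ hr'
      have h2 : 0 ≤ (σ.symm q).2.2 / ℓ (σ.symm q).2.1 + δ (gaugePolar ℓ (σ.symm q)) := by
        by_contra! h
        have := mul_neg_of_neg_of_pos h (hpos _ (pos_iff_ne_zero.2 hr))
        linarith
      have h3 : (σ.symm q).2.2 / ℓ (σ.symm q).2.1 ≤ Real.pi / 2 := by
        rw [div_le_iff₀ hℓr]; simp only [hs] at hsq; linarith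
      obtain ⟨h4, h5, h6⟩ := CrossCompatible.eq_arg (hP0 _ hr') (hexp _) h3 h2
      refine ⟨h4, h5, ?_⟩
      refine Prod.ext rfl (Prod.ext (nnnorm_gaugePolar_fst ℓ _) ?_)
      simp only [gaugeArg, nnnorm_gaugePolar_fst]
      rw [← h6, mul_div_cancel₀ _ hℓr.ne']
  refine ⟨fun p ↦ quarterMap ℓ (σ.symm (openCorner c (σ (gaugeArg ℓ p)))),
    fun p ↦ gaugePolar ℓ (σ.symm (closeCorner c (σ (quarterInv ℓ p)))), ?_, ?_, ?_, ?_, ?_, ?_⟩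
  · have h1 : Continuous fun q ↦ quarterMap ℓ (σ.symm (openCorner c (σ q))) :=
      (continuous_quarterMap hℓ).comp (σ.symm.continuous.comp
        ((continuous_openCorner hcc hcpos).comp σ.continuous))
    exact h1.comp_continuousOn ((continuousOn_gaugeArg hℓ hℓ0).mono fun p hp ↦ hp.1)
  · exact ((continuous_gaugePolar hℓ hpos).comp (σ.symm.continuous.comp
      ((continuous_closeCorner hcc hc0).comp
        (σ.continuous.comp (continuous_quarterInv hℓ))))).continuousOn
  · intro p h1 h2
    obtain ⟨h3, h4⟩ := hA p h1 h2
    refine ⟨hopen _ h3 h4, NNReal.coe_nonneg _, ?_⟩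
    beta_reduce
    rw [quarterInv_quarterMap, σ.apply_symm_apply, closeCorner_openCorner hc0 hcpos h3,
      σ.symm_apply_apply, gaugePolar_gaugeArg hpos]
  · intro p h1 h2
    have h3 : 0 ≤ s (σ (quarterInv ℓ p)) := by
      rw [hsσ]; simpa [quarterInv] using h1
    obtain ⟨h4, h5, h6⟩ := hB _ (closeCorner_snd_nonneg (c := c) (σ (quarterInv ℓ p)))
      (hclose _ h3)
    refine ⟨h4, h5, ?_⟩
    beta_reduce
    rw [h6, σ.apply_symm_apply, openCorner_closeCorner hc0 hcpos, σ.symm_apply_apply,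
      quarterMap_quarterInv ℓ h2]
  · intro p h1 h2
    have key : openCorner c (σ (gaugeArg ℓ p)) = σ (gaugeArg ℓ p) ∧ p.1 = ⟨0, ‖p.1‖⟩ ∧
        Real.pi / 2 * ℓ ‖p.1‖₊ = ℓ ‖p.1‖₊ * p.1.arg := by
      rcases eq_or_ne p.1 0 with h0 | h0
      · refine ⟨?_, ?_, ?_⟩
        · have : gaugeArg ℓ p = (p.2, 0, 0) := by simp [gaugeArg, h0]
          rw [this, hσ0]
          exact openCorner_of_ge hc0 hcpos (hc0 _).le
        · rw [h0]; simp [Complex.ext_iff]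
        · simp [h0, hℓ0]
      · have h3 : 0 < p.1.im := by
          rcases lt_trichotomy p.1.im 0 with h | h | h
          · exact absurd ((hc p).im_neg h1 h) h2.not_gt
          · exact absurd (Complex.ext h1 h) h0
          · exact h
        have h4 := arg_eq_pi_div_two h1 h3
        refine ⟨openCorner_of_ge hc0 hcpos ?_, ?_, by rw [h4]; ring⟩
        · by_contra! h
          have h5 := hC1 _ (hσr _ (by simpa [gaugeArg] using h0)) h.le
          rw [hsσ] at h5
          simp only [gaugeArg, h4] at h5
          linarith
        · have h5 := Complex.norm_mul_exp_arg_mul_I p.1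
          rw [h4] at h5
          push_cast at h5
          rw [Complex.exp_pi_div_two_mul_I] at h5
          conv_lhs => rw [← h5]
          simp [Complex.ext_iff]
    obtain ⟨k1, k2, k3⟩ := key
    beta_reduce
    rw [k1, σ.symm_apply_apply]
    refine Prod.ext ?_ rfl
    rw [k2]
    simp only [quarterMap, gaugeArg, k3, sub_self, coe_nnnorm, ← k2]
  · intro p h1 h2
    have key : (σ (gaugeArg ℓ p)).2.2 = 0 ∧ 0 ≤ (g p).1.re := by
      rcases eq_or_ne p.1 0 with h0 | h0
      · refine ⟨by simp [gaugeArg, h0, hσ0], ?_⟩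
        rw [(hc p).eq_zero_iff.1 h0]; simp
      · refine ⟨?_, ?_⟩
        · have hr : 0 < (gaugeArg ℓ p).2.1 := nnnorm_pos.2 h0
          rw [hσu _ hr, gaugePolar_gaugeArg hpos]
          have h3 : (gaugeArg ℓ p).2.2 / ℓ (gaugeArg ℓ p).2.1 = p.1.arg :=
            mul_div_cancel_left₀ _ (hpos _ hr).ne'
          rw [h3, hδdef]
          simp only
          rw [(hc p).arg_add_eq_zero h0 h1 h2, zero_mul]
        · by_contra! h
          exact absurd ((hc p).re_neg h2 h) h1.not_gt
    obtain ⟨k1, k2⟩ := key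
    have h3 := hPσ (gaugeArg ℓ p)
    rw [gaugePolar_gaugeArg hpos] at h3
    have h4 : σ (gaugeArg ℓ p) = ((g p).2, ‖(g p).1‖₊, 0) := by
      refine Prod.ext ?_ (Prod.ext ?_ k1)
      · rw [← h3]; rfl
      · rw [← h3, nnnorm_gaugePolar_fst]
    beta_reduce
    rw [h4, openCorner_of_eq_zero hc0 hcpos, hσ0']
    refine Prod.ext ?_ rfl
    have h5 : ‖(g p).1‖ = (g p).1.re := by
      have : (g p).1 = ((g p).1.re : ℂ) := Complex.ext (by simp) (by simp [h2])
      rw [this, Complex.norm_real, Real.norm_of_nonneg k2, Complex.ofReal_re]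
    refine Complex.ext ?_ ?_
    · simp [quarterMap, hℓ0, h5]
    · simp [quarterMap, h2]

end Quadrant

section Glue

open Filter Topology

variable {V : Type*}

/-- Rescaling of the real and imaginary parts of the first factor. -/
def signFlip (s t : ℝ) (p : ℂ × V) : ℂ × V := (⟨s * p.1.re, t * p.1.im⟩, p.2)

lemma signFlip_signFlip {s t : ℝ} (hs : s * s = 1) (ht : t * t = 1) (p : ℂ × V) :
    signFlip s t (signFlip s t p) = p := by
  refine Prod.ext (Complex.ext ?_ ?_) rfl
  · simp [signFlip, ← mul_assoc, hs]
  · simp [signFlip, ← mul_assoc, ht]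

variable [NormedAddCommGroup V]

lemma continuous_signFlip (s t : ℝ) : Continuous (signFlip s t : ℂ × V → ℂ × V) := by
  have h : (signFlip s t : ℂ × V → ℂ × V) =
      fun p ↦ (((s * p.1.re : ℝ) : ℂ) + ((t * p.1.im : ℝ) : ℂ) * Complex.I, p.2) := by
    ext p
    · simp [signFlip, Complex.ext_iff]
    · rfl
  have h1 : Continuous fun p : ℂ × V ↦ p.1.re := Complex.continuous_re.comp continuous_fst
  have h2 : Continuous fun p : ℂ × V ↦ p.1.im := Complex.continuous_im.comp continuous_fst
  rw [h]; fun_prop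

/-- `signFlip s t` as a homeomorphism, for signs `s` and `t`. -/
def signFlipHomeomorph {s t : ℝ} (hs : s * s = 1) (ht : t * t = 1) : (ℂ × V) ≃ₜ (ℂ × V) where
  toFun := signFlip s t
  invFun := signFlip s t
  left_inv := signFlip_signFlip hs ht
  right_inv := signFlip_signFlip hs ht
  continuous_toFun := continuous_signFlip s t
  continuous_invFun := continuous_signFlip s t

lemma CrossCompatible.signFlip {z w : ℂ} (h : CrossCompatible z w) {s t : ℝ} (hs : s * s = 1)
    (ht : t * t = 1) : CrossCompatible ⟨s * z.re, t * z.im⟩ ⟨s * w.re, t * w.im⟩ := by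
  obtain ⟨h1, h2, h3, h4, h5⟩ := h
  constructor <;> rcases mul_self_eq_one_iff.1 hs with rfl | rfl <;>
    rcases mul_self_eq_one_iff.1 ht with rfl | rfl <;>
    simp_all [Complex.ext_iff]

/-- The four quadrants `{s re z ≥ 0, t im (g z) ≥ 0}`. -/
theorem exists_signed_quadrant_maps [ProperSpace V] (g : (ℂ × V) ≃ₜ (ℂ × V))
    (hg0 : ∀ v, g (0, v) = (0, v)) (hc : ∀ p, CrossCompatible p.1 (g p).1)
    {s t : ℝ} (hs : s * s = 1) (ht : t * t = 1) :
    ∃ q q' : ℂ × V → ℂ × V,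
      ContinuousOn q {p | 0 ≤ s * p.1.re ∧ 0 ≤ t * (g p).1.im} ∧
      ContinuousOn q' {p | 0 ≤ s * p.1.re ∧ 0 ≤ t * p.1.im} ∧
      (∀ p : ℂ × V, 0 ≤ s * p.1.re → 0 ≤ t * (g p).1.im →
        0 ≤ s * (q p).1.re ∧ 0 ≤ t * (q p).1.im ∧ q' (q p) = p) ∧
      (∀ p : ℂ × V, 0 ≤ s * p.1.re → 0 ≤ t * p.1.im →
        0 ≤ s * (q' p).1.re ∧ 0 ≤ t * (g (q' p)).1.im ∧ q (q' p) = p) ∧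
      (∀ p : ℂ × V, p.1.re = 0 → 0 ≤ t * (g p).1.im → q p = p) ∧
      ∀ p : ℂ × V, 0 ≤ s * p.1.re → (g p).1.im = 0 → q p = g p := by
  set F : (ℂ × V) ≃ₜ (ℂ × V) := signFlipHomeomorph hs ht with hF
  have hFF : ∀ p, F (F p) = p := signFlip_signFlip hs ht
  have hre : ∀ p, (F p).1.re = s * p.1.re := fun p ↦ rfl
  have him : ∀ p, (F p).1.im = t * p.1.im := fun p ↦ rfl
  have hF0 : ∀ v, F (0, v) = (0, v) := fun v ↦ Prod.ext (by simp [hF, signFlipHomeomorph, signFlip, Complex.ext_iff]) rfl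
  obtain ⟨q, q', h1, h2, h3, h4, h5, h6⟩ := exists_quadrant_maps (F.trans (g.trans F))
    (fun v ↦ by simp [hF0, hg0])
    (fun p ↦ by
      have := (hc (F p)).signFlip hs ht
      have e : (⟨s * (F p).1.re, t * (F p).1.im⟩ : ℂ) = (F (F p)).1 := rfl
      rw [e, hFF] at this
      exact this)
  simp only [Homeomorph.trans_apply] at h1 h3 h4 h5 h6
  have hmem : ∀ p, t * (g p).1.im = (F (g (F (F p)))).1.im := fun p ↦ by rw [hFF, him]
  refine ⟨fun p ↦ F (q (F p)), fun p ↦ F (q' (F p)), ?_, ?_, ?_, ?_, ?_, ?_⟩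
  · refine F.continuous.comp_continuousOn (h1.comp F.continuous.continuousOn ?_)
    rintro p ⟨hp, hp'⟩
    exact ⟨hp, by rwa [hmem] at hp'⟩
  · exact F.continuous.comp_continuousOn (h2.comp F.continuous.continuousOn fun p hp ↦ hp)
  · intro p hp hp'
    obtain ⟨k1, k2, k3⟩ := h3 (F p) hp (by rwa [hmem] at hp')
    refine ⟨?_, ?_, ?_⟩
    · rw [← hre, hFF]; exact k1
    · rw [← him, hFF]; exact k2
    · beta_reduce; rw [hFF, k3, hFF]
  · intro p hp hp'
    obtain ⟨k1, k2, k3⟩ := h4 (F p) hp hp'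
    refine ⟨?_, ?_, ?_⟩
    · rw [← hre, hFF]; exact k1
    · exact k2
    · beta_reduce; rw [hFF, k3, hFF]
  · intro p hp hp'
    beta_reduce; rw [h5 (F p) (by rw [hre, hp, mul_zero]) (by rwa [hmem] at hp'), hFF]
  · intro p hp hp'
    beta_reduce; rw [h6 (F p) hp (by rw [← hmem, hp', mul_zero]), hFF, hFF]

/-- If `g` is compatible with a crossing of the lines `{re = 0}` and `{im = 0}`, then `{re z = 0}`
and `{im (g z) = 0}` can be straightened simultaneously. -/
theorem exists_homeomorph_straighten [ProperSpace V] (g : (ℂ × V) ≃ₜ (ℂ × V))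
    (hg0 : ∀ v, g (0, v) = (0, v)) (hc : ∀ p, CrossCompatible p.1 (g p).1) :
    ∃ e : (ℂ × V) ≃ₜ (ℂ × V), ∀ p, ((e p).1.re = 0 ↔ p.1.re = 0) ∧
      ((e p).1.im = 0 ↔ (g p).1.im = 0) := by
  set sg : Bool → ℝ := fun b ↦ if b then 1 else -1 with hsg
  have hsq : ∀ b, sg b * sg b = 1 := by intro b; cases b <;> simp [hsg]
  have hzero : ∀ {b b' : Bool} {x : ℝ}, b ≠ b' → 0 ≤ sg b * x → 0 ≤ sg b' * x → x = 0 := by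
    intro b b' x hb h1 h2
    cases b <;> cases b' <;> simp [hsg] at * <;> linarith
  have hex : ∀ x : ℝ, ∃ b, 0 ≤ sg b * x := fun x ↦ by
    rcases le_total 0 x with h | h
    · exact ⟨true, by simpa [hsg] using h⟩
    · exact ⟨false, by simpa [hsg] using h⟩
  choose q q' h1 h2 h3 h4 h5 h6 using fun b : Bool × Bool ↦
    exists_signed_quadrant_maps g hg0 hc (hsq b.1) (hsq b.2)
  set P : Bool × Bool → Set (ℂ × V) :=
    fun b ↦ {p | 0 ≤ sg b.1 * p.1.re ∧ 0 ≤ sg b.2 * (g p).1.im} with hP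
  set P' : Bool × Bool → Set (ℂ × V) :=
    fun b ↦ {p | 0 ≤ sg b.1 * p.1.re ∧ 0 ≤ sg b.2 * p.1.im} with hP'
  have hcov : ∀ p, ∃ b, p ∈ P b := fun p ↦ by
    obtain ⟨b, hb⟩ := hex p.1.re
    obtain ⟨b', hb'⟩ := hex (g p).1.im
    exact ⟨(b, b'), hb, hb'⟩
  have hcov' : ∀ p, ∃ b, p ∈ P' b := fun p ↦ by
    obtain ⟨b, hb⟩ := hex p.1.re
    obtain ⟨b', hb'⟩ := hex p.1.im
    exact ⟨(b, b'), hb, hb'⟩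
  have h5' : ∀ b, ∀ p ∈ P' b, p.1.re = 0 → q' b p = p := by
    intro b p hp h0
    have hgp : 0 ≤ sg b.2 * (g p).1.im := by
      rcases eq_or_ne p.1.im 0 with hi | hi
      · rw [(hc p).eq_zero_iff.1 (Complex.ext h0 hi)]; simp
      · have hp2 := hp.2
        obtain ⟨b1, b2⟩ := b
        cases b2
        · simp only [hsg, Bool.false_eq_true, if_false, neg_mul, one_mul] at hp2 ⊢
          linarith [(hc p).im_neg h0 (lt_of_le_of_ne (by linarith) hi)]
        · simp only [hsg, if_true, one_mul] at hp2 ⊢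
          exact ((hc p).im_pos h0 (lt_of_le_of_ne hp2 hi.symm)).le
    have h7 := (h3 b p (by rw [h0, mul_zero]) hgp).2.2
    rwa [h5 b p h0 hgp] at h7
  have h6' : ∀ b, ∀ p ∈ P' b, p.1.im = 0 → q' b p = g.symm p := by
    intro b p hp h0
    have hgp : 0 ≤ sg b.1 * (g.symm p).1.re := by
      have hc' := hc (g.symm p)
      rw [g.apply_symm_apply] at hc'
      rcases eq_or_ne p.1.re 0 with hi | hi
      · rw [hc'.eq_zero_iff.2 (Complex.ext hi h0)]; simp
      · have hp1 := hp.1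
        obtain ⟨b1, b2⟩ := b
        cases b1
        · simp only [hsg, Bool.false_eq_true, if_false, neg_mul, one_mul] at hp1 ⊢
          linarith [hc'.re_neg h0 (lt_of_le_of_ne (by linarith) hi)]
        · simp only [hsg, if_true, one_mul] at hp1 ⊢
          exact (hc'.re_pos h0 (lt_of_le_of_ne hp1 hi.symm)).le
    have h7 := (h3 b (g.symm p) hgp (by rw [g.apply_symm_apply, h0, mul_zero])).2.2
    rwa [h6 b _ hgp (by rwa [g.apply_symm_apply]), g.apply_symm_apply] at h7
  have hagree : ∀ b b' p, p ∈ P b → p ∈ P b' → q b p = q b' p := by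
    rintro ⟨b1, b2⟩ ⟨b1', b2'⟩ p hp hp'
    by_cases e1 : b1 = b1'
    · by_cases e2 : b2 = b2'
      · rw [e1, e2]
      · have h0 := hzero e2 hp.2 hp'.2
        rw [h6 _ p hp.1 h0, h6 _ p hp'.1 h0]
    · have h0 := hzero e1 hp.1 hp'.1
      rw [h5 _ p h0 hp.2, h5 _ p h0 hp'.2]
  have hagree' : ∀ b b' p, p ∈ P' b → p ∈ P' b' → q' b p = q' b' p := by
    rintro ⟨b1, b2⟩ ⟨b1', b2'⟩ p hp hp'
    by_cases e1 : b1 = b1'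
    · by_cases e2 : b2 = b2'
      · rw [e1, e2]
      · have h0 := hzero e2 hp.2 hp'.2
        rw [h6' _ p hp h0, h6' _ p hp' h0]
    · have h0 := hzero e1 hp.1 hp'.1
      rw [h5' _ p hp h0, h5' _ p hp' h0]
  choose β hβ using hcov
  choose β' hβ' using hcov'
  have hcre : Continuous fun p : ℂ × V ↦ p.1.re := Complex.continuous_re.comp continuous_fst
  have hcim : Continuous fun p : ℂ × V ↦ p.1.im := Complex.continuous_im.comp continuous_fst
  have hcl : ∀ b, IsClosed (P b) := fun b ↦
    (isClosed_le continuous_const (hcre.const_mul _)).inter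
      (isClosed_le continuous_const ((hcim.comp g.continuous).const_mul _))
  have hcl' : ∀ b, IsClosed (P' b) := fun b ↦
    (isClosed_le continuous_const (hcre.const_mul _)).inter
      (isClosed_le continuous_const (hcim.const_mul _))
  refine ⟨⟨⟨fun p ↦ q (β p) p, fun p ↦ q' (β' p) p, ?_, ?_⟩, ?_, ?_⟩, ?_⟩
  · intro p
    have hp := h3 (β p) p (hβ p).1 (hβ p).2
    beta_reduce
    rw [hagree' _ (β p) _ (hβ' _) ⟨hp.1, hp.2.1⟩, hp.2.2]
  · intro p
    have hp := h4 (β' p) p (hβ' p).1 (hβ' p).2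
    beta_reduce
    rw [hagree _ (β' p) _ (hβ _) ⟨hp.1, hp.2.1⟩, hp.2.2]
  · rw [continuous_iff_continuousAt]
    intro p
    refine continuousAt_of_isClosed_cover hcl (fun y ↦ ⟨_, hβ y⟩) fun b hb ↦ ?_
    exact (h1 b p hb).congr (fun y hy ↦ hagree _ _ _ (hβ y) hy) (hagree _ _ _ (hβ p) hb)
  · rw [continuous_iff_continuousAt]
    intro p
    refine continuousAt_of_isClosed_cover hcl' (fun y ↦ ⟨_, hβ' y⟩) fun b hb ↦ ?_
    exact (h2 b p hb).congr (fun y hy ↦ hagree' _ _ _ (hβ' y) hy) (hagree' _ _ _ (hβ' p) hb)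
  · intro p
    have hp := h3 (β p) p (hβ p).1 (hβ p).2
    change ((q (β p) p).1.re = 0 ↔ _) ∧ ((q (β p) p).1.im = 0 ↔ _)
    refine ⟨⟨fun h ↦ ?_, fun h ↦ ?_⟩, fun h ↦ ?_, fun h ↦ ?_⟩
    · have := h5' (β p) _ ⟨hp.1, hp.2.1⟩ h
      rw [hp.2.2] at this
      rwa [← this] at h
    · rw [h5 _ p h (hβ p).2, h]
    · have := h6' (β p) _ ⟨hp.1, hp.2.1⟩ h
      rw [hp.2.2] at this
      rw [this, g.apply_symm_apply, h]
    · rw [h6 _ p (hβ p).1 h, h]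

end Glue

section NormalForm

variable {X W : Type*} [TopologicalSpace X] [TopologicalSpace W]

/-- Splitting off the first coordinate of `ℝ^{d+1}`. -/
def finConsHomeomorph (d : ℕ) : (Fin (d + 1) → ℝ) ≃ₜ ℝ × (Fin d → ℝ) where
  toFun x := (x 0, fun i ↦ x i.succ)
  invFun y := Fin.cons y.1 y.2
  left_inv x := by
    ext i
    refine Fin.cases ?_ (fun i ↦ ?_) i <;> simp
  right_inv y := by ext <;> simp
  continuous_toFun := by fun_prop
  continuous_invFun := by
    refine continuous_pi fun i ↦ ?_
    refine Fin.cases ?_ (fun i ↦ ?_) i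
    · simpa using continuous_fst
    · simp only [Fin.cons_succ]; fun_prop

/-- The fibre over `0` of a product decomposition. -/
def zeroFibreHomeomorph (e : X ≃ₜ ℝ × W) {A : Set X} (hA : ∀ x, x ∈ A ↔ (e x).1 = 0) :
    A ≃ₜ W where
  toFun a := (e a).2
  invFun w := ⟨e.symm (0, w), (hA _).2 (by rw [e.apply_symm_apply])⟩
  left_inv a := by
    have h : ((0 : ℝ), (e a).2) = e a := Prod.ext ((hA a).1 a.2).symm rfl
    apply Subtype.ext
    change e.symm (0, (e a).2) = a
    rw [h, e.symm_apply_apply]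
  right_inv w := by
    change (e (e.symm (0, w))).2 = w
    rw [e.apply_symm_apply]
  continuous_toFun := by fun_prop
  continuous_invFun := by fun_prop

/-- The identification of the zero fibre with the second factor can be prescribed. -/
theorem exists_homeomorph_prod_extend (e : X ≃ₜ ℝ × W) {A : Set X}
    (hA : ∀ x, x ∈ A ↔ (e x).1 = 0) (χ : A ≃ₜ W) :
    ∃ e' : X ≃ₜ ℝ × W, (∀ x, (e' x).1 = (e x).1) ∧ ∀ a : A, (e' a).2 = χ a := by
  refine ⟨e.trans ((Homeomorph.refl ℝ).prodCongr ((zeroFibreHomeomorph e hA).symm.trans χ)),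
    fun x ↦ rfl, fun a ↦ ?_⟩
  change χ ((zeroFibreHomeomorph e hA).symm ((zeroFibreHomeomorph e hA) a)) = χ a
  rw [Homeomorph.symm_apply_apply]

/-- The sign of the first coordinate can be adapted to a function with the same zeros. -/
theorem exists_homeomorph_prod_sign [PreconnectedSpace W] (e : X ≃ₜ ℝ × W) {φ : X → ℝ}
    (hφ : Continuous φ) (h0 : ∀ x, φ x = 0 ↔ (e x).1 = 0) (hpos : ∃ x, 0 < φ x)
    (hneg : ∃ x, φ x < 0) :
    ∃ e' : X ≃ₜ ℝ × W, (∀ x, (e' x).2 = (e x).2) ∧ (∀ x, (e' x).1 = 0 ↔ (e x).1 = 0) ∧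
      (∀ x, 0 < (e' x).1 → 0 < φ x) ∧ ∀ x, (e' x).1 < 0 → φ x < 0 := by
  have key : ∀ (ψ : X → ℝ) (I : Set ℝ), Continuous ψ → IsPreconnected I → (0 : ℝ) ∉ I →
      (∀ x, ψ x = 0 ↔ (e x).1 = 0) → ∀ a, (e a).1 ∈ I → 0 < ψ a →
      ∀ x, (e x).1 ∈ I → 0 < ψ x := by
    intro ψ I hψ hI h0I hψ0 a ha hpa x hx
    have hU : IsPreconnected (e ⁻¹' (I ×ˢ (univ : Set W))) := by
      rw [e.isPreconnected_preimage]
      exact hI.prod isPreconnected_univ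
    refine pos_of_isPreconnected hU hψ.continuousOn (fun y hy h ↦ h0I ?_) (a := a) ⟨ha, trivial⟩
      hpa x ⟨hx, trivial⟩
    rw [← (hψ0 y).1 h]; exact hy.1
  have hP := isPreconnected_Ioi (a := (0 : ℝ))
  have hN := isPreconnected_Iio (a := (0 : ℝ))
  have hnφ : ∀ x, -φ x = 0 ↔ (e x).1 = 0 := fun x ↦ by rw [neg_eq_zero, h0]
  obtain ⟨x₁, hx₁⟩ := hpos
  obtain ⟨x₂, hx₂⟩ := hneg
  have hx₁0 : (e x₁).1 ≠ 0 := fun h ↦ hx₁.ne' ((h0 _).2 h)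
  have hx₂0 : (e x₂).1 ≠ 0 := fun h ↦ hx₂.ne ((h0 _).2 h)
  have pp := key φ (Ioi 0) hφ hP (by simp) h0
  have pn := key φ (Iio 0) hφ hN (by simp) h0
  have np := key (fun x ↦ -φ x) (Ioi 0) hφ.neg hP (by simp) hnφ
  have nn := key (fun x ↦ -φ x) (Iio 0) hφ.neg hN (by simp) hnφ
  simp only [mem_Ioi, mem_Iio, Left.neg_pos_iff] at pp pn np nn
  rcases lt_or_gt_of_ne hx₁0 with h | h
  · have h' : 0 < (e x₂).1 := by
      by_contra! h''
      exact (pn x₁ h hx₁ x₂ (lt_of_le_of_ne h'' hx₂0)).not_gt hx₂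
    refine ⟨e.trans ((Homeomorph.neg ℝ).prodCongr (Homeomorph.refl W)), fun x ↦ rfl,
      fun x ↦ neg_eq_zero, fun x hx ↦ pn x₁ h hx₁ x ?_, fun x hx ↦ np x₂ h' hx₂ x ?_⟩
    · exact neg_pos.1 hx
    · exact neg_lt_zero.1 hx
  · have h' : (e x₂).1 < 0 := by
      by_contra! h''
      exact (pp x₁ h hx₁ x₂ (lt_of_le_of_ne h'' hx₂0.symm)).not_gt hx₂
    exact ⟨e, fun x ↦ rfl, fun x ↦ Iff.rfl, pp x₁ h hx₁, nn x₂ h' hx₂⟩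

/-- Two hypersurfaces meeting in a common hypersurface of each, each of them meeting both sides of
the other, can be straightened simultaneously. -/
theorem exists_homeomorph_complex_prod {V : Type*} [NormedAddCommGroup V] [ProperSpace V]
    [PreconnectedSpace V] {A B : Set X} (a b : X ≃ₜ ℝ × (ℝ × V))
    (ha : ∀ x, x ∈ A ↔ (a x).1 = 0) (hb : ∀ x, x ∈ B ↔ (b x).1 = 0)
    (χA : A ≃ₜ ℝ × V) (χB : B ≃ₜ ℝ × V)
    (hχA : ∀ x : A, (x : X) ∈ B ↔ (χA x).1 = 0) (hχB : ∀ x : B, (x : X) ∈ A ↔ (χB x).1 = 0)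
    (hBp : ∃ x ∈ B, 0 < (a x).1) (hBn : ∃ x ∈ B, (a x).1 < 0)
    (hAp : ∃ x ∈ A, 0 < (b x).1) (hAn : ∃ x ∈ A, (b x).1 < 0) :
    ∃ T : X ≃ₜ ℂ × V, ∀ x, ((T x).1.re = 0 ↔ x ∈ A) ∧ ((T x).1.im = 0 ↔ x ∈ B) := by
  -- adapt the signs
  obtain ⟨χA, -, hχA0, hApos, hAneg⟩ := exists_homeomorph_prod_sign χA (φ := fun x : A ↦ (b x).1)
    (by fun_prop) (fun x ↦ by rw [← hb, hχA]) (by obtain ⟨x, h, h'⟩ := hAp; exact ⟨⟨x, h⟩, h'⟩)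
    (by obtain ⟨x, h, h'⟩ := hAn; exact ⟨⟨x, h⟩, h'⟩)
  obtain ⟨χB, -, hχB0, hBpos, hBneg⟩ := exists_homeomorph_prod_sign χB (φ := fun x : B ↦ (a x).1)
    (by fun_prop) (fun x ↦ by rw [← ha, hχB]) (by obtain ⟨x, h, h'⟩ := hBp; exact ⟨⟨x, h⟩, h'⟩)
    (by obtain ⟨x, h, h'⟩ := hBn; exact ⟨⟨x, h⟩, h'⟩)
  simp only [← hχA0] at hχA
  simp only [← hχB0] at hχB
  -- make the two coordinate systems agree on `A ∩ B`
  let sw : {x : B | (x : X) ∈ A} ≃ₜ {x : A | (x : X) ∈ B} :=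
    { toFun := fun x ↦ ⟨⟨x.1.1, x.2⟩, x.1.2⟩
      invFun := fun x ↦ ⟨⟨x.1.1, x.2⟩, x.1.2⟩
      left_inv := fun x ↦ rfl
      right_inv := fun x ↦ rfl
      continuous_toFun := by fun_prop
      continuous_invFun := by fun_prop }
  obtain ⟨χB, hB1, hB2⟩ := exists_homeomorph_prod_extend χB (A := {x : B | (x : X) ∈ A}) hχB
    (sw.trans (zeroFibreHomeomorph χA (A := {x : A | (x : X) ∈ B}) hχA))
  simp only [← hB1] at hχB hBpos hBneg
  obtain ⟨α, hα1, hα2⟩ := exists_homeomorph_prod_extend a ha χA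
  obtain ⟨β, hβ1, hβ2⟩ := exists_homeomorph_prod_extend b hb χB
  simp only [← hα1] at ha hBpos hBneg
  simp only [← hβ1] at hb hApos hAneg
  have hL : ∀ x, x ∈ A → x ∈ B → (α x).2.2 = (β x).2.2 := by
    intro x hxA hxB
    have h1 := hα2 ⟨x, hxA⟩
    have h2 := hβ2 ⟨x, hxB⟩
    have h3 := hB2 ⟨⟨x, hxB⟩, hxA⟩
    simp only at h1 h2 h3
    rw [h1, h2, h3]
    rfl
  have hLA : ∀ x ∈ A, (x ∈ B ↔ (α x).2.1 = 0) := fun x hx ↦ by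
    rw [hα2 ⟨x, hx⟩]; exact hχA ⟨x, hx⟩
  have hLB : ∀ x ∈ B, (x ∈ A ↔ (β x).2.1 = 0) := fun x hx ↦ by
    rw [hβ2 ⟨x, hx⟩]; exact hχB ⟨x, hx⟩
  let K : ℝ × (ℝ × V) ≃ₜ ℂ × V := (Homeomorph.prodAssoc ℝ ℝ V).symm.trans
    (Complex.equivRealProdCLM.symm.toHomeomorph.prodCongr (Homeomorph.refl V))
  let K' : ℝ × (ℝ × V) ≃ₜ ℂ × V := (Homeomorph.prodAssoc ℝ ℝ V).symm.trans
    (((Homeomorph.prodComm ℝ ℝ).trans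
      Complex.equivRealProdCLM.symm.toHomeomorph).prodCongr (Homeomorph.refl V))
  have hK : ∀ p, K p = (⟨p.1, p.2.1⟩, p.2.2) := fun p ↦ by
    refine Prod.ext (Complex.ext ?_ ?_) rfl <;> simp [K] <;> rfl
  have hK' : ∀ p, K' p = (⟨p.2.1, p.1⟩, p.2.2) := fun p ↦ by
    refine Prod.ext (Complex.ext ?_ ?_) rfl <;> simp [K'] <;> rfl
  set P := α.trans K with hP
  set Q := β.trans K' with hQ
  have hPx : ∀ x, P x = (⟨(α x).1, (α x).2.1⟩, (α x).2.2) := fun x ↦ hK _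
  have hQx : ∀ x, Q x = (⟨(β x).2.1, (β x).1⟩, (β x).2.2) := fun x ↦ hK' _
  have hg : ∀ x, (P.symm.trans Q) (P x) = Q x := fun x ↦ by simp
  have h00 : ∀ x, ((P x).1 = 0 ↔ x ∈ A ∧ x ∈ B) ∧ ((Q x).1 = 0 ↔ x ∈ A ∧ x ∈ B) := fun x ↦ by
    rw [hPx, hQx]
    simp only [Complex.ext_iff, Complex.zero_re, Complex.zero_im]
    refine ⟨⟨fun h ↦ ?_, fun h ↦ ?_⟩, fun h ↦ ?_, fun h ↦ ?_⟩
    · have hxA := (ha x).2 h.1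
      exact ⟨hxA, (hLA x hxA).2 h.2⟩
    · exact ⟨(ha x).1 h.1, (hLA x h.1).1 h.2⟩
    · have hxB := (hb x).2 h.2
      exact ⟨(hLB x hxB).2 h.1, hxB⟩
    · exact ⟨(hLB x h.2).1 h.1, (hb x).1 h.2⟩
  obtain ⟨e, he⟩ := exists_homeomorph_straighten (P.symm.trans Q)
    (fun v ↦ by
      obtain ⟨x, hx⟩ := P.surjective (0, v)
      rw [← hx, hg]
      have h1 : (P x).1 = 0 := by rw [hx]
      have h2 := (h00 x).1.1 h1
      refine Prod.ext ?_ ?_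
      · rw [(h00 x).2.2 h2, h1]
      · rw [hPx, hQx]; exact (hL x h2.1 h2.2).symm)
    (fun p ↦ by
      obtain ⟨x, rfl⟩ := P.surjective p
      rw [hg]
      refine ⟨(h00 x).1.trans (h00 x).2.symm, ?_, ?_, ?_, ?_⟩ <;> rw [hPx, hQx] <;>
        intro h0 h
      · have hxB := (hb x).2 h0
        exact hBpos ⟨x, hxB⟩ (by rwa [hβ2 ⟨x, hxB⟩] at h)
      · have hxB := (hb x).2 h0
        exact hBneg ⟨x, hxB⟩ (by rwa [hβ2 ⟨x, hxB⟩] at h)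
      · have hxA := (ha x).2 h0
        exact hApos ⟨x, hxA⟩ (by rwa [hα2 ⟨x, hxA⟩] at h)
      · have hxA := (ha x).2 h0
        exact hAneg ⟨x, hxA⟩ (by rwa [hα2 ⟨x, hxA⟩] at h))
  refine ⟨P.trans e, fun x ↦ ?_⟩
  have h1 := he (P x)
  rw [hg] at h1
  refine ⟨h1.1.trans ?_, h1.2.trans ?_⟩
  · rw [hPx]; exact (ha x).symm
  · rw [hQx]; exact (hb x).symm

end NormalForm

section Crossing

variable {n : ℕ}

lemma IsRelTopoplane.exists_homeomorph {Y Z : Set (Fin n → ℝ)} (h : IsRelTopoplane Y Z) :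
    ∃ d, ∃ φ : Y ≃ₜ (Fin (d + 1) → ℝ), ∀ y : Y, (y : Fin n → ℝ) ∈ Z ↔ φ y 0 = 0 := by
  obtain ⟨-, d, hd, φ, hφ⟩ := h
  obtain ⟨d, rfl⟩ := Nat.exists_eq_add_of_le' hd
  refine ⟨d, φ, fun y ↦ ?_⟩
  have h1 : φ y ∈ φ '' {y : Y | (y : Fin n → ℝ) ∈ Z} ↔ (y : Fin n → ℝ) ∈ Z :=
    φ.injective.mem_set_image
  rw [← h1, hφ]
  exact ⟨fun h ↦ h (Nat.succ_pos d), fun h _ ↦ h⟩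

lemma mem_iff_of_image_eq_coordHyp {e : (Fin (n + 1) → ℝ) ≃ₜ (Fin (n + 1) → ℝ)}
    {H : Set (Fin (n + 1) → ℝ)} (he : e '' H = coordHyp (n + 1) 0) (x : Fin (n + 1) → ℝ) :
    x ∈ H ↔ e x 0 = 0 := by
  rw [← e.injective.mem_set_image (s := H), he]
  exact ⟨fun h ↦ h (Nat.succ_pos n), fun h _ ↦ h⟩

lemma IsTopoplane.hasDim {H : Set (Fin (n + 1) → ℝ)} (h : IsTopoplane H) : HasDim H n := by
  obtain ⟨e, he⟩ := h
  exact ⟨(e.image H).trans ((Homeomorph.setCongr he).trans (coordHypHomeomorph n))⟩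

lemma HasDim.eq {Y : Set (Fin n → ℝ)} {d d' : ℕ} (h : HasDim Y d) (h' : HasDim Y d') :
    d = d' := by
  obtain ⟨φ⟩ := h
  obtain ⟨φ'⟩ := h'
  exact eq_of_homeomorph_pi (φ.symm.trans φ')

lemma isFlat_of_mem {𝓐 : Set (Set (Fin n → ℝ))} {A : Set (Fin n → ℝ)} (hA : A ∈ 𝓐)
    (h : A.Nonempty) : IsFlat 𝓐 A :=
  ⟨⟨{A}, by simpa using hA, by simp⟩, h⟩

/-- Intersecting distinct topoplanes of an arrangement are not contained in one another. -/
theorem IsArrangement.not_subset {𝓐 : Set (Set (Fin (n + 1) → ℝ))} (h𝓐 : IsArrangement 𝓐)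
    {A B : Set (Fin (n + 1) → ℝ)} (hA : A ∈ 𝓐) (hB : B ∈ 𝓐) (hne : A ≠ B)
    (hAB : (A ∩ B).Nonempty) : ¬ A ⊆ B := by
  intro hsub
  have hdA := (h𝓐.2.1 A hA).hasDim
  have hdB := (h𝓐.2.1 B hB).hasDim
  rcases h𝓐.2.2 A hA B (isFlat_of_mem hB hAB.right) with h | h | h
  · exact hne (hsub.antisymm h)
  · exact hAB.ne_empty h
  · obtain ⟨d, φ, hφ⟩ := h.exists_homeomorph
    rw [inter_eq_left.2 hsub] at hφ
    have h1 : d + 1 = n := HasDim.eq ⟨φ⟩ hdB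
    have h2 : HasDim A d := by
      let sw : A ≃ₜ {x : B | (x : Fin (n + 1) → ℝ) ∈ A} :=
        { toFun := fun x ↦ ⟨⟨x.1, hsub x.2⟩, x.2⟩
          invFun := fun x ↦ ⟨x.1.1, x.2⟩
          left_inv := fun x ↦ rfl
          right_inv := fun x ↦ rfl
          continuous_toFun := by fun_prop
          continuous_invFun := by fun_prop }
      exact ⟨sw.trans (zeroFibreHomeomorph (φ.trans (finConsHomeomorph d)) hφ)⟩
    have h3 := hdA.eq h2
    omega

/-- Intersecting topoplanes of an arrangement, each of them meeting both sides of the other,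
cross. -/
theorem IsArrangement.crosses {𝓐 : Set (Set (Fin (n + 1) → ℝ))} (h𝓐 : IsArrangement 𝓐)
    {A B : Set (Fin (n + 1) → ℝ)} (hA : A ∈ 𝓐) (hB : B ∈ 𝓐) (hne : A ≠ B)
    (hAB : (A ∩ B).Nonempty)
    {a b : (Fin (n + 1) → ℝ) ≃ₜ (Fin (n + 1) → ℝ)}
    (ha : a '' A = coordHyp (n + 1) 0) (hb : b '' B = coordHyp (n + 1) 0)
    (hBp : ∃ x ∈ B, 0 < a x 0) (hBn : ∃ x ∈ B, a x 0 < 0)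
    (hAp : ∃ x ∈ A, 0 < b x 0) (hAn : ∃ x ∈ A, b x 0 < 0) : Crosses A B := by
  have hrel : ∀ {A B : Set (Fin (n + 1) → ℝ)}, A ∈ 𝓐 → B ∈ 𝓐 → A ≠ B → (A ∩ B).Nonempty →
      ∃ m, m + 1 = n ∧ ∃ φ : A ≃ₜ (Fin (m + 1) → ℝ),
        ∀ x : A, (x : Fin (n + 1) → ℝ) ∈ B ↔ φ x 0 = 0 := by
    intro A B hA hB hne hAB
    rcases h𝓐.2.2 B hB A (isFlat_of_mem hA hAB.left) with h | h | h
    · exact (h𝓐.not_subset hA hB hne hAB h).elim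
    · rw [inter_comm] at h
      exact (hAB.ne_empty h).elim
    · obtain ⟨m, φ, hφ⟩ := h.exists_homeomorph
      exact ⟨m, HasDim.eq ⟨φ⟩ (h𝓐.2.1 A hA).hasDim, φ, fun x ↦ by
        rw [← hφ]; exact ⟨fun h ↦ ⟨h, x.2⟩, fun h ↦ h.1⟩⟩
  obtain ⟨m, rfl, φA, hφA⟩ := hrel hA hB hne hAB
  obtain ⟨m', hm', φB, hφB⟩ := hrel hB hA hne.symm (by rwa [inter_comm])
  obtain rfl : m' = m := by omega
  let Φ := (finConsHomeomorph (m' + 1)).trans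
    ((Homeomorph.refl ℝ).prodCongr (finConsHomeomorph m'))
  obtain ⟨T, hT⟩ := exists_homeomorph_complex_prod (A := A) (B := B) (a.trans Φ) (b.trans Φ)
    (mem_iff_of_image_eq_coordHyp ha) (mem_iff_of_image_eq_coordHyp hb)
    (φA.trans (finConsHomeomorph m')) (φB.trans (finConsHomeomorph m')) hφA hφB hBp hBn hAp hAn
  let K : ℂ × (Fin m' → ℝ) ≃ₜ ℝ × (ℝ × (Fin m' → ℝ)) :=
    (Complex.equivRealProdCLM.toHomeomorph.prodCongr (Homeomorph.refl _)).trans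
      (Homeomorph.prodAssoc _ _ _)
  have h0 : ∀ x, (T.trans (K.trans Φ.symm)) x 0 = (T x).1.re := fun x ↦ rfl
  have h1 : ∀ x, (T.trans (K.trans Φ.symm)) x 1 = (T x).1.im := fun x ↦ rfl
  refine ⟨T.trans (K.trans Φ.symm), ?_, ?_⟩
  · ext y
    obtain ⟨x, rfl⟩ := (T.trans (K.trans Φ.symm)).surjective y
    rw [(T.trans (K.trans Φ.symm)).injective.mem_set_image, ← (hT x).1, ← h0]
    exact ⟨fun h _ ↦ h, fun h ↦ h (by omega)⟩
  · ext y
    obtain ⟨x, rfl⟩ := (T.trans (K.trans Φ.symm)).surjective y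
    rw [(T.trans (K.trans Φ.symm)).injective.mem_set_image, ← (hT x).2, ← h1]
    exact ⟨fun h _ ↦ h, fun h ↦ h (by omega)⟩

end Crossing

section Pseudospheres

variable {n : ℕ}

/-- `σ` is a continuous function with zero set `S`, the sign of which is changed by the antipodal
map. -/
structure IsSideFunction (S : Set (Sph n)) (σ : Sph n → ℝ) : Prop where
  continuous : Continuous σ
  mem_iff : ∀ x, x ∈ S ↔ σ x = 0
  antipode_neg : ∀ x, 0 < σ x → σ (antipode n x) < 0
  antipode_pos : ∀ x, σ x < 0 → 0 < σ (antipode n x)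

lemma IsSideFunction.neg {S : Set (Sph n)} {σ : Sph n → ℝ} (h : IsSideFunction S σ) :
    IsSideFunction S fun x ↦ -σ x where
  continuous := h.continuous.neg
  mem_iff x := by rw [h.mem_iff, neg_eq_zero]
  antipode_neg x hx := neg_lt_zero.2 (h.antipode_pos x (neg_pos.1 hx))
  antipode_pos x hx := neg_pos.2 (h.antipode_neg x (neg_lt_zero.1 hx))

lemma isSideFunction_of_image_eq {S : Set (Sph n)} (hS : ∀ x ∈ S, antipode n x ∈ S)
    {e : Sph n ≃ₜ Sph n} (he : e '' S = sphEquator n) :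
    IsSideFunction S fun x ↦ (e x : EuclideanSpace ℝ (Fin (n + 1))) 0 where
  continuous := (continuous_sph_apply 0).comp e.continuous
  mem_iff x := by rw [← e.injective.mem_set_image (s := S), he]; rfl
  antipode_neg _ hx := antipode_neg_of_pos hS he hx
  antipode_pos _ hx := antipode_pos_of_neg hS he hx

lemma IsPseudosphereArr.antipode_mem {𝓢 : Set (Set (Sph n))} (h : IsPseudosphereArr 𝓢)
    {S : Set (Sph n)} (hS : S ∈ 𝓢) : ∀ x ∈ S, antipode n x ∈ S :=
  fun x hx ↦ (h.2.1 S hS).1 x hx _ rfl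

/-- The two sides of a pseudosphere are the components of its complement. -/
theorem IsPseudosphereArr.exists_isSideFunction_component {𝓢 : Set (Set (Sph n))}
    (h : IsPseudosphereArr 𝓢) {S : Set (Sph n)} (hS : S ∈ 𝓢) {x : Sph n} (hx : x ∉ S) :
    ∃ σ, IsSideFunction S σ ∧ connectedComponentIn Sᶜ x = {y | 0 < σ y} := by
  obtain ⟨e, he⟩ := (h.2.1 S hS).2
  have hσ := isSideFunction_of_image_eq (h.antipode_mem hS) he
  have key : ∀ σ, IsSideFunction S σ → IsPreconnected {y | 0 < σ y} → 0 < σ x →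
      connectedComponentIn Sᶜ x = {y | 0 < σ y} := by
    intro σ hσ hc hpos
    refine Subset.antisymm (fun y hy ↦ ?_) ?_
    · refine pos_of_isPreconnected isPreconnected_connectedComponentIn hσ.continuous.continuousOn
        (fun z hz hz0 ↦ ?_) (mem_connectedComponentIn hx) hpos y hy
      exact connectedComponentIn_subset _ _ hz ((hσ.mem_iff z).2 hz0)
    · refine hc.subset_connectedComponentIn hpos fun y hy hyS ↦ ?_
      exact (show 0 < σ y from hy).ne' ((hσ.mem_iff y).1 hyS)
  rcases lt_or_gt_of_ne fun h0 ↦ hx ((hσ.mem_iff x).2 h0) with hlt | hgt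
  · refine ⟨_, hσ.neg, key _ hσ.neg ?_ (neg_pos.2 hlt)⟩
    have := e.isPreconnected_preimage.2 (isPreconnected_hemisphere_neg n)
    simpa only [neg_pos, preimage_ofPred_eq] using this
  · exact ⟨_, hσ, key _ hσ (e.isPreconnected_preimage.2 (isPreconnected_hemisphere_pos n)) hgt⟩

/-- Near a common point, a pseudosphere `T` meets both sides of a pseudosphere `S` which cuts
`T` in an equator. -/
theorem IsSideFunction.exists_pos_neg {S T U : Set (Sph n)} {σ : Sph n → ℝ}
    (hσ : IsSideFunction S σ) (hT : ∀ x ∈ T, antipode n x ∈ T) {d : ℕ} (ψ : T ≃ₜ Sph d)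
    (hψ : ψ '' {y : T | (y : Sph n) ∈ S} = sphEquator d) (hU : IsOpen U) {p : Sph n}
    (hpS : p ∈ S) (hpT : p ∈ T) (hpU : p ∈ U) :
    (∃ y ∈ T ∩ U, 0 < σ y) ∧ ∃ y ∈ T ∩ U, σ y < 0 := by
  have hmem : ∀ y : T, (y : Sph n) ∈ S ↔ ψ y ∈ sphEquator d := fun y ↦ by
    rw [← hψ, ψ.injective.mem_set_image]; rfl
  have hne : ∀ z : Sph d, (z : EuclideanSpace ℝ (Fin (d + 1))) 0 ≠ 0 →
      σ (ψ.symm z) ≠ 0 := by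
    intro z hz h0
    have := (hmem (ψ.symm z)).1 ((hσ.mem_iff _).2 h0)
    rw [ψ.apply_symm_apply] at this
    exact hz this
  have hV : IsOpen {z : Sph d | (ψ.symm z : Sph n) ∈ U} :=
    hU.preimage (continuous_subtype_val.comp ψ.symm.continuous)
  have hpV : ψ ⟨p, hpT⟩ ∈ {z : Sph d | (ψ.symm z : Sph n) ∈ U} := by
    change (ψ.symm (ψ ⟨p, hpT⟩) : Sph n) ∈ U
    rwa [ψ.symm_apply_apply]
  obtain ⟨z₁, hz₁U, hz₁⟩ := mem_closure_iff.1
    (mem_closure_hemisphere_pos ((hmem ⟨p, hpT⟩).1 hpS)) _ hV hpV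
  obtain ⟨z₂, hz₂U, hz₂⟩ := mem_closure_iff.1
    (mem_closure_hemisphere_neg ((hmem ⟨p, hpT⟩).1 hpS)) _ hV hpV
  have key : ∀ τ, IsSideFunction S τ → 0 < τ (ψ.symm z₁) → τ (ψ.symm z₂) < 0 := by
    intro τ hτ hpos
    have hτc : Continuous fun z ↦ τ (ψ.symm z) :=
      hτ.continuous.comp (continuous_subtype_val.comp ψ.symm.continuous)
    have hneτ : ∀ z : Sph d, (z : EuclideanSpace ℝ (Fin (d + 1))) 0 ≠ 0 →
        τ (ψ.symm z) ≠ 0 := fun z hz h0 ↦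
      hne z hz ((hσ.mem_iff _).1 ((hτ.mem_iff _).2 h0))
    have hP := pos_of_isPreconnected (isPreconnected_hemisphere_pos d) hτc.continuousOn
      (fun z hz ↦ hneτ z (ne_of_gt hz)) hz₁ hpos
    set w : T := ⟨antipode n (ψ.symm z₁), hT _ (ψ.symm z₁).2⟩ with hw
    have hwneg : τ (ψ.symm (ψ w)) < 0 := by
      rw [ψ.symm_apply_apply]; exact hτ.antipode_neg _ hpos
    have hw0 : (ψ w : EuclideanSpace ℝ (Fin (d + 1))) 0 < 0 := by
      by_contra! h0
      rcases h0.eq_or_lt with h0 | h0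
      · have := (hmem w).2 h0.symm
        rw [hτ.mem_iff] at this
        rw [ψ.symm_apply_apply] at hwneg
        exact hwneg.ne this
      · exact (hP (ψ w) h0).not_gt hwneg
    have := pos_of_isPreconnected (isPreconnected_hemisphere_neg d) hτc.neg.continuousOn
      (fun z hz ↦ neg_ne_zero.2 (hneτ z (ne_of_lt hz))) (a := ψ w) hw0 (neg_pos.2 hwneg) z₂ hz₂
    exact neg_pos.1 this
  rcases lt_or_gt_of_ne (hne z₁ (ne_of_gt hz₁)) with h | h
  · have h2 := key _ hσ.neg (neg_pos.2 h)
    exact ⟨⟨_, ⟨(ψ.symm z₂).2, hz₂U⟩, neg_lt_zero.1 h2⟩, _, ⟨(ψ.symm z₁).2, hz₁U⟩, h⟩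
  · exact ⟨⟨_, ⟨(ψ.symm z₁).2, hz₁U⟩, h⟩, _, ⟨(ψ.symm z₂).2, hz₂U⟩, key _ hσ h⟩

/-- `X` is a sphere and `Y` is homeomorphic to an equator of it. -/
def IsEquatorType (X Y : Set (Sph n)) : Prop :=
  ∃ d, Nonempty (X ≃ₜ Sph d) ∧ Nonempty (Y ≃ₜ sphEquator d)

lemma IsEquatorType.nonempty_homeomorph {X Y Y' : Set (Sph n)} (h : IsEquatorType X Y)
    (h' : IsEquatorType X Y') : Nonempty (Y ≃ₜ Y') := by
  obtain ⟨d, ⟨φ⟩, ⟨ψ⟩⟩ := h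
  obtain ⟨d', ⟨φ'⟩, ⟨ψ'⟩⟩ := h'
  obtain rfl := eq_of_homeomorph_sph (φ.symm.trans φ')
  exact ⟨ψ.trans ψ'.symm⟩

lemma IsEquatorType.isEmpty_homeomorph {X Y : Set (Sph n)} (h : IsEquatorType X Y) :
    IsEmpty (X ≃ₜ Y) := by
  obtain ⟨d, ⟨φ⟩, ⟨ψ⟩⟩ := h
  exact ⟨fun χ ↦ (isEmpty_homeomorph_sph_sphEquator d).false ((φ.symm.trans χ).trans ψ)⟩

lemma IsPseudosphereArr.isEquatorType {𝓢 : Set (Set (Sph n))} (h : IsPseudosphereArr 𝓢)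
    {𝓣 : Set (Set (Sph n))} (h𝓣 : 𝓣 ⊆ 𝓢) {S : Set (Sph n)} (hS : S ∈ 𝓢)
    (hne : ¬ ⋂₀ 𝓣 ⊆ S) : IsEquatorType (⋂₀ 𝓣) (⋂₀ 𝓣 ∩ S) := by
  obtain ⟨d, ψ, hψ⟩ := h.2.2.2 𝓣 h𝓣 S hS hne
  refine ⟨d, ⟨ψ⟩, ⟨?_⟩⟩
  let sw : ↥(⋂₀ 𝓣 ∩ S) ≃ₜ {y : ↥(⋂₀ 𝓣) | (y : Sph n) ∈ S} :=
    { toFun := fun x ↦ ⟨⟨x.1, x.2.1⟩, x.2.2⟩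
      invFun := fun x ↦ ⟨x.1.1, x.1.2, x.2⟩
      left_inv := fun x ↦ rfl
      right_inv := fun x ↦ rfl
      continuous_toFun := by fun_prop
      continuous_invFun := by fun_prop }
  exact sw.trans ((ψ.image _).trans (Homeomorph.setCongr hψ))

lemma IsPseudosphereArr.isEquatorType_inter {𝓢 : Set (Set (Sph n))} (h : IsPseudosphereArr 𝓢)
    {S T : Set (Sph n)} (hS : S ∈ 𝓢) (hT : T ∈ 𝓢) (hne : ¬ S ⊆ T) : IsEquatorType S (S ∩ T) := by
  have := h.isEquatorType (𝓣 := {S}) (by simpa using hS) hT (by simpa using hne)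
  rwa [sInter_singleton] at this

lemma IsPseudosphereArr.isEquatorType_inter_inter {𝓢 : Set (Set (Sph n))}
    (h : IsPseudosphereArr 𝓢) {S T R : Set (Sph n)} (hS : S ∈ 𝓢) (hT : T ∈ 𝓢) (hR : R ∈ 𝓢)
    (hne : ¬ S ∩ T ⊆ R) : IsEquatorType (S ∩ T) (S ∩ T ∩ R) := by
  have := h.isEquatorType (𝓣 := {S, T}) (by rintro _ (rfl | rfl) <;> assumption) hR
    (by simpa [sInter_pair] using hne)
  rwa [sInter_pair] at this

/-- Pseudospheres meeting only inside a third one `R` have the same intersection with `R`. -/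
theorem IsPseudosphereArr.inter_eq_inter {𝓢 : Set (Set (Sph n))} (h : IsPseudosphereArr 𝓢)
    {S T R : Set (Sph n)} (hS : S ∈ 𝓢) (hT : T ∈ 𝓢) (hR : R ∈ 𝓢) (hST : ¬ S ⊆ T) (hSR : ¬ S ⊆ R)
    (hsub : S ∩ T ⊆ R) : S ∩ R = S ∩ T := by
  refine Subset.antisymm (fun x hx ↦ ⟨hx.1, ?_⟩) fun x hx ↦ ⟨hx.1, hsub hx⟩
  by_contra hxT
  have h1 := h.isEquatorType_inter_inter hS hR hT fun h ↦ hxT (h hx)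
  have h2 : S ∩ R ∩ T = S ∩ T := by
    ext y
    exact ⟨fun hy ↦ ⟨hy.1.1, hy.2⟩, fun hy ↦ ⟨⟨hy.1, hsub hy⟩, hy.2⟩⟩
  rw [h2] at h1
  obtain ⟨χ⟩ := (h.isEquatorType_inter hS hR hSR).nonempty_homeomorph
    (h.isEquatorType_inter hS hT hST)
  exact h1.isEmpty_homeomorph.false χ

/-- Meeting only inside a fixed pseudosphere `R` is a transitive relation. -/
theorem IsPseudosphereArr.inter_subset_trans {𝓢 : Set (Set (Sph n))} (h : IsPseudosphereArr 𝓢)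
    {S T S' R : Set (Sph n)} (hS : S ∈ 𝓢) (hT : T ∈ 𝓢) (hS' : S' ∈ 𝓢) (hR : R ∈ 𝓢)
    (hSR : ¬ S ⊆ R) (hTR : ¬ T ⊆ R) (hSR' : ¬ S' ⊆ R)
    (hST : S ∩ T ⊆ R) (hTS : T ∩ S' ⊆ R) (hSS : ¬ S ⊆ S') : S ∩ S' ⊆ R := by
  by_contra hne
  have hn : ∀ {A B : Set (Sph n)}, ¬ A ⊆ R → A ∩ B ⊆ R → ¬ A ⊆ B :=
    fun hA hAB h ↦ hA fun x hx ↦ hAB ⟨hx, h hx⟩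
  have hTS' := hTS
  have hST' := hST
  rw [inter_comm] at hTS' hST'
  have e1 := h.inter_eq_inter hS hT hR (hn hSR hST) hSR hST
  have e2 := h.inter_eq_inter hT hS hR (hn hTR hST') hTR hST'
  have e3 := h.inter_eq_inter hT hS' hR (hn hTR hTS) hTR hTS
  have e4 := h.inter_eq_inter hS' hT hR (hn hSR' hTS') hSR' hTS'
  have e5 : S ∩ R = S' ∩ R := by
    rw [e1, inter_comm, ← e2, e3, inter_comm, ← e4]
  have e6 : S ∩ S' ∩ R = S ∩ R := by
    rw [inter_assoc, ← e5, ← inter_assoc, inter_self]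
  have h1 := h.isEquatorType_inter_inter hS hS' hR hne
  rw [e6] at h1
  obtain ⟨χ⟩ := (h.isEquatorType_inter hS hS' hSS).nonempty_homeomorph
    (h.isEquatorType_inter hS hR hSR)
  exact h1.isEmpty_homeomorph.false χ

end Pseudospheres

section Projectivization

variable {n : ℕ}

lemma IsTopoplane.nonempty {H : Set (Fin n → ℝ)} (h : IsTopoplane H) : H.Nonempty := by
  obtain ⟨e, he⟩ := h
  rw [← image_nonempty (f := e), he]
  exact ⟨0, fun _ ↦ rfl⟩

/-- A set meeting both sides of `A` with respect to some function with zero set `A` meets both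
sides with respect to any homeomorphism straightening `A`. -/
lemma exists_pos_neg_of_sides {A B : Set (Fin (n + 1) → ℝ)}
    {a : (Fin (n + 1) → ℝ) ≃ₜ (Fin (n + 1) → ℝ)} (ha : a '' A = coordHyp (n + 1) 0)
    {φ : (Fin (n + 1) → ℝ) → ℝ} (hφ : Continuous φ) (hA : ∀ x, x ∈ A ↔ φ x = 0)
    (hp : ∃ x ∈ B, 0 < φ x) (hn : ∃ x ∈ B, φ x < 0) :
    (∃ x ∈ B, 0 < a x 0) ∧ ∃ x ∈ B, a x 0 < 0 := by
  have hA' := mem_iff_of_image_eq_coordHyp ha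
  obtain ⟨x, hx, hx0⟩ := hp
  obtain ⟨y, hy, hy0⟩ := hn
  have key : ∀ I : Set ℝ, Convex ℝ I → (0 : ℝ) ∉ I → a x 0 ∈ I → a y 0 ∉ I := by
    intro I hI h0 hxI hyI
    have hU : IsPreconnected (a ⁻¹' ((fun z ↦ z 0) ⁻¹' I)) := by
      rw [a.isPreconnected_preimage]
      exact (hI.linear_preimage (LinearMap.proj (R := ℝ) (φ := fun _ ↦ ℝ) 0)).isPreconnected
    refine (pos_of_isPreconnected hU hφ.continuousOn (fun z hz hz0 ↦ h0 ?_) (a := x) hxI hx0 y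
      hyI).not_gt hy0
    have := (hA' z).1 ((hA z).2 hz0)
    rwa [← this]
  have hx' : a x 0 ≠ 0 := fun h ↦ hx0.ne' ((hA x).1 ((hA' x).2 h))
  have hy' : a y 0 ≠ 0 := fun h ↦ hy0.ne ((hA y).1 ((hA' y).2 h))
  rcases lt_or_gt_of_ne hx' with h | h
  · exact ⟨⟨y, hy, lt_of_le_of_ne (not_lt.1 (key _ (convex_Iio 0) self_notMem_Iio h)) hy'.symm⟩,
      x, hx, h⟩
  · exact ⟨⟨x, hx, h⟩,
      y, hy, lt_of_le_of_ne (not_lt.1 (key _ (convex_Ioi 0) self_notMem_Ioi h)) hy'⟩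

end Projectivization

/-- if an arrangement `𝓐` of topoplanes in `ℝⁿ` is projectivizable, then
`𝓐` is affine and parallelism (= disjointness) is transitive on `𝓐`. -/
theorem statement10 {n : ℕ} (hn : 1 ≤ n) (𝓐 : Set (Set (Fin n → ℝ)))
    (h𝓐 : IsArrangement 𝓐) (hproj : Projectivizable 𝓐) :
    PairwiseAffine 𝓐 ∧
      ∀ H ∈ 𝓐, ∀ H' ∈ 𝓐, ∀ H'' ∈ 𝓐, H ≠ H' → H' ≠ H'' → H ≠ H'' →
        H ∩ H' = ∅ → H' ∩ H'' = ∅ → H ∩ H'' = ∅ := by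
  obtain ⟨n, rfl⟩ := Nat.exists_eq_add_of_le' hn
  obtain ⟨𝓢, h𝓢, S₀, hS₀, D, ⟨x₀, hx₀, hD⟩, f, hf⟩ := hproj
  obtain ⟨θ, hθ, hDθ⟩ := h𝓢.exists_isSideFunction_component hS₀ hx₀
  rw [← hD] at hDθ
  have hDS : ∀ x ∈ D, x ∉ S₀ := fun x hx h ↦ by
    rw [hDθ] at hx; exact (show 0 < θ x from hx).ne' ((hθ.mem_iff x).1 h)
  have hDo : IsOpen D := by rw [hDθ]; exact isOpen_lt continuous_const hθ.continuous
  have hex : ∀ A ∈ 𝓐, ∃ S ∈ 𝓢, ∀ x, x ∈ A ↔ (f x : Sph (n + 1)) ∈ S := by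
    intro A hA
    have h1 : Subtype.val '' (⇑f '' A) ∈ {B : Set (Sph (n + 1)) | ∃ S ∈ 𝓢, S ≠ S₀ ∧ B = S ∩ D} := by
      rw [← hf]; exact ⟨A, hA, rfl⟩
    obtain ⟨S, hS, -, h2⟩ := h1
    refine ⟨S, hS, fun x ↦ ?_⟩
    have h3 : (f x : Sph (n + 1)) ∈ Subtype.val '' (⇑f '' A) ↔ x ∈ A := by
      rw [Subtype.val_injective.mem_set_image, f.injective.mem_set_image]
    rw [← h3, h2]
    exact ⟨fun h ↦ h.1, fun h ↦ ⟨h, (f x).2⟩⟩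
  choose! s hs hsA using hex
  have hsub : ∀ A ∈ 𝓐, ∀ B ∈ 𝓐, s A ⊆ s B → A ⊆ B := fun A hA B hB h x hx ↦
    (hsA B hB x).2 (h ((hsA A hA x).1 hx))
  have hns : ∀ A ∈ 𝓐, ¬ s A ⊆ S₀ := fun A hA h ↦ by
    obtain ⟨x, hx⟩ := (h𝓐.2.1 A hA).nonempty
    exact hDS _ (f x).2 (h ((hsA A hA x).1 hx))
  have hdisj : ∀ A ∈ 𝓐, ∀ B ∈ 𝓐, (A ∩ B = ∅ ↔ s A ∩ s B ⊆ S₀) := by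
    intro A hA B hB
    constructor
    · intro h
      have hpos : ∀ y ∈ s A ∩ s B, ¬ 0 < θ y := by
        intro y hy h0
        have hyD : y ∈ D := by rw [hDθ]; exact h0
        obtain ⟨x, hx⟩ := f.surjective ⟨y, hyD⟩
        have hxy : (f x : Sph (n + 1)) = y := congrArg Subtype.val hx
        have : x ∈ A ∩ B := ⟨(hsA A hA x).2 (by rw [hxy]; exact hy.1),
          (hsA B hB x).2 (by rw [hxy]; exact hy.2)⟩
        rw [h] at this
        exact this
      intro y hy
      by_contra hyS
      rcases lt_or_gt_of_ne fun h0 ↦ hyS ((hθ.mem_iff y).2 h0) with h0 | h0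
      · exact hpos _ ⟨h𝓢.antipode_mem (hs A hA) y hy.1, h𝓢.antipode_mem (hs B hB) y hy.2⟩
          (hθ.antipode_pos y h0)
      · exact hpos y hy h0
    · intro h
      rw [eq_empty_iff_forall_notMem]
      intro x hx
      exact hDS _ (f x).2 (h ⟨(hsA A hA x).1 hx.1, (hsA B hB x).1 hx.2⟩)
  refine ⟨fun A hA B hB hne ↦ ?_, fun A hA B hB C hC _ _ hAC hAB hBC ↦ ?_⟩
  · rw [or_iff_not_imp_left, ← Ne, ← nonempty_iff_ne_empty]
    intro hAB
    have hside : ∀ A ∈ 𝓐, ∀ B ∈ 𝓐, A ≠ B → (A ∩ B).Nonempty →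
        ∀ a : (Fin (n + 1) → ℝ) ≃ₜ (Fin (n + 1) → ℝ), a '' A = coordHyp (n + 1) 0 →
          (∃ x ∈ B, 0 < a x 0) ∧ ∃ x ∈ B, a x 0 < 0 := by
      intro A hA B hB hne hAB a ha
      obtain ⟨e, he⟩ := (h𝓢.2.1 _ (hs A hA)).2
      have hσ := isSideFunction_of_image_eq (h𝓢.antipode_mem (hs A hA)) he
      set σ := fun x ↦ (e x : EuclideanSpace ℝ (Fin (n + 1 + 1))) 0
      obtain ⟨d, ψ, hψ⟩ := h𝓢.2.2.2 {s B} (by simpa using hs B hB) (s A) (hs A hA)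
        (by
          rw [sInter_singleton]
          exact fun h ↦ h𝓐.not_subset hB hA hne.symm (by rwa [inter_comm]) (hsub B hB A hA h))
      obtain ⟨p, hpA, hpB⟩ := hAB
      obtain ⟨⟨y, hy, hy0⟩, z, hz, hz0⟩ := hσ.exists_pos_neg
        (by rw [sInter_singleton]; exact h𝓢.antipode_mem (hs B hB)) ψ hψ hDo
        ((hsA A hA p).1 hpA) (by rw [sInter_singleton]; exact (hsA B hB p).1 hpB) (f p).2
      rw [sInter_singleton] at hy hz
      have lift : ∀ y ∈ s B ∩ D, ∃ x ∈ B, (f x : Sph (n + 1)) = y := fun y hy ↦ by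
        obtain ⟨x, hx⟩ := f.surjective ⟨y, hy.2⟩
        have hxy : (f x : Sph (n + 1)) = y := congrArg Subtype.val hx
        exact ⟨x, (hsA B hB x).2 (by rw [hxy]; exact hy.1), hxy⟩
      obtain ⟨y, hyB, rfl⟩ := lift y hy
      obtain ⟨z, hzB, rfl⟩ := lift z hz
      exact exists_pos_neg_of_sides ha
        (hσ.continuous.comp (continuous_subtype_val.comp f.continuous))
        (fun x ↦ (hsA A hA x).trans (hσ.mem_iff _)) ⟨y, hyB, hy0⟩ ⟨z, hzB, hz0⟩
    obtain ⟨a, ha⟩ := h𝓐.2.1 A hA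
    obtain ⟨b, hb⟩ := h𝓐.2.1 B hB
    obtain ⟨h1, h2⟩ := hside A hA B hB hne hAB a ha
    obtain ⟨h3, h4⟩ := hside B hB A hA hne.symm (by rwa [inter_comm]) b hb
    exact h𝓐.crosses hA hB hne hAB ha hb h1 h2 h3 h4
  · by_contra hne
    rw [hdisj A hA B hB] at hAB
    rw [hdisj B hB C hC] at hBC
    refine hne ((hdisj A hA C hC).2 (h𝓢.inter_subset_trans (hs A hA) (hs B hB) (hs C hC) hS₀
      (hns A hA) (hns B hB) (hns C hC) hAB hBC fun h ↦ ?_))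
    exact h𝓐.not_subset hA hC hAC (nonempty_iff_ne_empty.2 hne) (hsub A hA C hC h)
end

section
/- Let 𝓗 be a finite set of topolines in ℝ² such that any two distinct members of 𝓗 intersect in at most one point. Then 𝓗 is an arrangement of topolines, where for a flat Y of dimension 0 (a single point) a relative topoplane in Y is taken to be impossible and the arrangement condition for such Y requires H ∩ Y = ∅ or Y ⊆ H for every H ∈ 𝓗. -/
open Set

/-- The first coordinate axis `{x | x₁ = 0}` of the plane is homeomorphic to the line. -/
def coordHypTwoHomeomorph : coordHyp 2 0 ≃ₜ (Fin 1 → ℝ) where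
  toFun x := fun _ => (x : Fin 2 → ℝ) 1
  invFun y := ⟨![0, y 0], fun _ => rfl⟩
  left_inv x := by
    have h : (x : Fin 2 → ℝ) 0 = 0 := x.2 two_pos
    ext i
    fin_cases i
    · exact h.symm
    · rfl
  right_inv y := by
    ext i
    rw [Subsingleton.elim i 0]
    rfl
  continuous_toFun := continuous_pi fun _ => (continuous_apply 1).comp continuous_subtype_val
  continuous_invFun := by fun_prop

theorem coordHyp_one_zero : coordHyp 1 0 = {0} := by
  ext x
  constructor
  · intro h
    ext i
    rw [Subsingleton.elim i 0]
    exact h one_pos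
  · rintro rfl _
    rfl

theorem IsTopoplane.hasDim_one {H : Set (Fin 2 → ℝ)} (hH : IsTopoplane H) : HasDim H 1 := by
  obtain ⟨e, he⟩ := hH
  exact ⟨((e.image H).trans (Homeomorph.setCongr he)).trans coordHypTwoHomeomorph⟩

theorem IsTopoplane.isRelTopoplane_univ {n : ℕ} (hn : 1 ≤ n) {H : Set (Fin n → ℝ)}
    (hH : IsTopoplane H) : IsRelTopoplane univ H := by
  obtain ⟨e, he⟩ := hH
  refine ⟨subset_univ H, n, hn, (Homeomorph.Set.univ _).trans e, ?_⟩
  rw [← he]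
  ext x
  constructor
  · rintro ⟨y, hy, rfl⟩
    exact ⟨y, hy, rfl⟩
  · rintro ⟨y, hy, rfl⟩
    exact ⟨⟨y, mem_univ y⟩, hy, rfl⟩

/-- A point of a one-dimensional set is a relative topoplane in it. -/
theorem HasDim.isRelTopoplane_singleton {n : ℕ} {Y : Set (Fin n → ℝ)} (hY : HasDim Y 1)
    {p : Fin n → ℝ} (hp : p ∈ Y) : IsRelTopoplane Y {p} := by
  obtain ⟨φ⟩ := hY
  refine ⟨singleton_subset_iff.2 hp, 1, le_rfl,
    φ.trans (Homeomorph.addRight (-φ ⟨p, hp⟩)), ?_⟩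
  have hpt : {y : Y | (y : Fin n → ℝ) ∈ ({p} : Set (Fin n → ℝ))} = {⟨p, hp⟩} := by
    ext y
    simp [Subtype.ext_iff]
  rw [hpt, image_singleton, coordHyp_one_zero]
  simp

theorem Set.Subsingleton.subset_or_inter_eq_empty {α : Type*} {Y : Set α}
    (hY : Y.Subsingleton) (H : Set α) : Y ⊆ H ∨ H ∩ Y = ∅ := by
  rcases (H ∩ Y).eq_empty_or_nonempty with h | ⟨x, hxH, hxY⟩
  · exact Or.inr h
  · exact Or.inl fun y hy => hY hxY hy ▸ hxH

/-- If distinct members meet in at most one point, a flat is the whole space, a member, or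
has at most one point. -/
theorem IsFlat.eq_univ_or_mem_or_subsingleton {n : ℕ} {𝓗 : Set (Set (Fin n → ℝ))}
    (hpair : ∀ H₁ ∈ 𝓗, ∀ H₂ ∈ 𝓗, H₁ ≠ H₂ → (H₁ ∩ H₂).Subsingleton)
    {Y : Set (Fin n → ℝ)} (hY : IsFlat 𝓗 Y) : Y = univ ∨ Y ∈ 𝓗 ∨ Y.Subsingleton := by
  obtain ⟨⟨𝓢, h𝓢, rfl⟩, -⟩ := hY
  rcases 𝓢.eq_empty_or_nonempty with rfl | hne
  · exact Or.inl sInter_empty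
  · rcases hne.exists_eq_singleton_or_nontrivial with ⟨K, rfl⟩ | ⟨K₁, h₁, K₂, h₂, h⟩
    · rw [sInter_singleton]
      exact Or.inr (Or.inl (h𝓢 rfl))
    · exact Or.inr (Or.inr ((hpair K₁ (h𝓢 h₁) K₂ (h𝓢 h₂) h).anti
        (subset_inter (sInter_subset_of_mem h₁) (sInter_subset_of_mem h₂))))

/-- a finite set of topolines in `ℝ²` any two distinct members of which meet
in at most one point is an arrangement of topolines. -/
theorem statement16 (𝓗 : Set (Set (Fin 2 → ℝ))) (hfin : 𝓗.Finite)
    (htopo : ∀ H ∈ 𝓗, IsTopoplane H)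
    (hpair : ∀ H₁ ∈ 𝓗, ∀ H₂ ∈ 𝓗, H₁ ≠ H₂ → (H₁ ∩ H₂).Subsingleton) :
    IsArrangement 𝓗 := by
  refine ⟨hfin, htopo, fun H hH Y hY => ?_⟩
  rcases hY.eq_univ_or_mem_or_subsingleton hpair with rfl | hY𝓗 | hsub
  · rw [inter_univ]
    exact Or.inr (Or.inr ((htopo H hH).isRelTopoplane_univ one_le_two))
  · rcases eq_or_ne H Y with rfl | hne
    · exact Or.inl Subset.rfl
    · rcases (hpair H hH Y hY𝓗 hne).eq_empty_or_singleton with h | ⟨p, hp⟩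
      · exact Or.inr (Or.inl h)
      · have hpY : p ∈ Y := (hp.symm ▸ mem_singleton p : p ∈ H ∩ Y).2
        rw [hp]
        exact Or.inr (Or.inr ((htopo Y hY𝓗).hasDim_one.isRelTopoplane_singleton hpY))
  · exact (hsub.subset_or_inter_eq_empty H).imp_right Or.inl
end
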